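/- arXiv:0904.3526 — 2 statements merged into one kernel-verified Lean document; each statement's English description precedes it below -/
import Mathlib

section
/- For any constant ω > 0 and all sufficiently large integers N, \sum_{p \le N} | \sum_{d | p-1, \sqrt{N} L^{-ω} < d < \sqrt{N} L^{ω}} χ(d) |^2 \ll N L^{-1} (\log L)^7, where p runs over primes, L = log N, and the implied constant depends only on ω. -/
open Finset

noncomputable section

/-- The non-principal Dirichlet character modulo 4. -/
def chi4 (n : ℕ) : ℝ := if n % 4 = 1 then 1 else if n % 4 = 3 then -1 else 0

lemma abs_chi4_le_one (n : ℕ) : |chi4 n| ≤ 1 := by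
  unfold chi4
  split_ifs <;> simp

lemma chi4_mul (m n : ℕ) : chi4 (m * n) = chi4 m * chi4 n := by
  unfold chi4
  rw [Nat.mul_mod]
  have hm : m % 4 < 4 := Nat.mod_lt _ (by norm_num)
  have hn : n % 4 < 4 := Nat.mod_lt _ (by norm_num)
  generalize m % 4 = x at *
  generalize n % 4 = y at *
  interval_cases x <;> interval_cases y <;> norm_num

lemma chi4_add_two_mul_odd (a : ℕ) {q : ℕ} (hq : Odd q) : chi4 (a + 2 * q) = -chi4 a := by
  obtain ⟨k, rfl⟩ := hq
  unfold chi4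
  have h : (a + 2 * (2 * k + 1)) % 4 = (a % 4 + 2) % 4 := by omega
  rw [h]
  have hm : a % 4 < 4 := Nat.mod_lt _ (by norm_num)
  generalize a % 4 = x at *
  interval_cases x <;> norm_num

lemma abs_sum_Ico_le_of_antiperiodic {f : ℕ → ℝ} {q : ℕ} (hf : ∀ a, |f a| ≤ 1)
    (hq : 0 < q) (h : ∀ a, f (a + q) = -f a) (u v : ℕ) :
    |∑ a ∈ Ico u v, f a| ≤ 2 * q := by
  induction hn : v - u using Nat.strong_induction_on generalizing u with
  | _ n ih =>
    by_cases hlt : n < 2 * q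
    · calc |∑ a ∈ Ico u v, f a| ≤ ∑ a ∈ Ico u v, |f a| := abs_sum_le_sum_abs _ _
        _ ≤ ∑ a ∈ Ico u v, (1 : ℝ) := sum_le_sum fun a _ => hf a
        _ = (n : ℝ) := by simp [hn]
        _ ≤ 2 * q := by exact_mod_cast hlt.le
    · have h1 := sum_Ico_consecutive f (show u ≤ u + q by omega) (show u + q ≤ v by omega)
      have h2 := sum_Ico_consecutive f (show u + q ≤ u + q + q by omega)
        (show u + q + q ≤ v by omega)
      have h3 : ∑ a ∈ Ico (u + q) (u + q + q), f a = -∑ a ∈ Ico u (u + q), f a := by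
        rw [← sum_neg_distrib, ← sum_Ico_add' f u (u + q) q]
        exact sum_congr rfl fun a _ => h a
      rw [← h1, ← h2, h3, add_neg_cancel_left]
      exact ih (v - (u + q + q)) (by omega) (u + q + q) rfl

lemma abs_sum_range_mul_le {f h : ℕ → ℝ} {K : ℝ} (hf : ∀ m, |∑ i ∈ range m, f i| ≤ K)
    (hh : Antitone h) (h0 : ∀ i, 0 ≤ h i) (n : ℕ) :
    |∑ i ∈ range n, h i * f i| ≤ K * h 0 := by
  have hparts := sum_range_by_parts h f n
  simp only [smul_eq_mul] at hparts
  rw [hparts]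
  calc _ ≤ |h (n - 1) * ∑ i ∈ range n, f i| +
        |∑ i ∈ range (n - 1), (h (i + 1) - h i) * ∑ j ∈ range (i + 1), f j| := abs_sub _ _
    _ ≤ h (n - 1) * K + ∑ i ∈ range (n - 1), (h i - h (i + 1)) * K := by
        gcongr
        · rw [abs_mul, abs_of_nonneg (h0 _)]
          exact mul_le_mul_of_nonneg_left (hf _) (h0 _)
        · refine (abs_sum_le_sum_abs _ _).trans (sum_le_sum fun i _ => ?_)
          have hi : h (i + 1) ≤ h i := hh (Nat.le_succ i)
          rw [abs_mul, abs_sub_comm, abs_of_nonneg (sub_nonneg.2 hi)]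
          exact mul_le_mul_of_nonneg_left (hf _) (sub_nonneg.2 hi)
    _ = K * h 0 := by
        rw [← sum_mul, sum_range_sub']
        ring

lemma abs_sum_Ico_chi4_div_le {A : ℝ} (hA : 0 < A) {u v : ℕ} (h : ∀ a ∈ Ico u v, A < a) :
    |∑ a ∈ Ico u v, chi4 a / a| ≤ 4 / A := by
  rcases le_or_gt v u with huv | huv
  · rw [Ico_eq_empty_of_le huv]
    rw [sum_empty, abs_zero]
    positivity
  · have hu : A < u := h u (by simp [huv])
    have hu0 : (0 : ℝ) < u := hA.trans hu
    rw [sum_Ico_eq_sum_range]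
    have key := abs_sum_range_mul_le (f := fun i => chi4 (u + i))
      (h := fun i => 1 / ((u : ℝ) + i)) (K := 4) (fun m => ?_) (fun i j hij => ?_)
      (fun i => by positivity) (v - u)
    · refine (le_of_eq ?_).trans (key.trans ?_)
      · congr 1
        refine sum_congr rfl fun i _ => ?_
        push_cast
        ring
      · simp only [Nat.cast_zero, add_zero]
        rw [mul_one_div]
        gcongr
    · have := abs_sum_Ico_le_of_antiperiodic (f := chi4) (q := 2) abs_chi4_le_one two_pos
        (fun a => chi4_add_two_mul_odd a odd_one) u (u + m)
      rw [sum_Ico_eq_sum_range] at this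
      rw [Nat.add_sub_cancel_left] at this
      exact this.trans (by norm_num)
    · dsimp only
      gcongr

lemma exists_filter_Icc_eq_Ico {P : ℕ → Prop} [DecidablePred P]
    (hP : ∀ a b c, a ≤ b → b ≤ c → P a → P c → P b) (M : ℕ) :
    ∃ u v, {a ∈ Icc 1 M | P a} = Ico u v := by
  rcases ({a ∈ Icc 1 M | P a}).eq_empty_or_nonempty with he | hne
  · exact ⟨0, 0, by simpa using he⟩
  · refine ⟨({a ∈ Icc 1 M | P a}).min' hne, ({a ∈ Icc 1 M | P a}).max' hne + 1, ?_⟩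
    have h1 := mem_filter.1 (({a ∈ Icc 1 M | P a}).min'_mem hne)
    have h2 := mem_filter.1 (({a ∈ Icc 1 M | P a}).max'_mem hne)
    ext b
    constructor
    · intro hb
      exact mem_Ico.2 ⟨min'_le _ _ hb, Nat.lt_succ_of_le (le_max' _ _ hb)⟩
    · intro hb
      obtain ⟨hb1, hb2⟩ := mem_Ico.1 hb
      have hb3 := Nat.lt_succ_iff.1 hb2
      have h11 := mem_Icc.1 h1.1
      have h21 := mem_Icc.1 h2.1
      exact mem_filter.2 ⟨mem_Icc.2 ⟨h11.1.trans hb1, hb3.trans h21.2⟩,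
        hP _ b _ hb1 hb3 h1.2 h2.2⟩

lemma sum_filter_dvd_eq {F : ℕ → ℝ} {P : ℕ → Prop} [DecidablePred P] {M e : ℕ}
    (hPM : ∀ a, P a → a ≤ M) (he : 0 < e) :
    ∑ a ∈ Icc 1 M with P a ∧ e ∣ a, F a = ∑ a ∈ Icc 1 M with P (e * a), F (e * a) := by
  symm
  refine sum_nbij' (fun a => e * a) (fun a => a / e) ?_ ?_ ?_ ?_ ?_
  · intro a ha
    simp only [mem_filter, mem_Icc] at ha ⊢
    exact ⟨⟨Nat.mul_pos he ha.1.1, hPM _ ha.2⟩, ha.2, dvd_mul_right _ _⟩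
  · intro a ha
    simp only [mem_filter, mem_Icc] at ha ⊢
    obtain ⟨⟨h1, h2⟩, h3, h4⟩ := ha
    rw [Nat.mul_div_cancel' h4]
    exact ⟨⟨Nat.div_pos (Nat.le_of_dvd h1 h4) he, (Nat.div_le_self _ _).trans h2⟩, h3⟩
  · intro a _
    exact Nat.mul_div_cancel_left a he
  · intro a ha
    exact Nat.mul_div_cancel' (mem_filter.1 ha).2.2
  · intro a _
    rfl

/-- Detecting coprimality by the Möbius function bounds a sum over integers coprime to `k`. -/
lemma abs_sum_coprime_le {F : ℕ → ℝ} {P : ℕ → Prop} [DecidablePred P] {M k : ℕ} {K : ℝ}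
    (hPM : ∀ a, P a → a ≤ M) (hk : k ≠ 0)
    (h : ∀ e, 0 < e → |∑ a ∈ Icc 1 M with P (e * a), F (e * a)| ≤ K) :
    |∑ a ∈ Icc 1 M with P a ∧ a.Coprime k, F a| ≤ #k.divisors * K := by
  have hmoeb : ∀ a ∈ Icc 1 M, (if a.Coprime k then F a else 0) =
      ∑ e ∈ k.divisors, (ArithmeticFunction.moebius e : ℝ) * if e ∣ a then F a else 0 := by
    intro a ha
    have ha0 : a ≠ 0 := by
      have := (mem_Icc.1 ha).1
      omega
    have h1 : ∑ e ∈ (a.gcd k).divisors, ArithmeticFunction.moebius e =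
        if a.gcd k = 1 then 1 else 0 := by
      rw [← ArithmeticFunction.coe_mul_zeta_apply, ArithmeticFunction.moebius_mul_coe_zeta,
        ArithmeticFunction.one_apply]
    have h2 : (a.gcd k).divisors = {e ∈ k.divisors | e ∣ a} := by
      ext e
      simp only [Nat.mem_divisors, Nat.dvd_gcd_iff, mem_filter]
      have : a.gcd k ≠ 0 := Nat.gcd_ne_zero_left ha0
      tauto
    rw [h2] at h1
    simp only [mul_ite, mul_zero]
    rw [← sum_filter, ← sum_mul, ← Int.cast_sum, h1]
    unfold Nat.Coprime
    split_ifs <;> simp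
  have hswap : ∑ a ∈ Icc 1 M with P a ∧ a.Coprime k, F a =
      ∑ e ∈ k.divisors, (ArithmeticFunction.moebius e : ℝ) *
        ∑ a ∈ Icc 1 M with P (e * a), F (e * a) := by
    rw [← filter_filter, sum_filter, sum_congr rfl (fun a ha => hmoeb a (mem_filter.1 ha).1),
      sum_comm]
    refine sum_congr rfl fun e he => ?_
    have he0 : 0 < e := Nat.pos_of_mem_divisors he
    rw [← mul_sum, ← sum_filter, filter_filter, sum_filter_dvd_eq hPM he0]
  rw [hswap]
  calc _ ≤ ∑ e ∈ k.divisors, |(ArithmeticFunction.moebius e : ℝ) *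
        ∑ a ∈ Icc 1 M with P (e * a), F (e * a)| := abs_sum_le_sum_abs _ _
    _ ≤ ∑ e ∈ k.divisors, K := by
        refine sum_le_sum fun e he => ?_
        rw [abs_mul]
        have hmu : |(ArithmeticFunction.moebius e : ℝ)| ≤ 1 := by
          exact_mod_cast ArithmeticFunction.abs_moebius_le_one (n := e)
        exact (mul_le_of_le_one_left (abs_nonneg _) hmu).trans
          (h e (Nat.pos_of_mem_divisors he))
    _ = #k.divisors * K := by simp

lemma abs_sum_chi4_coprime_dvd_le {P : ℕ → Prop} [DecidablePred P] {M k r : ℕ}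
    (hP : ∀ a b c, a ≤ b → b ≤ c → P a → P c → P b) (hPM : ∀ a, P a → a ≤ M) (hk : k ≠ 0)
    (hr : Odd r) (t : ℕ) :
    |∑ a ∈ Icc 1 M with P a ∧ a.Coprime k, chi4 a * if r ∣ t * a + 1 then 1 else 0| ≤
      #k.divisors * (4 * r) := by
  refine abs_sum_coprime_le hPM hk fun e _ => ?_
  obtain ⟨u, v, huv⟩ := exists_filter_Icc_eq_Ico (P := fun a => P (e * a))
    (fun a b c hab hbc => hP _ _ _ (Nat.mul_le_mul_left e hab) (Nat.mul_le_mul_left e hbc)) M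
  rw [huv]
  have h := abs_sum_Ico_le_of_antiperiodic
    (f := fun a => chi4 (e * a) * if r ∣ t * (e * a) + 1 then 1 else 0) (q := 2 * r)
    (fun a => ?_) (by have := hr.pos; omega) (fun a => ?_) u v
  · refine h.trans (le_of_eq ?_)
    push_cast
    ring
  · split_ifs
    · simpa using abs_chi4_le_one _
    · simp
  · have h1 : r ∣ t * (e * (a + 2 * r)) + 1 ↔ r ∣ t * (e * a) + 1 := by
      rw [show t * (e * (a + 2 * r)) + 1 = r * (t * e * 2) + (t * (e * a) + 1) by ring]
      exact Nat.dvd_add_right (dvd_mul_right _ _)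
    simp only [h1, chi4_mul, chi4_add_two_mul_odd a hr]
    ring

lemma abs_sum_chi4_coprime_div_le {P : ℕ → Prop} [DecidablePred P] {M k : ℕ} {A : ℝ}
    (hP : ∀ a b c, a ≤ b → b ≤ c → P a → P c → P b) (hPM : ∀ a, P a → a ≤ M) (hk : k ≠ 0)
    (hA : 0 < A) (hPA : ∀ a, P a → A < a) :
    |∑ a ∈ Icc 1 M with P a ∧ a.Coprime k, chi4 a / a| ≤ #k.divisors * (4 / A) := by
  refine abs_sum_coprime_le hPM hk fun e he => ?_
  obtain ⟨u, v, huv⟩ := exists_filter_Icc_eq_Ico (P := fun a => P (e * a))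
    (fun a b c hab hbc => hP _ _ _ (Nat.mul_le_mul_left e hab) (Nat.mul_le_mul_left e hbc)) M
  have he' : (0 : ℝ) < e := by exact_mod_cast he
  have h := abs_sum_Ico_chi4_div_le (A := A / e) (by positivity) (u := u) (v := v) (fun a ha => by
    rw [← huv] at ha
    have := hPA _ (mem_filter.1 ha).2
    push_cast at this
    rwa [div_lt_iff₀' he'])
  rw [huv]
  have h2 : ∑ a ∈ Ico u v, chi4 (e * a) / ((e * a : ℕ) : ℝ) =
      chi4 e / e * ∑ a ∈ Ico u v, chi4 a / a := by
    rw [mul_sum]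
    refine sum_congr rfl fun a _ => ?_
    rw [chi4_mul, Nat.cast_mul, mul_div_mul_comm]
  rw [h2, abs_mul, abs_div, abs_of_pos he']
  calc |chi4 e| / e * |∑ a ∈ Ico u v, chi4 a / a| ≤ 1 / e * (4 / (A / e)) := by
        gcongr
        exact abs_chi4_le_one e
    _ = 4 / A := by field_simp

/-- Parametrising pairs of divisors by their greatest common divisor. -/
lemma sq_sum_divisors_eq (f : ℕ → ℝ) {n N : ℕ} (hn : 0 < n) (hnN : n ≤ N) :
    (∑ d ∈ n.divisors, f d) ^ 2 = ∑ g ∈ Icc 1 N, ∑ b ∈ Icc 1 N, ∑ a ∈ Icc 1 N with a.Coprime b,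
      f (g * a) * f (g * b) * if g * b * a ∣ n then 1 else 0 := by
  have hle : ∀ d, d ∣ n → 0 < d ∧ d ≤ N := fun d hd =>
    ⟨Nat.pos_of_dvd_of_pos hd hn, (Nat.le_of_dvd hn hd).trans hnN⟩
  have hR : ∑ g ∈ Icc 1 N, ∑ b ∈ Icc 1 N, ∑ a ∈ Icc 1 N with a.Coprime b,
      f (g * a) * f (g * b) * (if g * b * a ∣ n then 1 else 0) =
      ∑ x ∈ Icc 1 N ×ˢ Icc 1 N ×ˢ Icc 1 N with x.2.2.Coprime x.2.1 ∧ x.1 * x.2.1 * x.2.2 ∣ n,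
        f (x.1 * x.2.2) * f (x.1 * x.2.1) := by
    rw [sum_filter, sum_product]
    refine sum_congr rfl fun g _ => ?_
    rw [sum_product]
    refine sum_congr rfl fun b _ => ?_
    rw [sum_filter]
    refine sum_congr rfl fun a _ => ?_
    by_cases h1 : a.Coprime b <;> by_cases h2 : g * b * a ∣ n <;> simp [h1, h2]
  rw [hR, sq, sum_mul_sum, ← sum_product']
  refine sum_nbij' (fun x => (x.1.gcd x.2, x.2 / x.1.gcd x.2, x.1 / x.1.gcd x.2))
    (fun x => (x.1 * x.2.2, x.1 * x.2.1)) ?_ ?_ ?_ ?_ ?_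
  · rintro ⟨d, e⟩ hde
    simp only [mem_product, Nat.mem_divisors, mem_filter, mem_Icc] at hde ⊢
    obtain ⟨⟨hd, _⟩, he, _⟩ := hde
    have hd0 := (hle d hd).1
    have hg : 0 < d.gcd e := Nat.gcd_pos_of_pos_left _ hd0
    have h1 : d.gcd e * (e / d.gcd e) = e := Nat.mul_div_cancel' (Nat.gcd_dvd_right _ _)
    have h2 : d.gcd e * (d / d.gcd e) = d := Nat.mul_div_cancel' (Nat.gcd_dvd_left _ _)
    have hlcm : d.gcd e * (e / d.gcd e) * (d / d.gcd e) ∣ n := by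
      rw [h1, ← Nat.mul_div_assoc _ (Nat.gcd_dvd_left _ _), mul_comm e d]
      exact Nat.lcm_dvd hd he
    have h3 : e / d.gcd e ∣ n := (Dvd.intro_left _ h1).trans he
    have h4 : d / d.gcd e ∣ n := (Dvd.intro_left _ h2).trans hd
    exact ⟨⟨hle _ ((Nat.gcd_dvd_left _ _).trans hd), hle _ h3, hle _ h4⟩,
      Nat.coprime_div_gcd_div_gcd hg, hlcm⟩
  · rintro ⟨g, b, a⟩ hx
    simp only [mem_product, Nat.mem_divisors, mem_filter, mem_Icc] at hx ⊢
    refine ⟨⟨(Dvd.intro_left b ?_).trans hx.2.2, hn.ne'⟩, (Dvd.intro _ rfl).trans hx.2.2, hn.ne'⟩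
    ring
  · rintro ⟨d, e⟩ _
    simp only [Prod.mk.injEq]
    exact ⟨Nat.mul_div_cancel' (Nat.gcd_dvd_left _ _), Nat.mul_div_cancel' (Nat.gcd_dvd_right _ _)⟩
  · rintro ⟨g, b, a⟩ hx
    simp only [mem_product, mem_filter, mem_Icc] at hx
    have hg : (g * a).gcd (g * b) = g := by
      rw [Nat.gcd_mul_left, hx.2.1.gcd_eq_one, mul_one]
    have hg0 : 0 < g := hx.1.1.1
    simp only [hg, Nat.mul_div_cancel_left _ hg0]
  · rintro ⟨d, e⟩ _
    simp only
    rw [Nat.mul_div_cancel' (Nat.gcd_dvd_left _ _), Nat.mul_div_cancel' (Nat.gcd_dvd_right _ _)]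

/-- The number of positive multiples `n ≤ N` of `q` such that `r` divides `n + 1`. -/
def shiftedCount (N q r : ℕ) : ℕ := #{n ∈ Icc 1 N | q ∣ n ∧ r ∣ n + 1}

lemma shiftedCount_eq_zero {N q r : ℕ} (h : ¬ r.Coprime q) : shiftedCount N q r = 0 := by
  rw [shiftedCount, card_eq_zero, filter_eq_empty_iff]
  rintro n _ ⟨hq, hr⟩
  apply h
  have h1 : r.gcd q ∣ n := (Nat.gcd_dvd_right _ _).trans hq
  have h2 : r.gcd q ∣ n + 1 := (Nat.gcd_dvd_left _ _).trans hr
  exact Nat.dvd_one.1 ((Nat.dvd_add_right h1).1 h2)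

lemma abs_shiftedCount_sub_le {N q r : ℕ} (hq : 0 < q) (hr : 0 < r) (h : r.Coprime q) :
    |(shiftedCount N q r : ℝ) - N / (q * r)| ≤ 1 := by
  obtain ⟨c, hc1, hc2⟩ := Nat.chineseRemainder h.symm 0 (r - 1)
  have hfil : {n ∈ Icc 1 N | q ∣ n ∧ r ∣ n + 1} = {n ∈ Ioc 0 N | n ≡ c [MOD q * r]} := by
    ext n
    simp only [mem_filter, mem_Icc, mem_Ioc]
    refine and_congr (by omega) ?_
    rw [← Nat.modEq_and_modEq_iff_modEq_mul h.symm]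
    refine and_congr ?_ ?_
    · rw [← Nat.modEq_zero_iff_dvd]
      exact ⟨fun hn => hn.trans hc1.symm, fun hn => hn.trans hc1⟩
    · rw [← Nat.modEq_zero_iff_dvd]
      have hr1 : r - 1 + 1 ≡ 0 [MOD r] := by
        rw [Nat.sub_add_cancel hr, Nat.modEq_zero_iff_dvd]
      constructor
      · intro hn
        exact (Nat.ModEq.add_right_cancel' 1 (hn.trans hr1.symm)).trans hc2.symm
      · intro hn
        exact ((hn.trans hc2).add_right 1).trans hr1
  have hqr : 0 < q * r := Nat.mul_pos hq hr
  have hcard := Nat.Ioc_filter_modEq_card 0 N hqr c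
  rw [← hfil] at hcard
  have key : |((shiftedCount N q r : ℕ) : ℚ) - N / (q * r)| ≤ 1 := by
    have hQ : (0 : ℚ) < (q * r : ℕ) := by exact_mod_cast hqr
    set x : ℚ := ((N : ℚ) - c) / (q * r : ℕ) with hx
    set y : ℚ := (((0 : ℕ) : ℚ) - c) / (q * r : ℕ) with hy
    have hxy : (N : ℚ) / (q * r) = x - y := by
      rw [hx, hy, ← sub_div]
      push_cast
      ring
    have hyx : y ≤ x := by
      rw [hx, hy]
      gcongr
      simp
    rw [max_eq_left (sub_nonneg.2 (Int.floor_le_floor hyx))] at hcard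
    have hc : ((shiftedCount N q r : ℕ) : ℚ) = (⌊x⌋ : ℚ) - ⌊y⌋ := by
      rw [shiftedCount]
      exact_mod_cast hcard
    rw [hc, hxy, abs_le]
    have h1 := Int.floor_le x
    have h2 := Int.lt_floor_add_one x
    have h3 := Int.floor_le y
    have h4 := Int.lt_floor_add_one y
    constructor <;> linarith
  have hreal := (Rat.cast_le (K := ℝ)).2 key
  push_cast at hreal
  exact hreal

lemma shiftedCount_eq_sum {N q r : ℕ} (hq : 0 < q) :
    (shiftedCount N q r : ℝ) =
      ∑ m ∈ Icc 1 N, if q * m ≤ N ∧ r ∣ q * m + 1 then (1 : ℝ) else 0 := by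
  rw [← sum_filter, sum_const, nsmul_eq_mul, mul_one, Nat.cast_inj, shiftedCount]
  refine card_nbij' (fun n => n / q) (fun m => q * m) ?_ ?_ ?_ ?_
  · intro n hn
    simp only [mem_coe, mem_filter, mem_Icc] at hn ⊢
    obtain ⟨⟨h1, h2⟩, h3, h4⟩ := hn
    rw [Nat.mul_div_cancel' h3]
    exact ⟨⟨Nat.div_pos (Nat.le_of_dvd h1 h3) hq, (Nat.div_le_self _ _).trans h2⟩, h2, h4⟩
  · intro m hm
    simp only [mem_coe, mem_filter, mem_Icc] at hm ⊢
    exact ⟨⟨Nat.mul_pos hq hm.1.1, hm.2.1⟩, dvd_mul_right _ _, hm.2.2⟩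
  · intro n hn
    exact Nat.mul_div_cancel' (mem_filter.1 hn).2.1
  · intro m _
    exact Nat.mul_div_cancel_left m hq

lemma sum_Icc_inv_le (M : ℕ) : ∑ n ∈ Icc 1 M, (1 : ℝ) / n ≤ 1 + Real.log M := by
  have h := harmonic_le_one_add_log M
  rw [harmonic_eq_sum_Icc] at h
  push_cast at h
  simpa only [one_div] using h

lemma sum_Ico_inv_le {a : ℕ} (ha : 0 < a) (k : ℕ) :
    ∑ n ∈ Ico a (a + k + 1), (1 : ℝ) / n ≤ 1 + Real.log ((a + k : ℕ) / a) := by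
  have ha' : (1 : ℝ) ≤ a := by exact_mod_cast ha
  induction k with
  | zero =>
    simp only [add_zero, Nat.Ico_succ_singleton, sum_singleton]
    rw [div_self (by positivity), Real.log_one, add_zero, div_le_one (by positivity)]
    exact ha'
  | succ k ih =>
    rw [sum_Ico_succ_top (by omega), show a + (k + 1) = a + k + 1 by ring]
    have h0 : (0 : ℝ) < ((a + k : ℕ) : ℝ) := by positivity
    have h1 : (0 : ℝ) < ((a + k + 1 : ℕ) : ℝ) := by positivity
    have h2 : (1 : ℝ) / (a + k + 1 : ℕ) ≤ Real.log ((a + k + 1 : ℕ) / (a + k : ℕ)) := by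
      refine le_trans (le_of_eq ?_) (Real.one_sub_inv_le_log_of_pos (by positivity))
      rw [inv_div, one_sub_div h1.ne']
      congr 1
      push_cast
      ring
    rw [Real.log_div h1.ne' (by positivity)]
    rw [Real.log_div h1.ne' h0.ne'] at h2
    rw [Real.log_div h0.ne' (by positivity)] at ih
    linarith

lemma sum_window_inv_le {u v : ℝ} (hu : 0 < u) (huv : u ≤ v) (M : ℕ) :
    ∑ n ∈ Icc 1 M with u < ((n : ℕ) : ℝ) ∧ (n : ℝ) < v, (1 : ℝ) / n ≤ 1 + Real.log (v / u) := by
  obtain ⟨a, b, hab⟩ := exists_filter_Icc_eq_Ico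
    (P := fun n : ℕ => u < (n : ℝ) ∧ (n : ℝ) < v) (fun x y z hxy hyz hx hz =>
      ⟨hx.1.trans_le (by exact_mod_cast hxy), lt_of_le_of_lt (by exact_mod_cast hyz) hz.2⟩) M
  rw [hab]
  rcases le_or_gt b a with hba | hba
  · rw [Ico_eq_empty_of_le hba, sum_empty]
    have := Real.log_nonneg ((one_le_div hu).2 huv)
    linarith
  · obtain ⟨k, rfl⟩ : ∃ k, b = a + k + 1 := ⟨b - a - 1, by omega⟩
    have h1 : a ∈ Ico a (a + k + 1) := by simp
    have h2 : a + k ∈ Ico a (a + k + 1) := by simp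
    rw [← hab, mem_filter, mem_Icc] at h1 h2
    have ha' : (0 : ℝ) < a := by exact_mod_cast h1.1.1
    refine (sum_Ico_inv_le h1.1.1 k).trans ?_
    gcongr
    · exact div_pos (by exact_mod_cast h2.1.1) ha'
    · exact hu.le.trans huv
    · exact h2.2.2.le
    · exact h1.2.1.le

lemma sum_filter_sum_divisors_eq {G : ℕ → ℕ → ℝ} {P : ℕ → Prop} [DecidablePred P] {M : ℕ}
    (hPM : ∀ a, P a → a ≤ M) :
    ∑ n ∈ Icc 1 M with P n, ∑ d ∈ n.divisors, G d n =
      ∑ d ∈ Icc 1 M, ∑ m ∈ Icc 1 M with P (d * m), G d (d * m) := by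
  have h : ∀ n ∈ {n ∈ Icc 1 M | P n}, ∑ d ∈ n.divisors, G d n =
      ∑ d ∈ Icc 1 M, if d ∣ n then G d n else 0 := by
    intro n hn
    rw [mem_filter, mem_Icc] at hn
    rw [← sum_filter]
    refine sum_congr ?_ fun _ _ => rfl
    ext d
    simp only [Nat.mem_divisors, mem_filter, mem_Icc]
    constructor
    · rintro ⟨hd, _⟩
      exact ⟨⟨Nat.pos_of_dvd_of_pos hd hn.1.1, (Nat.le_of_dvd hn.1.1 hd).trans hn.1.2⟩, hd⟩
    · rintro ⟨_, hd⟩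
      exact ⟨hd, by omega⟩
  rw [sum_congr rfl h, sum_comm]
  refine sum_congr rfl fun d hd => ?_
  rw [← sum_filter, filter_filter, sum_filter_dvd_eq hPM (mem_Icc.1 hd).1]

lemma sum_card_divisors_div_le (M : ℕ) :
    ∑ n ∈ Icc 1 M, (#n.divisors : ℝ) / n ≤ (1 + Real.log M) ^ 2 := by
  have h := sum_filter_sum_divisors_eq (G := fun _ n => (1 : ℝ) / n) (P := fun n => n ≤ M)
    (M := M) (fun _ h => h)
  have h1 : {n ∈ Icc 1 M | n ≤ M} = Icc 1 M := filter_true_of_mem fun n hn => (mem_Icc.1 hn).2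
  rw [h1] at h
  have h2 : ∑ n ∈ Icc 1 M, (#n.divisors : ℝ) / n =
      ∑ n ∈ Icc 1 M, ∑ d ∈ n.divisors, (1 : ℝ) / n := by
    refine sum_congr rfl fun n _ => ?_
    rw [sum_const, nsmul_eq_mul, mul_one_div]
  rw [h2, h, sq]
  calc _ ≤ ∑ d ∈ Icc 1 M, ∑ m ∈ Icc 1 M, (1 : ℝ) / ((d * m : ℕ) : ℝ) := by
        refine sum_le_sum fun d _ => sum_le_sum_of_subset_of_nonneg (filter_subset _ _) ?_
        intros
        positivity
    _ = (∑ n ∈ Icc 1 M, (1 : ℝ) / n) * ∑ n ∈ Icc 1 M, (1 : ℝ) / n := by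
        rw [sum_mul_sum]
        refine sum_congr rfl fun d _ => sum_congr rfl fun m _ => ?_
        push_cast
        rw [one_div_mul_one_div]
    _ ≤ _ := by
        have h3 := sum_Icc_inv_le M
        have h4 : 0 ≤ ∑ n ∈ Icc 1 M, (1 : ℝ) / n := sum_nonneg fun n _ => by positivity
        gcongr

lemma card_divisors_mul_le (m n : ℕ) : #(m * n).divisors ≤ #m.divisors * #n.divisors := by
  rw [Nat.divisors_mul]
  exact card_mul_le

/-- The product of `1 + 1 / p` over the primes `p` dividing `n`. -/
def dedekindRatio (n : ℕ) : ℝ := ∏ p ∈ n.primeFactors, (1 + 1 / (p : ℝ))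

lemma one_le_prod_one_add_inv (s : Finset ℕ) : 1 ≤ ∏ p ∈ s, (1 + 1 / (p : ℝ)) :=
  one_le_prod fun p _ => by simp

lemma one_le_dedekindRatio (n : ℕ) : 1 ≤ dedekindRatio n := one_le_prod_one_add_inv _

lemma dedekindRatio_mul_le (m n : ℕ) :
    dedekindRatio (m * n) ≤ dedekindRatio m * dedekindRatio n := by
  rcases eq_or_ne m 0 with rfl | hm
  · rw [zero_mul]
    exact le_mul_of_one_le_right (zero_le_one.trans (one_le_dedekindRatio _))
      (one_le_dedekindRatio _)
  rcases eq_or_ne n 0 with rfl | hn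
  · rw [mul_zero]
    exact le_mul_of_one_le_left (zero_le_one.trans (one_le_dedekindRatio _))
      (one_le_dedekindRatio _)
  unfold dedekindRatio
  rw [Nat.primeFactors_mul hm hn, ← prod_union_inter]
  exact le_mul_of_one_le_right (zero_le_one.trans (one_le_prod_one_add_inv _))
    (one_le_prod_one_add_inv _)

lemma dedekindRatio_le_sum_divisors {n : ℕ} (hn : n ≠ 0) :
    dedekindRatio n ≤ ∑ d ∈ n.divisors, (1 : ℝ) / d := by
  rw [dedekindRatio, prod_one_add]
  have hprime : ∀ s ∈ n.primeFactors.powerset, ∀ p ∈ s, p.Prime := fun s hs p hp =>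
    Nat.prime_of_mem_primeFactors (mem_powerset.1 hs hp)
  have hinj : Set.InjOn (fun s : Finset ℕ => ∏ p ∈ s, p) (n.primeFactors.powerset : Set _) := by
    intro s hs t ht hst
    rw [← Nat.primeFactors_prod (hprime s hs), ← Nat.primeFactors_prod (hprime t ht)]
    exact congrArg _ hst
  have himg : ∑ s ∈ n.primeFactors.powerset, ∏ p ∈ s, (1 : ℝ) / p =
      ∑ d ∈ n.primeFactors.powerset.image (fun s => ∏ p ∈ s, p), (1 : ℝ) / d := by
    rw [sum_image hinj]
    refine sum_congr rfl fun s _ => ?_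
    push_cast
    rw [prod_div_distrib, prod_const_one]
  rw [himg]
  refine sum_le_sum_of_subset_of_nonneg ?_ fun _ _ _ => by positivity
  intro d hd
  obtain ⟨s, hs, rfl⟩ := mem_image.1 hd
  refine Nat.mem_divisors.2 ⟨prod_primes_dvd n (fun p hp => (hprime s hs p hp).prime) fun p hp =>
    Nat.dvd_of_mem_primeFactors (mem_powerset.1 hs hp), hn⟩

lemma sum_window_dedekindRatio_div_le {u v : ℝ} (hu : 0 < u) (huv : u ≤ v) {M : ℕ}
    (hM : v ≤ M) :
    ∑ n ∈ Icc 1 M with u < ((n : ℕ) : ℝ) ∧ (n : ℝ) < v, dedekindRatio n / n ≤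
      2 * (1 + Real.log (v / u)) := by
  have hlog := Real.log_nonneg ((one_le_div hu).2 huv)
  have hsq : ∑ d ∈ Icc 1 M, (1 : ℝ) / (d : ℝ) ^ 2 ≤ 2 := by
    have h := sum_Ioo_inv_sq_le (α := ℝ) 0 (M + 1)
    have h1 : Ioo 0 (M + 1) = Icc 1 M := by
      ext d
      simp only [mem_Ioo, mem_Icc]
      omega
    rw [h1] at h
    simpa using h
  calc _ ≤ ∑ n ∈ Icc 1 M with u < ((n : ℕ) : ℝ) ∧ (n : ℝ) < v,
        ∑ d ∈ n.divisors, (1 : ℝ) / d / n := by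
        refine sum_le_sum fun n hn => ?_
        rw [← sum_div]
        gcongr
        refine dedekindRatio_le_sum_divisors ?_
        have := (mem_Icc.1 (mem_filter.1 hn).1).1
        omega
    _ = ∑ d ∈ Icc 1 M, ∑ m ∈ Icc 1 M with u < ((d * m : ℕ) : ℝ) ∧ ((d * m : ℕ) : ℝ) < v,
        (1 : ℝ) / d / ((d * m : ℕ) : ℝ) :=
      sum_filter_sum_divisors_eq (fun a ha => by exact_mod_cast (ha.2.trans_le hM).le)
    _ ≤ ∑ d ∈ Icc 1 M, (1 : ℝ) / (d : ℝ) ^ 2 * (1 + Real.log (v / u)) := by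
        refine sum_le_sum fun d hd => ?_
        have hd : (0 : ℝ) < d := by exact_mod_cast (mem_Icc.1 hd).1
        have h := sum_window_inv_le (u := u / d) (v := v / d) (by positivity) (by gcongr) M
        rw [div_div_div_cancel_right₀ hd.ne'] at h
        refine le_trans (le_of_eq ?_) (mul_le_mul_of_nonneg_left h (by positivity))
        rw [mul_sum]
        refine sum_congr (filter_congr fun m _ => ?_) fun m _ => ?_
        · push_cast
          rw [div_lt_iff₀' hd, lt_div_iff₀' hd]
        · push_cast
          field_simp
    _ ≤ _ := by
        rw [← sum_mul]
        gcongr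

lemma card_filter_mul_lt_le {x X : ℝ} (hx : 0 < x) (hX : 0 ≤ X) (M : ℕ) :
    (#{a ∈ Icc 1 M | x * ((a : ℕ) : ℝ) < X} : ℝ) ≤ X / x := by
  have h : {a ∈ Icc 1 M | x * ((a : ℕ) : ℝ) < X} ⊆ Icc 1 ⌊X / x⌋₊ := by
    intro a ha
    rw [mem_filter, mem_Icc] at ha
    rw [mem_Icc]
    refine ⟨ha.1.1, Nat.le_floor ?_⟩
    rw [le_div_iff₀' hx]
    exact ha.2.le
  calc (#{a ∈ Icc 1 M | x * ((a : ℕ) : ℝ) < X} : ℝ) ≤ #(Icc 1 ⌊X / x⌋₊) := by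
        exact_mod_cast card_le_card h
    _ ≤ X / x := by
        rw [Nat.card_Icc, Nat.add_sub_cancel]
        exact Nat.floor_le (by positivity)

/-- The character `chi4` restricted to the open interval `(lo, hi)`. -/
def windowChi (lo hi : ℝ) (d : ℕ) : ℝ := if lo < (d : ℝ) ∧ (d : ℝ) < hi then chi4 d else 0

lemma abs_windowChi_le (lo hi : ℝ) (d : ℕ) :
    |windowChi lo hi d| ≤ if lo < (d : ℝ) ∧ (d : ℝ) < hi then 1 else 0 := by
  unfold windowChi
  split_ifs
  · exact abs_chi4_le_one d
  · simp

lemma abs_windowChi_le_one (lo hi : ℝ) (d : ℕ) : |windowChi lo hi d| ≤ 1 :=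
  (abs_windowChi_le lo hi d).trans (by split_ifs <;> norm_num)

/-- The density of the integers coprime to `q` under the sieve weights `c` supported on `R`. -/
def sieveDensity (R : Finset ℕ) (c : ℕ → ℝ) (q : ℕ) : ℝ := ∑ r ∈ R with r.Coprime q, c r / r

/-- Sieve weights `c` of level `D`, supported on a set `R` of odd moduli, whose densities are
bounded by `v`. -/
structure IsOddSieve (R : Finset ℕ) (c : ℕ → ℝ) (N : ℕ) (D v : ℝ) : Prop where
  odd : ∀ r ∈ R, Odd r
  le_length : ∀ r ∈ R, r ≤ N
  le_level : ∀ r ∈ R, (r : ℝ) ≤ D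
  card_le : (#R : ℝ) ≤ D
  abs_le_one : ∀ r ∈ R, |c r| ≤ 1
  abs_density_le : ∀ q, 0 < q → |sieveDensity R c q| ≤ v * dedekindRatio q

/-- The part of the sifted second moment coming from pairs of divisors with greatest common
divisor `g`. -/
def gcdPart (R : Finset ℕ) (c : ℕ → ℝ) (N : ℕ) (lo hi : ℝ) (g : ℕ) : ℝ :=
  ∑ b ∈ Icc 1 N, ∑ a ∈ Icc 1 N with a.Coprime b,
    windowChi lo hi (g * a) * windowChi lo hi (g * b) *
      ∑ r ∈ R, c r * shiftedCount N (g * b * a) r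

/-- The expected main term of `gcdPart`. -/
def gcdMain (R : Finset ℕ) (c : ℕ → ℝ) (N : ℕ) (lo hi : ℝ) (g : ℕ) : ℝ :=
  ∑ b ∈ Icc 1 N, ∑ a ∈ Icc 1 N with a.Coprime b,
    windowChi lo hi (g * a) * windowChi lo hi (g * b) *
      (N / ((g * b * a : ℕ) : ℝ) * sieveDensity R c (g * b * a))

lemma sum_sieve_mul_sq_eq (R : Finset ℕ) (c : ℕ → ℝ) (N : ℕ) (lo hi : ℝ) :
    ∑ n ∈ Icc 1 N, (∑ r ∈ R with r ∣ n + 1, c r) * (∑ d ∈ n.divisors, windowChi lo hi d) ^ 2 =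
      ∑ g ∈ Icc 1 N, gcdPart R c N lo hi g := by
  have h1 : ∀ n ∈ Icc 1 N, (∑ r ∈ R with r ∣ n + 1, c r) *
      (∑ d ∈ n.divisors, windowChi lo hi d) ^ 2 =
      ∑ g ∈ Icc 1 N, ∑ b ∈ Icc 1 N, ∑ a ∈ Icc 1 N with a.Coprime b,
        windowChi lo hi (g * a) * windowChi lo hi (g * b) *
          ((∑ r ∈ R with r ∣ n + 1, c r) * if g * b * a ∣ n then 1 else 0) := by
    intro n hn
    rw [sq_sum_divisors_eq _ (mem_Icc.1 hn).1 (mem_Icc.1 hn).2]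
    simp only [mul_sum]
    refine sum_congr rfl fun g _ => sum_congr rfl fun b _ => sum_congr rfl fun a _ => ?_
    ring
  rw [sum_congr rfl h1, sum_comm]
  refine sum_congr rfl fun g _ => ?_
  rw [sum_comm, gcdPart]
  refine sum_congr rfl fun b _ => ?_
  rw [sum_comm]
  refine sum_congr rfl fun a _ => ?_
  rw [← mul_sum]
  congr 1
  simp only [sum_filter, sum_mul]
  rw [sum_comm]
  refine sum_congr rfl fun r _ => ?_
  rw [shiftedCount, card_filter, Nat.cast_sum, mul_sum]
  refine sum_congr rfl fun n _ => ?_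
  by_cases h2 : g * b * a ∣ n <;> by_cases h3 : r ∣ n + 1 <;> simp [h2, h3]

lemma gcdPart_eq_zero (R : Finset ℕ) (c : ℕ → ℝ) (N : ℕ) (lo : ℝ) {hi : ℝ} {g : ℕ}
    (hg : hi ≤ g) : gcdPart R c N lo hi g = 0 := by
  refine sum_eq_zero fun b _ => sum_eq_zero fun a ha => ?_
  have h1 : 1 ≤ a := (mem_Icc.1 (mem_filter.1 ha).1).1
  have h : windowChi lo hi (g * a) = 0 := by
    refine if_neg fun h => ?_
    have h2 : (g : ℝ) ≤ ((g * a : ℕ) : ℝ) := by exact_mod_cast Nat.le_mul_of_pos_right g h1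
    linarith [h.2]
  rw [h, zero_mul, zero_mul]

/-- For a fixed modulus, summing over the multiples first exhibits cancellation. -/
lemma abs_sum_windowChi_mul_shiftedCount_le {N g b r : ℕ} {lo hi D : ℝ} (hlo : 0 < lo)
    (hhi : hi ≤ N) (hg : 0 < g) (hb : 0 < b) (hr : Odd r) (hrD : (r : ℝ) ≤ D) :
    |∑ a ∈ Icc 1 N with a.Coprime b, windowChi lo hi (g * a) * shiftedCount N (g * b * a) r| ≤
      4 * D * (N / lo) * (#b.divisors / b) := by
  have hb' : (0 : ℝ) < b := by exact_mod_cast hb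
  have hD : 0 ≤ D := (Nat.cast_nonneg r).trans hrD
  let P : ℕ → ℕ → Prop := fun m a =>
    (lo < ((g * a : ℕ) : ℝ) ∧ ((g * a : ℕ) : ℝ) < hi) ∧ g * b * a * m ≤ N
  have hdec : ∀ m, DecidablePred (P m) := fun m a => inferInstanceAs (Decidable (_ ∧ _))
  have hrw : ∑ a ∈ Icc 1 N with a.Coprime b,
      windowChi lo hi (g * a) * shiftedCount N (g * b * a) r =
      ∑ m ∈ Icc 1 N, chi4 g * ∑ a ∈ Icc 1 N with P m a ∧ a.Coprime b,
        chi4 a * if r ∣ g * b * m * a + 1 then 1 else 0 := by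
    simp only [mul_sum]
    have h1 : ∀ m ∈ Icc 1 N, ∑ a ∈ Icc 1 N with P m a ∧ a.Coprime b,
        chi4 g * (chi4 a * if r ∣ g * b * m * a + 1 then 1 else 0) =
        ∑ a ∈ Icc 1 N with a.Coprime b,
          if P m a then chi4 g * (chi4 a * if r ∣ g * b * m * a + 1 then 1 else 0) else 0 := by
      intro m _
      rw [← sum_filter, filter_filter]
      exact sum_congr (filter_congr fun _ _ => and_comm) fun _ _ => rfl
    rw [sum_congr rfl h1, sum_comm]
    refine sum_congr rfl fun a ha => ?_
    have ha0 : 0 < a := (mem_Icc.1 (mem_filter.1 ha).1).1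
    rw [shiftedCount_eq_sum (Nat.mul_pos (Nat.mul_pos hg hb) ha0), mul_sum]
    refine sum_congr rfl fun m _ => ?_
    have hcomm : g * b * m * a = g * b * a * m := by ring
    rw [hcomm]
    unfold windowChi
    by_cases h2 : lo < ((g * a : ℕ) : ℝ) ∧ ((g * a : ℕ) : ℝ) < hi <;>
      by_cases h3 : g * b * a * m ≤ N <;> by_cases h4 : r ∣ g * b * a * m + 1 <;>
      simp only [P, h2, h3, h4, chi4_mul, if_true, if_false, and_true, and_false, mul_zero,
        mul_one]
  have hm : ∀ m ∈ Icc 1 N, |chi4 g * ∑ a ∈ Icc 1 N with P m a ∧ a.Coprime b,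
      chi4 a * if r ∣ g * b * m * a + 1 then 1 else 0| ≤
      if (b : ℝ) * m < N / lo then #b.divisors * (4 * D) else 0 := by
    intro m hm
    have hm0 : 0 < m := (mem_Icc.1 hm).1
    split_ifs with hbm
    · rw [abs_mul]
      refine (mul_le_of_le_one_left (abs_nonneg _) (abs_chi4_le_one g)).trans ?_
      refine (abs_sum_chi4_coprime_dvd_le ?_ ?_ hb.ne' hr (g * b * m)).trans ?_
      · rintro x y z hxy hyz ⟨⟨hx, _⟩, _⟩ ⟨⟨_, hz1⟩, hz2⟩
        refine ⟨⟨hx.trans_le ?_, lt_of_le_of_lt ?_ hz1⟩, le_trans ?_ hz2⟩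
        · exact_mod_cast Nat.mul_le_mul_left g hxy
        · exact_mod_cast Nat.mul_le_mul_left g hyz
        · gcongr
      · rintro a ⟨⟨_, h2⟩, _⟩
        have h3 : ((g * a : ℕ) : ℝ) ≤ N := h2.le.trans hhi
        exact (Nat.le_mul_of_pos_left a hg).trans (by exact_mod_cast h3)
      · gcongr
    · rw [filter_false_of_mem, sum_empty, mul_zero, abs_zero]
      rintro a _ ⟨⟨⟨h1, _⟩, h2⟩, _⟩
      apply hbm
      rw [lt_div_iff₀ hlo]
      have hbm0 : (0 : ℝ) < b * m := by positivity
      calc (b : ℝ) * m * lo < b * m * ((g * a : ℕ) : ℝ) := by gcongr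
        _ = ((g * b * a * m : ℕ) : ℝ) := by push_cast; ring
        _ ≤ N := by exact_mod_cast h2
  rw [hrw]
  refine (abs_sum_le_sum_abs _ _).trans ((sum_le_sum hm).trans ?_)
  rw [← sum_filter, sum_const, nsmul_eq_mul]
  calc _ ≤ (N / lo / b) * (#b.divisors * (4 * D)) := by
        gcongr
        exact card_filter_mul_lt_le hb' (by positivity) N
    _ = _ := by
        field_simp

lemma abs_gcdPart_le {R : Finset ℕ} {c : ℕ → ℝ} {N g : ℕ} {lo hi D v : ℝ}
    (hR : IsOddSieve R c N D v) (hlo : 0 < lo) (hhi : hi ≤ N) (hg : 0 < g) :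
    |gcdPart R c N lo hi g| ≤ 4 * D ^ 2 * (N / lo) * (1 + Real.log N) ^ 2 := by
  have hD : 0 ≤ D := (Nat.cast_nonneg _).trans hR.card_le
  have hb : ∀ b ∈ Icc 1 N, |∑ a ∈ Icc 1 N with a.Coprime b,
      windowChi lo hi (g * a) * windowChi lo hi (g * b) *
        ∑ r ∈ R, c r * shiftedCount N (g * b * a) r| ≤
      D * (4 * D * (N / lo) * (#b.divisors / b)) := by
    intro b hb
    have hb0 : 0 < b := (mem_Icc.1 hb).1
    have hrw : ∑ a ∈ Icc 1 N with a.Coprime b,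
        windowChi lo hi (g * a) * windowChi lo hi (g * b) *
          ∑ r ∈ R, c r * shiftedCount N (g * b * a) r =
        ∑ r ∈ R, windowChi lo hi (g * b) * c r * ∑ a ∈ Icc 1 N with a.Coprime b,
          windowChi lo hi (g * a) * shiftedCount N (g * b * a) r := by
      simp only [mul_sum]
      rw [sum_comm]
      refine sum_congr rfl fun r _ => sum_congr rfl fun a _ => ?_
      ring
    rw [hrw]
    calc _ ≤ ∑ r ∈ R, 4 * D * (N / lo) * (#b.divisors / b) := by
          refine (abs_sum_le_sum_abs _ _).trans (sum_le_sum fun r hr => ?_)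
          rw [abs_mul, abs_mul]
          refine (mul_le_of_le_one_left (abs_nonneg _) (mul_le_one₀
            (abs_windowChi_le_one _ _ _) (abs_nonneg _) (hR.abs_le_one r hr))).trans ?_
          exact abs_sum_windowChi_mul_shiftedCount_le hlo hhi hg hb0 (hR.odd r hr)
            (hR.le_level r hr)
      _ ≤ _ := by
          rw [sum_const, nsmul_eq_mul]
          gcongr
          exact hR.card_le
  calc _ ≤ ∑ b ∈ Icc 1 N, D * (4 * D * (N / lo) * (#b.divisors / b)) :=
        (abs_sum_le_sum_abs _ _).trans (sum_le_sum hb)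
    _ = 4 * D ^ 2 * (N / lo) * ∑ b ∈ Icc 1 N, (#b.divisors : ℝ) / b := by
        rw [mul_sum]
        refine sum_congr rfl fun b _ => ?_
        ring
    _ ≤ _ := by
        gcongr
        exact sum_card_divisors_div_le N

lemma abs_gcdPart_sub_gcdMain_le {R : Finset ℕ} {c : ℕ → ℝ} {N g : ℕ} {lo hi D v : ℝ}
    (hR : IsOddSieve R c N D v) (hhi : 0 ≤ hi) (hg : 0 < g) :
    |gcdPart R c N lo hi g - gcdMain R c N lo hi g| ≤ D * (hi / g) ^ 2 := by
  have hD : 0 ≤ D := (Nat.cast_nonneg _).trans hR.card_le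
  have hg' : (0 : ℝ) < g := by exact_mod_cast hg
  have hwin : ∀ x : ℕ, |windowChi lo hi (g * x)| ≤ if (g : ℝ) * x < hi then 1 else 0 := by
    intro x
    refine (abs_windowChi_le _ _ _).trans ?_
    push_cast
    split_ifs with h1 h2 h2
    · exact le_rfl
    · exact absurd h1.2 h2
    · exact zero_le_one
    · exact le_rfl
  have hcard := card_filter_mul_lt_le hg' hhi N
  rw [card_filter, Nat.cast_sum] at hcard
  push_cast at hcard
  have hcount : ∀ q : ℕ, 0 < q →
      |∑ r ∈ R, c r * shiftedCount N q r - N / (q : ℝ) * sieveDensity R c q| ≤ D := by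
    intro q hq
    rw [sieveDensity, sum_filter, mul_sum, ← sum_sub_distrib]
    calc _ ≤ ∑ r ∈ R, (1 : ℝ) := by
          refine (abs_sum_le_sum_abs _ _).trans (sum_le_sum fun r hr => ?_)
          have hr0 : 0 < r := (hR.odd r hr).pos
          split_ifs with hrq
          · rw [show (N : ℝ) / q * (c r / r) = c r * (N / (q * r)) by field_simp, ← mul_sub,
              abs_mul]
            exact mul_le_one₀ (hR.abs_le_one r hr) (abs_nonneg _)
              (abs_shiftedCount_sub_le hq hr0 hrq)
          · simp [shiftedCount_eq_zero hrq]
      _ ≤ D := by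
          rw [sum_const, nsmul_eq_mul, mul_one]
          exact hR.card_le
  rw [gcdPart, gcdMain, ← sum_sub_distrib]
  calc _ ≤ ∑ b ∈ Icc 1 N, ∑ a ∈ Icc 1 N,
        (if (g : ℝ) * a < hi then 1 else 0) * (if (g : ℝ) * b < hi then 1 else 0) * D := by
        refine (abs_sum_le_sum_abs _ _).trans (sum_le_sum fun b hb => ?_)
        rw [← sum_sub_distrib]
        refine (abs_sum_le_sum_abs _ _).trans ?_
        refine (sum_le_sum fun a ha => ?_).trans
          (sum_le_sum_of_subset_of_nonneg (filter_subset (fun a : ℕ => a.Coprime b) _)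
            fun a _ _ => by positivity)
        have ha0 : 0 < a := (mem_Icc.1 (mem_filter.1 ha).1).1
        have hb0 : 0 < b := (mem_Icc.1 hb).1
        rw [← mul_sub, abs_mul, abs_mul]
        gcongr
        · exact hwin a
        · exact hwin b
        · exact hcount _ (Nat.mul_pos (Nat.mul_pos hg hb0) ha0)
    _ = D * ((∑ a ∈ Icc 1 N, if (g : ℝ) * a < hi then 1 else 0) *
          ∑ b ∈ Icc 1 N, if (g : ℝ) * b < hi then 1 else 0) := by
        rw [sum_mul_sum, sum_comm, mul_sum]
        refine sum_congr rfl fun b _ => ?_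
        rw [mul_sum]
        exact sum_congr rfl fun a _ => by ring
    _ ≤ _ := by
        rw [sq]
        have h0 : (0 : ℝ) ≤ ∑ a ∈ Icc 1 N, if (g : ℝ) * a < hi then (1 : ℝ) else 0 :=
          sum_nonneg fun _ _ => by positivity
        gcongr

/-- The product `g * a` lies in the open interval `(lo, hi)`. -/
def MulMemWindow (lo hi : ℝ) (g a : ℕ) : Prop := lo < ((g * a : ℕ) : ℝ) ∧ ((g * a : ℕ) : ℝ) < hi

instance (lo hi : ℝ) (g : ℕ) : DecidablePred (MulMemWindow lo hi g) :=
  fun _ => inferInstanceAs (Decidable (_ ∧ _))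

lemma gcdMain_eq_sum {R : Finset ℕ} {c : ℕ → ℝ} {N g : ℕ} {D v : ℝ}
    (hR : IsOddSieve R c N D v) (lo hi : ℝ) (hg : 0 < g) :
    gcdMain R c N lo hi g = ∑ b ∈ Icc 1 N, ∑ r ∈ R with r.Coprime (g * b),
      windowChi lo hi (g * b) * c r * chi4 g * (N / (g * b * r)) *
        ∑ a ∈ Icc 1 N with MulMemWindow lo hi g a ∧ a.Coprime (b * r), chi4 a / a := by
  have hg' : (0 : ℝ) < g := by exact_mod_cast hg
  refine sum_congr rfl fun b hb => ?_
  have hb0 : 0 < b := (mem_Icc.1 hb).1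
  let T : ℕ → ℕ → ℝ := fun a r => if a.Coprime b ∧ r.Coprime (g * b * a) then
    windowChi lo hi (g * a) * windowChi lo hi (g * b) * (N / ((g * b * a : ℕ) : ℝ) * (c r / r))
    else 0
  have hleft : ∀ a, (if a.Coprime b then windowChi lo hi (g * a) * windowChi lo hi (g * b) *
      (N / ((g * b * a : ℕ) : ℝ) * sieveDensity R c (g * b * a)) else 0) = ∑ r ∈ R, T a r := by
    intro a
    by_cases hab : a.Coprime b
    · rw [if_pos hab, sieveDensity, sum_filter, mul_sum, mul_sum]
      refine sum_congr rfl fun r _ => ?_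
      by_cases h : r.Coprime (g * b * a)
      · rw [if_pos h, show T a r = _ from if_pos ⟨hab, h⟩]
      · rw [if_neg h, show T a r = 0 from if_neg fun h' => h h'.2, mul_zero, mul_zero]
    · rw [if_neg hab, sum_eq_zero fun r _ => if_neg fun h => hab h.1]
  have hright : ∀ r ∈ R, (if r.Coprime (g * b) then windowChi lo hi (g * b) * c r * chi4 g *
      (N / (g * b * r)) *
          ∑ a ∈ Icc 1 N with MulMemWindow lo hi g a ∧ a.Coprime (b * r), chi4 a / a else 0) =
      ∑ a ∈ Icc 1 N, T a r := by
    intro r hr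
    have hr0 : (0 : ℝ) < r := by exact_mod_cast (hR.odd r hr).pos
    by_cases hrgb : r.Coprime (g * b)
    · rw [if_pos hrgb, sum_filter, mul_sum]
      refine sum_congr rfl fun a ha => ?_
      have hb' : (0 : ℝ) < b := by exact_mod_cast hb0
      have ha' : (0 : ℝ) < a := by exact_mod_cast (mem_Icc.1 ha).1
      by_cases hPa : MulMemWindow lo hi g a
      · have hw : windowChi lo hi (g * a) = chi4 g * chi4 a := by
          rw [windowChi, if_pos ⟨hPa.1, hPa.2⟩, chi4_mul]
        by_cases h : a.Coprime b ∧ r.Coprime (g * b * a)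
        · have h' : MulMemWindow lo hi g a ∧ a.Coprime (b * r) := ⟨hPa, Nat.coprime_mul_iff_right.2
            ⟨h.1, (Nat.coprime_mul_iff_right.1 h.2).2.symm⟩⟩
          rw [if_pos h', show T a r = _ from if_pos h, hw]
          push_cast
          field_simp
        · have h' : ¬(MulMemWindow lo hi g a ∧ a.Coprime (b * r)) := fun h' => h
            ⟨(Nat.coprime_mul_iff_right.1 h'.2).1, Nat.coprime_mul_iff_right.2
              ⟨hrgb, (Nat.coprime_mul_iff_right.1 h'.2).2.symm⟩⟩
          rw [if_neg h', show T a r = 0 from if_neg h, mul_zero]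
      · have hw : windowChi lo hi (g * a) = 0 := if_neg hPa
        rw [if_neg fun h => hPa h.1]
        simp only [T, hw, zero_mul, mul_zero, ite_self]
    · have hT : ∀ a, T a r = 0 := fun a =>
        if_neg fun h => hrgb (Nat.Coprime.coprime_mul_right_right h.2)
      rw [if_neg hrgb, sum_congr rfl fun a _ => hT a, sum_const_zero]
  rw [sum_filter, sum_filter, sum_congr rfl fun a _ => hleft a, sum_congr rfl hright, sum_comm]

/-- Cancellation in the main term when both cofactors are large. -/
lemma abs_gcdMain_le {R : Finset ℕ} {c : ℕ → ℝ} {N g : ℕ} {lo hi D v : ℝ}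
    (hR : IsOddSieve R c N D v) (hlo : 0 < lo) (hhi : hi ≤ N) (hg : 0 < g) :
    |gcdMain R c N lo hi g| ≤ 4 * (N / lo) * (1 + Real.log N) ^ 4 := by
  have hg' : (0 : ℝ) < g := by exact_mod_cast hg
  have hin : ∀ k, k ≠ 0 → |∑ a ∈ Icc 1 N with MulMemWindow lo hi g a ∧ a.Coprime k, chi4 a / a| ≤
      #k.divisors * (4 / (lo / g)) := by
    intro k hk
    refine abs_sum_chi4_coprime_div_le ?_ ?_ hk (by positivity) ?_
    · rintro x y z hxy hyz ⟨hx, _⟩ ⟨_, hz⟩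
      exact ⟨hx.trans_le (by exact_mod_cast Nat.mul_le_mul_left g hxy),
        lt_of_le_of_lt (by exact_mod_cast Nat.mul_le_mul_left g hyz) hz⟩
    · rintro a ⟨_, h2⟩
      have h3 : ((g * a : ℕ) : ℝ) ≤ N := h2.le.trans hhi
      exact (Nat.le_mul_of_pos_left a hg).trans (by exact_mod_cast h3)
    · rintro a ⟨h1, _⟩
      rw [div_lt_iff₀' hg']
      exact_mod_cast h1
  have hrw := gcdMain_eq_sum hR lo hi hg
  have hterm : ∀ b ∈ Icc 1 N, ∀ r ∈ R, |windowChi lo hi (g * b) * c r * chi4 g *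
      (N / (g * b * r)) *
          ∑ a ∈ Icc 1 N with MulMemWindow lo hi g a ∧ a.Coprime (b * r), chi4 a / a| ≤
      4 * (N / lo) * ((#b.divisors / b) * (#r.divisors / r)) := by
    intro b hb r hr
    have hb0 : 0 < b := (mem_Icc.1 hb).1
    have hr0 : 0 < r := (hR.odd r hr).pos
    have hb' : (0 : ℝ) < b := by exact_mod_cast hb0
    have hr' : (0 : ℝ) < r := by exact_mod_cast hr0
    have hQ : (0 : ℝ) ≤ N / (g * b * r) := by positivity
    have hone : |windowChi lo hi (g * b) * c r * chi4 g| ≤ 1 := by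
      rw [abs_mul, abs_mul]
      exact mul_le_one₀ (mul_le_one₀ (abs_windowChi_le_one _ _ _) (abs_nonneg _)
        (hR.abs_le_one r hr)) (abs_nonneg _) (abs_chi4_le_one g)
    rw [abs_mul, abs_mul, abs_of_nonneg hQ]
    calc _ ≤ 1 * (N / (g * b * r)) * (((#b.divisors * #r.divisors : ℕ) : ℝ) *
          (4 / (lo / g))) := by
          gcongr
          refine (hin _ (Nat.mul_pos hb0 hr0).ne').trans ?_
          gcongr
          exact card_divisors_mul_le b r
      _ = _ := by
          push_cast
          field_simp
  have hlog : 0 ≤ ∑ n ∈ Icc 1 N, (#n.divisors : ℝ) / n := sum_nonneg fun n _ => by positivity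
  rw [hrw]
  calc _ ≤ ∑ b ∈ Icc 1 N, ∑ r ∈ Icc 1 N,
        4 * (N / lo) * ((#b.divisors / b) * ((#r.divisors : ℝ) / r)) := by
        refine (abs_sum_le_sum_abs _ _).trans (sum_le_sum fun b hb => ?_)
        refine (abs_sum_le_sum_abs _ _).trans ((sum_le_sum fun r hr =>
          hterm b hb r (mem_filter.1 hr).1).trans ?_)
        refine sum_le_sum_of_subset_of_nonneg (fun r hr => ?_) fun r _ _ => by positivity
        have hr := (mem_filter.1 hr).1
        exact mem_Icc.2 ⟨(hR.odd r hr).pos, hR.le_length r hr⟩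
    _ = 4 * (N / lo) * ((∑ n ∈ Icc 1 N, (#n.divisors : ℝ) / n) *
          ∑ n ∈ Icc 1 N, (#n.divisors : ℝ) / n) := by
        rw [sum_mul_sum, mul_sum]
        simp only [mul_sum]
    _ ≤ 4 * (N / lo) * ((1 + Real.log N) ^ 2 * (1 + Real.log N) ^ 2) := by
        have := sum_card_divisors_div_le N
        gcongr
    _ = _ := by ring

lemma abs_gcdMain_le_of_density {R : Finset ℕ} {c : ℕ → ℝ} {N g : ℕ} {lo hi D v : ℝ}
    (hR : IsOddSieve R c N D v) (hlo : 0 < lo) (hlohi : lo ≤ hi) (hhi : hi ≤ N) (hv : 0 ≤ v)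
    (hg : 0 < g) :
    |gcdMain R c N lo hi g| ≤
      N * v * (2 * (1 + Real.log (hi / lo))) ^ 2 * (dedekindRatio g / g) := by
  have hg1 : (1 : ℝ) ≤ g := by exact_mod_cast hg
  have hg' : (0 : ℝ) < g := by linarith
  have hrat : ∀ n, 0 ≤ dedekindRatio n := fun n => zero_le_one.trans (one_le_dedekindRatio n)
  have hwin : ∑ a ∈ Icc 1 N, (if lo < ((g * a : ℕ) : ℝ) ∧ ((g * a : ℕ) : ℝ) < hi then 1 else 0) *
      (dedekindRatio a / a) ≤ 2 * (1 + Real.log (hi / lo)) := by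
    have h := sum_window_dedekindRatio_div_le (u := lo / g) (v := hi / g) (by positivity)
      (by gcongr) (M := N) ((div_le_self (hlo.le.trans hlohi) hg1).trans hhi)
    rw [div_div_div_cancel_right₀ hg'.ne'] at h
    refine le_trans (le_of_eq ?_) h
    rw [sum_filter]
    refine sum_congr rfl fun a _ => ?_
    push_cast
    simp only [div_lt_iff₀' hg', lt_div_iff₀' hg', ite_mul, one_mul, zero_mul]
  have h0 : 0 ≤ ∑ a ∈ Icc 1 N, (if lo < ((g * a : ℕ) : ℝ) ∧ ((g * a : ℕ) : ℝ) < hi then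
      (1 : ℝ) else 0) * (dedekindRatio a / a) :=
    sum_nonneg fun a _ => mul_nonneg (by positivity) (div_nonneg (hrat a) (by positivity))
  calc _ ≤ ∑ b ∈ Icc 1 N, ∑ a ∈ Icc 1 N, N * v * (dedekindRatio g / g) *
        (((if lo < ((g * b : ℕ) : ℝ) ∧ ((g * b : ℕ) : ℝ) < hi then 1 else 0) *
          (dedekindRatio b / b)) *
        ((if lo < ((g * a : ℕ) : ℝ) ∧ ((g * a : ℕ) : ℝ) < hi then 1 else 0) *
          (dedekindRatio a / a))) := by
        rw [gcdMain]
        refine (abs_sum_le_sum_abs _ _).trans (sum_le_sum fun b hb => ?_)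
        have hb0 : 0 < b := (mem_Icc.1 hb).1
        have hb' : (0 : ℝ) < b := by exact_mod_cast hb0
        refine (abs_sum_le_sum_abs _ _).trans ?_
        refine (sum_le_sum fun a ha => ?_).trans
          (sum_le_sum_of_subset_of_nonneg (filter_subset (fun a : ℕ => a.Coprime b) _)
            fun a _ _ => by have := hrat a; have := hrat b; have := hrat g; positivity)
        have ha0 : 0 < a := (mem_Icc.1 (mem_filter.1 ha).1).1
        have ha' : (0 : ℝ) < a := by exact_mod_cast ha0
        have hdens : |sieveDensity R c (g * b * a)| ≤
            v * (dedekindRatio g * dedekindRatio b * dedekindRatio a) := by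
          refine (hR.abs_density_le _ (Nat.mul_pos (Nat.mul_pos hg hb0) ha0)).trans ?_
          have := hrat a
          gcongr
          refine (dedekindRatio_mul_le _ _).trans ?_
          gcongr
          exact dedekindRatio_mul_le _ _
        rw [abs_mul, abs_mul, abs_mul, abs_of_nonneg (show (0 : ℝ) ≤ N / ((g * b * a : ℕ) : ℝ) by
          positivity)]
        calc _ ≤ (if lo < ((g * a : ℕ) : ℝ) ∧ ((g * a : ℕ) : ℝ) < hi then 1 else 0) *
              (if lo < ((g * b : ℕ) : ℝ) ∧ ((g * b : ℕ) : ℝ) < hi then 1 else 0) *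
              (N / ((g * b * a : ℕ) : ℝ) *
                (v * (dedekindRatio g * dedekindRatio b * dedekindRatio a))) := by
              gcongr
              · exact abs_windowChi_le _ _ _
              · exact abs_windowChi_le _ _ _
          _ = _ := by
              generalize (if lo < ((g * a : ℕ) : ℝ) ∧ ((g * a : ℕ) : ℝ) < hi then (1 : ℝ) else 0) =
                x
              generalize (if lo < ((g * b : ℕ) : ℝ) ∧ ((g * b : ℕ) : ℝ) < hi then (1 : ℝ) else 0) =
                y
              push_cast
              field_simp
    _ = N * v * (dedekindRatio g / g) *
        ((∑ a ∈ Icc 1 N, (if lo < ((g * a : ℕ) : ℝ) ∧ ((g * a : ℕ) : ℝ) < hi then 1 else 0) *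
          (dedekindRatio a / a)) *
        ∑ a ∈ Icc 1 N, (if lo < ((g * a : ℕ) : ℝ) ∧ ((g * a : ℕ) : ℝ) < hi then 1 else 0) *
          (dedekindRatio a / a)) := by
        rw [sum_mul_sum, mul_sum]
        simp only [mul_sum]
    _ ≤ N * v * (dedekindRatio g / g) *
        ((2 * (1 + Real.log (hi / lo))) * (2 * (1 + Real.log (hi / lo)))) := by
        have := hrat g
        have := h0.trans hwin
        gcongr
    _ = _ := by ring

lemma sum_powerset_filter_card_le_neg_one_pow {α : Type*} (T : Finset α) (m : ℕ) :
    ∑ s ∈ T.powerset with #s ≤ m, (-1 : ℤ) ^ #s =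
      ∑ j ∈ range (m + 1), (-1) ^ j * ((#T).choose j : ℤ) := by
  rw [sum_filter, sum_powerset_apply_card (fun j => if j ≤ m then (-1 : ℤ) ^ j else 0)]
  have h1 : ∀ j ∈ range (#T + 1), (#T).choose j • (if j ≤ m then (-1 : ℤ) ^ j else 0) =
      if j < m + 1 then (-1) ^ j * ((#T).choose j : ℤ) else 0 := by
    intro j _
    split_ifs <;> first | omega | simp [mul_comm]
  rw [sum_congr rfl h1, ← sum_filter]
  refine sum_subset (fun j hj => mem_range.2 (mem_filter.1 hj).2) fun j hj hj' => ?_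
  have h2 : #T < j := by
    by_contra! h
    exact hj' (mem_filter.2 ⟨mem_range.2 (by omega), mem_range.1 hj⟩)
  rw [Nat.choose_eq_zero_of_lt h2, Nat.cast_zero, mul_zero]

/-- The upper bound in Brun's pure sieve. -/
lemma sum_powerset_filter_card_le_two_mul_nonneg {α : Type*} (T : Finset α) (k : ℕ) :
    0 ≤ ∑ s ∈ T.powerset with #s ≤ 2 * k, (-1 : ℤ) ^ #s := by
  rw [sum_powerset_filter_card_le_neg_one_pow]
  rcases h : #T with _ | n
  · rw [sum_range_succ', sum_eq_zero fun j _ => by simp]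
    simp
  · rw [Int.alternating_sum_range_choose_eq_choose, pow_mul]
    simp

/-- The products of at most `m` distinct elements of `P`. -/
def sieveSupport (P : Finset ℕ) (m : ℕ) : Finset ℕ :=
  {s ∈ P.powerset | #s ≤ m}.image fun s => ∏ p ∈ s, p

lemma sum_sieveSupport {P : Finset ℕ} (hP : ∀ p ∈ P, p.Prime) (m : ℕ) (f : ℕ → ℝ) :
    ∑ r ∈ sieveSupport P m, f r = ∑ s ∈ P.powerset with #s ≤ m, f (∏ p ∈ s, p) := by
  have hprime : ∀ s ∈ P.powerset.filter (#· ≤ m), ∀ p ∈ s, p.Prime := fun s hs p hp =>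
    hP p (mem_powerset.1 (mem_filter.1 hs).1 hp)
  refine sum_image fun s hs t ht hst => ?_
  rw [← Nat.primeFactors_prod (hprime s hs), ← Nat.primeFactors_prod (hprime t ht)]
  exact congrArg _ hst

lemma sum_sieveSupport_filter {P : Finset ℕ} (hP : ∀ p ∈ P, p.Prime) (m : ℕ) (f : ℕ → ℝ)
    (Q : ℕ → Prop) [DecidablePred Q]
    (hQ : ∀ s ⊆ P, Q (∏ p ∈ s, p) ↔ ∀ p ∈ s, Q p) :
    ∑ r ∈ sieveSupport P m with Q r, f r =
      ∑ s ∈ {p ∈ P | Q p}.powerset with #s ≤ m, f (∏ p ∈ s, p) := by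
  rw [sum_filter, sum_sieveSupport hP, ← sum_filter, filter_filter]
  refine sum_congr ?_ fun _ _ => rfl
  ext s
  simp only [mem_filter, mem_powerset, subset_iff]
  constructor
  · rintro ⟨hs, h1, h2⟩
    exact ⟨fun p hp => ⟨hs hp, (hQ s hs).1 h2 p hp⟩, h1⟩
  · rintro ⟨hs, h1⟩
    have hs' : s ⊆ P := fun p hp => (hs hp).1
    exact ⟨hs', h1, (hQ s hs').2 fun p hp => (hs hp).2⟩

/-- The Möbius function on squarefree integers. -/
def sieveWeight (r : ℕ) : ℝ := (-1) ^ #r.primeFactors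

lemma sieveWeight_prod {s : Finset ℕ} (hs : ∀ p ∈ s, p.Prime) :
    sieveWeight (∏ p ∈ s, p) = (-1) ^ #s := by
  rw [sieveWeight, Nat.primeFactors_prod hs]

lemma abs_sieveWeight (r : ℕ) : |sieveWeight r| = 1 := by
  rw [sieveWeight, abs_pow, abs_neg, abs_one, one_pow]

lemma sum_sieveWeight_dvd_eq {P : Finset ℕ} (hP : ∀ p ∈ P, p.Prime) (m n : ℕ) :
    ∑ r ∈ sieveSupport P m with r ∣ n, sieveWeight r =
      ((∑ s ∈ {p ∈ P | p ∣ n}.powerset with #s ≤ m, (-1 : ℤ) ^ #s : ℤ) : ℝ) := by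
  rw [sum_sieveSupport_filter hP m _ (· ∣ n)]
  · push_cast
    refine sum_congr rfl fun s hs => sieveWeight_prod fun p hp => ?_
    exact hP p (mem_filter.1 (mem_powerset.1 (mem_filter.1 hs).1 hp)).1
  · intro s hs
    exact ⟨fun h p hp => (dvd_prod_of_mem _ hp).trans h,
      fun h => prod_primes_dvd n (fun p hp => (hP p (hs hp)).prime) h⟩

lemma sum_sieveWeight_dvd_nonneg {P : Finset ℕ} (hP : ∀ p ∈ P, p.Prime) (k n : ℕ) :
    0 ≤ ∑ r ∈ sieveSupport P (2 * k) with r ∣ n, sieveWeight r := by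
  rw [sum_sieveWeight_dvd_eq hP]
  exact_mod_cast sum_powerset_filter_card_le_two_mul_nonneg _ k

lemma sum_sieveWeight_dvd_eq_one {P : Finset ℕ} (hP : ∀ p ∈ P, p.Prime) (m : ℕ) {n : ℕ}
    (hn : ∀ p ∈ P, ¬p ∣ n) : ∑ r ∈ sieveSupport P m with r ∣ n, sieveWeight r = 1 := by
  rw [sum_sieveWeight_dvd_eq hP, filter_false_of_mem hn]
  simp [sum_filter]

lemma sum_powerset_card_gt_le (P : Finset ℕ) (k : ℕ) :
    ∑ s ∈ P.powerset with ¬#s ≤ 2 * k, ∏ p ∈ s, (1 / (p : ℝ)) ≤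
      (1 / 4) ^ k * ∏ p ∈ P, (1 + 2 / (p : ℝ)) := by
  rw [prod_one_add, mul_sum]
  refine (sum_le_sum fun s hs => ?_).trans
    (sum_le_sum_of_subset_of_nonneg (filter_subset _ _) fun s _ _ => by positivity)
  have hk : 2 * k ≤ #s := by have := (mem_filter.1 hs).2; omega
  have h1 : ∏ p ∈ s, (2 / (p : ℝ)) = 2 ^ #s * ∏ p ∈ s, (1 / (p : ℝ)) := by
    rw [← prod_const, ← prod_mul_distrib]
    exact prod_congr rfl fun p _ => by ring
  have h2 : (2 : ℝ) ^ (2 * k) ≤ 2 ^ #s := pow_le_pow_right₀ one_le_two hk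
  have h3 : ((1 : ℝ) / 4) ^ k * 2 ^ (2 * k) = 1 := by
    rw [pow_mul, ← mul_pow]
    norm_num
  have h0 : (0 : ℝ) ≤ ∏ p ∈ s, (1 / (p : ℝ)) := by positivity
  rw [h1, ← mul_assoc]
  refine le_mul_of_one_le_left h0 (h3.symm.le.trans ?_)
  gcongr

lemma sieveDensity_sieveWeight_eq {P : Finset ℕ} (hP : ∀ p ∈ P, p.Prime) (m q : ℕ) :
    sieveDensity (sieveSupport P m) sieveWeight q =
      ∑ s ∈ {p ∈ P | p.Coprime q}.powerset with #s ≤ m, ∏ p ∈ s, (-(1 / (p : ℝ))) := by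
  rw [sieveDensity, sum_sieveSupport_filter hP m _ (Nat.Coprime · q)
    fun s _ => Nat.coprime_prod_left_iff]
  refine sum_congr rfl fun s hs => ?_
  rw [sieveWeight_prod fun p hp => hP p (mem_filter.1 (mem_powerset.1 (mem_filter.1 hs).1 hp)).1,
    Nat.cast_prod, ← prod_const, ← prod_div_distrib]
  exact prod_congr rfl fun p _ => by ring

lemma abs_sieveDensity_sieveWeight_le {P : Finset ℕ} (hP : ∀ p ∈ P, p.Prime) (k q : ℕ) :
    |sieveDensity (sieveSupport P (2 * k)) sieveWeight q| ≤
      ∏ p ∈ P with p.Coprime q, (1 - 1 / (p : ℝ)) + (1 / 4) ^ k * ∏ p ∈ P, (1 + 2 / (p : ℝ)) := by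
  set Q := P.filter (Nat.Coprime · q) with hQ
  have hprod : ∏ p ∈ Q, (1 - 1 / (p : ℝ)) = sieveDensity (sieveSupport P (2 * k)) sieveWeight q +
      ∑ s ∈ Q.powerset with ¬#s ≤ 2 * k, ∏ p ∈ s, (-(1 / (p : ℝ))) := by
    simp only [sub_eq_add_neg]
    rw [prod_one_add, sieveDensity_sieveWeight_eq hP, sum_filter_add_sum_filter_not]
  have htail : |∑ s ∈ Q.powerset with ¬#s ≤ 2 * k, ∏ p ∈ s, (-(1 / (p : ℝ)))| ≤
      (1 / 4) ^ k * ∏ p ∈ P, (1 + 2 / (p : ℝ)) := by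
    calc _ ≤ ∑ s ∈ Q.powerset with ¬#s ≤ 2 * k, ∏ p ∈ s, (1 / (p : ℝ)) := by
          refine (abs_sum_le_sum_abs _ _).trans_eq (sum_congr rfl fun s _ => ?_)
          rw [abs_prod]
          exact prod_congr rfl fun p _ => by rw [abs_neg, abs_of_nonneg (by positivity)]
      _ ≤ (1 / 4) ^ k * ∏ p ∈ Q, (1 + 2 / (p : ℝ)) := sum_powerset_card_gt_le Q k
      _ ≤ _ := by
          refine mul_le_mul_of_nonneg_left ?_ (by positivity)
          exact prod_le_prod_of_subset_of_one_le (filter_subset _ _)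
            (fun p _ => by positivity) fun p _ _ => le_add_of_nonneg_right (by positivity)
  have hpos : 0 ≤ ∏ p ∈ Q, (1 - 1 / (p : ℝ)) := prod_nonneg fun p hp =>
    sub_nonneg.2 (div_le_self zero_le_one (by exact_mod_cast (hP p (mem_filter.1 hp).1).one_le))
  rw [abs_le] at htail ⊢
  constructor <;> linarith [htail.1, htail.2]

lemma one_sub_inv_nonneg_of_prime {p : ℕ} (hp : p.Prime) : 0 ≤ 1 - 1 / (p : ℝ) :=
  sub_nonneg.2 (div_le_self zero_le_one (by exact_mod_cast hp.one_le))

lemma log_mul_prod_primesBelow_le (z : ℕ) :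
    Real.log (z + 1) * ∏ p ∈ (z + 1).primesBelow, (1 - 1 / (p : ℝ)) ≤ 1 := by
  have hpos : 0 < ∏ p ∈ (z + 1).primesBelow, (1 - 1 / (p : ℝ)) := prod_pos fun p hp =>
    sub_pos.2 ((div_lt_one (by exact_mod_cast (Nat.prime_of_mem_primesBelow hp).pos)).2
      (by exact_mod_cast (Nat.prime_of_mem_primesBelow hp).one_lt))
  let f : ℕ →* ℝ :=
    { toFun := fun n => (n : ℝ)⁻¹
      map_one' := by simp
      map_mul' := fun m n => by push_cast; rw [mul_inv] }
  have hf : ∀ {p : ℕ}, p.Prime → ‖f p‖ < 1 := by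
    intro p hp
    change ‖(p : ℝ)⁻¹‖ < 1
    rw [norm_inv, Real.norm_natCast]
    exact inv_lt_one_of_one_lt₀ (by exact_mod_cast hp.one_lt)
  have hsum := (EulerProduct.summable_and_hasSum_smoothNumbers_prod_primesBelow_geometric hf
    (z + 1)).2
  have hmem : ∀ n : Icc 1 z, (n : ℕ) ∈ (z + 1).smoothNumbers := fun n =>
    Nat.mem_smoothNumbers_of_lt (mem_Icc.1 n.2).1 (Nat.lt_succ_of_le (mem_Icc.1 n.2).2)
  have hle : ∑ n ∈ Icc 1 z, ((n : ℝ))⁻¹ ≤ ∏ p ∈ (z + 1).primesBelow, (1 - f p)⁻¹ := by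
    let e : Icc 1 z ↪ (z + 1).smoothNumbers :=
      ⟨fun n => ⟨n, hmem n⟩, fun a b h => Subtype.ext (Subtype.mk.inj h)⟩
    have h := sum_le_hasSum (univ.map e) (fun n _ => inv_nonneg.2 (Nat.cast_nonneg (n : ℕ))) hsum
    rw [sum_map] at h
    refine le_trans (le_of_eq ?_) h
    rw [← sum_coe_sort]
    rfl
  have hlog : Real.log (z + 1) ≤ ∑ n ∈ Icc 1 z, ((n : ℝ))⁻¹ := by
    have h := log_add_one_le_harmonic z
    rw [harmonic_eq_sum_Icc] at h
    push_cast at h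
    exact h
  have heq : ∏ p ∈ (z + 1).primesBelow, (1 - f p)⁻¹ =
      (∏ p ∈ (z + 1).primesBelow, (1 - 1 / (p : ℝ)))⁻¹ := by
    rw [← prod_inv_distrib]
    exact prod_congr rfl fun p _ => by rw [one_div]; rfl
  calc _ ≤ (∏ p ∈ (z + 1).primesBelow, (1 - 1 / (p : ℝ)))⁻¹ *
        ∏ p ∈ (z + 1).primesBelow, (1 - 1 / (p : ℝ)) := by
        rw [← heq]
        gcongr
        exact hlog.trans hle
    _ = 1 := inv_mul_cancel₀ hpos.ne'

lemma half_le_prod_one_sub_inv_sq {s : Finset ℕ} (hs : ∀ p ∈ s, 2 ≤ p) :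
    1 / 2 ≤ ∏ p ∈ s, (1 - 1 / (p : ℝ) ^ 2) := by
  have htel : ∀ M : ℕ, ∏ n ∈ Icc 2 (M + 1), (1 - 1 / ((n : ℕ) : ℝ) ^ 2) =
      ((M : ℝ) + 2) / (2 * (M + 1)) := by
    intro M
    induction M with
    | zero => norm_num
    | succ M ih =>
      rw [prod_Icc_succ_top (by omega), ih]
      have : (M : ℝ) + 1 ≠ 0 := by positivity
      have : (M : ℝ) + 2 ≠ 0 := by positivity
      push_cast
      field_simp
      ring
  have hle : ∀ n : ℕ, 2 ≤ n → 1 / (n : ℝ) ^ 2 ≤ 1 := by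
    intro n hn
    exact div_le_one_of_le₀ (one_le_pow₀ (by exact_mod_cast (show 1 ≤ n by omega))) (by positivity)
  calc (1 : ℝ) / 2 ≤ ((s.sup id : ℕ) + 2) / (2 * ((s.sup id : ℕ) + 1)) := by
        rw [div_le_div_iff₀ two_pos (by positivity)]
        linarith
    _ = ∏ n ∈ Icc 2 (s.sup id + 1), (1 - 1 / ((n : ℕ) : ℝ) ^ 2) := (htel _).symm
    _ ≤ _ := by
        refine prod_le_prod_of_subset_of_le_one (fun p hp => mem_Icc.2 ⟨hs p hp, ?_⟩)
          (fun n hn => sub_nonneg.2 (hle n (mem_Icc.1 hn).1)) fun n _ _ =>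
            sub_le_self _ (by positivity)
        exact (le_sup (f := id) hp).trans (Nat.le_succ _)

lemma half_le_prod_primeFactors_mul_dedekindRatio (n : ℕ) :
    1 / 2 ≤ (∏ p ∈ n.primeFactors, (1 - 1 / (p : ℝ))) * dedekindRatio n := by
  rw [dedekindRatio, ← prod_mul_distrib]
  refine (half_le_prod_one_sub_inv_sq fun p hp =>
    (Nat.prime_of_mem_primeFactors hp).two_le).trans_eq (prod_congr rfl fun p _ => ?_)
  ring

/-- Removing the primes dividing `2 * q` from the Euler product costs at most a factor of the
order of `dedekindRatio q`. -/
lemma log_mul_prod_coprime_le (z : ℕ) {q : ℕ} (hq : 0 < q) :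
    Real.log (z + 1) * ∏ p ∈ {p ∈ (z + 1).primesBelow | p ≠ 2} with p.Coprime q,
      (1 - 1 / (p : ℝ)) ≤ 3 * dedekindRatio q := by
  have h2q : dedekindRatio (2 * q) ≤ 3 / 2 * dedekindRatio q := by
    refine (dedekindRatio_mul_le 2 q).trans_eq ?_
    rw [dedekindRatio, Nat.Prime.primeFactors Nat.prime_two, prod_singleton]
    norm_num
  have hset : {p ∈ {p ∈ (z + 1).primesBelow | p ≠ 2} | p.Coprime q} =
      {p ∈ (z + 1).primesBelow | ¬p ∣ 2 * q} := by
    ext p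
    simp only [mem_filter, and_assoc]
    refine and_congr_right fun hp => ?_
    have hp' := Nat.prime_of_mem_primesBelow hp
    rw [hp'.dvd_mul, Nat.prime_dvd_prime_iff_eq hp' Nat.prime_two, hp'.coprime_iff_not_dvd, not_or]
  have h0 : ∀ p ∈ (z + 1).primesBelow, 0 ≤ 1 - 1 / (p : ℝ) := fun p hp =>
    one_sub_inv_nonneg_of_prime (Nat.prime_of_mem_primesBelow hp)
  have hdiv : ∏ p ∈ (2 * q).primeFactors, (1 - 1 / (p : ℝ)) ≤
      ∏ p ∈ (z + 1).primesBelow with p ∣ 2 * q, (1 - 1 / (p : ℝ)) := by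
    refine prod_le_prod_of_subset_of_le_one (fun p hp => ?_) (fun p hp =>
      one_sub_inv_nonneg_of_prime (Nat.prime_of_mem_primeFactors hp)) fun p _ _ =>
        sub_le_self _ (by positivity)
    exact Nat.mem_primeFactors.2 ⟨Nat.prime_of_mem_primesBelow (mem_filter.1 hp).1,
      (mem_filter.1 hp).2, by omega⟩
  have hall := log_mul_prod_primesBelow_le z
  have hhalf := half_le_prod_primeFactors_mul_dedekindRatio (2 * q)
  have hh : 0 ≤ dedekindRatio (2 * q) := zero_le_one.trans (one_le_dedekindRatio _)
  have hlog : 0 ≤ Real.log (z + 1) := Real.log_nonneg (by linarith [Nat.cast_nonneg (α := ℝ) z])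
  rw [← prod_filter_mul_prod_filter_not _ (· ∣ 2 * q)] at hall
  rw [hset]
  set x := ∏ p ∈ (z + 1).primesBelow with ¬p ∣ 2 * q, (1 - 1 / (p : ℝ))
  set y := ∏ p ∈ (z + 1).primesBelow with p ∣ 2 * q, (1 - 1 / (p : ℝ))
  have hx : 0 ≤ x := prod_nonneg fun p hp => h0 p (mem_filter.1 hp).1
  calc Real.log (z + 1) * x = 2 * (Real.log (z + 1) * x * (1 / 2)) := by ring
    _ ≤ 2 * (Real.log (z + 1) * x * (y * dedekindRatio (2 * q))) := by
        gcongr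
        exact hhalf.trans (mul_le_mul_of_nonneg_right hdiv hh)
    _ = 2 * (Real.log (z + 1) * (y * x) * dedekindRatio (2 * q)) := by ring
    _ ≤ 2 * (1 * (3 / 2 * dedekindRatio q)) := by gcongr
    _ = _ := by ring

lemma mul_card_primes_Ioc_two_pow_le (j : ℕ) :
    j * #{p ∈ Ioc (2 ^ j) (2 ^ (j + 1)) | p.Prime} ≤ 2 ^ (j + 2) := by
  refine (Nat.pow_le_pow_iff_right (a := 2) (by norm_num)).1 ?_
  calc 2 ^ (j * #{p ∈ Ioc (2 ^ j) (2 ^ (j + 1)) | p.Prime})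
      = ∏ p ∈ Ioc (2 ^ j) (2 ^ (j + 1)) with p.Prime, 2 ^ j := by rw [prod_const, pow_mul]
    _ ≤ ∏ p ∈ Ioc (2 ^ j) (2 ^ (j + 1)) with p.Prime, p :=
        prod_le_prod' fun p hp => (mem_Ioc.1 (mem_filter.1 hp).1).1.le
    _ ≤ primorial (2 ^ (j + 1)) := by
        refine prod_le_prod_of_subset_of_one_le' (fun p hp => ?_) fun p hp _ =>
          (mem_filter.1 hp).2.one_le
        have := (mem_Ioc.1 (mem_filter.1 hp).1).2
        exact mem_filter.2 ⟨mem_range.2 (by omega), (mem_filter.1 hp).2⟩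
    _ ≤ 4 ^ 2 ^ (j + 1) := primorial_le_four_pow _
    _ = 2 ^ 2 ^ (j + 2) := by
        rw [show (4 : ℕ) = 2 ^ 2 by norm_num, ← pow_mul]
        congr 1
        ring

lemma sum_primes_inv_le (K : ℕ) :
    ∑ p ∈ Icc 1 (2 ^ (K + 1)) with p.Prime, (1 : ℝ) / (p : ℕ) ≤
      1 / 2 + 4 * ∑ j ∈ Icc 1 K, (1 : ℝ) / (j : ℕ) := by
  induction K with
  | zero =>
    have : {p ∈ Icc 1 (2 ^ (0 + 1)) | p.Prime} = {2} := by decide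
    rw [this]
    simp
  | succ K ih =>
    have hsplit : Icc 1 (2 ^ (K + 1 + 1)) =
        Icc 1 (2 ^ (K + 1)) ∪ Ioc (2 ^ (K + 1)) (2 ^ (K + 1 + 1)) := by
      have h1 : 1 ≤ 2 ^ (K + 1) := Nat.one_le_two_pow
      have h2 : 2 ^ (K + 1) ≤ 2 ^ (K + 1 + 1) := Nat.pow_le_pow_right two_pos (Nat.le_succ _)
      ext p
      simp only [mem_union, mem_Icc, mem_Ioc]
      omega
    have hdisj : Disjoint {p ∈ Icc 1 (2 ^ (K + 1)) | p.Prime}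
        {p ∈ Ioc (2 ^ (K + 1)) (2 ^ (K + 1 + 1)) | p.Prime} := by
      refine disjoint_filter_filter (disjoint_left.2 fun p hp hp' => ?_)
      have := (mem_Icc.1 hp).2
      have := (mem_Ioc.1 hp').1
      omega
    have hblock : ∑ p ∈ Ioc (2 ^ (K + 1)) (2 ^ (K + 1 + 1)) with p.Prime, (1 : ℝ) / (p : ℕ) ≤
        4 * (1 / ((K + 1 : ℕ) : ℝ)) := by
      have hcard : ((K + 1 : ℕ) : ℝ) * #{p ∈ Ioc (2 ^ (K + 1)) (2 ^ (K + 1 + 1)) | p.Prime} ≤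
          2 ^ (K + 1 + 2) := by exact_mod_cast mul_card_primes_Ioc_two_pow_le (K + 1)
      have hK : (0 : ℝ) < ((K + 1 : ℕ) : ℝ) := by positivity
      calc _ ≤ ∑ p ∈ Ioc (2 ^ (K + 1)) (2 ^ (K + 1 + 1)) with p.Prime, 1 / (2 : ℝ) ^ (K + 1) := by
            refine sum_le_sum fun p hp => ?_
            have : (2 : ℝ) ^ (K + 1) ≤ p := by
              exact_mod_cast (mem_Ioc.1 (mem_filter.1 hp).1).1.le
            gcongr
        _ = #{p ∈ Ioc (2 ^ (K + 1)) (2 ^ (K + 1 + 1)) | p.Prime} / (2 : ℝ) ^ (K + 1) := by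
            rw [sum_const, nsmul_eq_mul, mul_one_div]
        _ ≤ _ := by
            rw [mul_one_div, div_le_div_iff₀ (by positivity) hK, mul_comm]
            refine hcard.trans_eq ?_
            ring
    rw [hsplit, filter_union, sum_union hdisj, sum_Icc_succ_top (by omega), mul_add, ← add_assoc]
    exact add_le_add ih hblock

/-- A crude upper bound for the product of `1 + 2 / p`. -/
lemma prod_primes_one_add_two_div_le {P : Finset ℕ} {K : ℕ} (hP : ∀ p ∈ P, p.Prime)
    (hK : 0 < K) (hPK : ∀ p ∈ P, p ≤ 2 ^ (K + 1)) :
    ∏ p ∈ P, (1 + 2 / (p : ℝ)) ≤ Real.exp 9 * (K : ℝ) ^ 8 := by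
  have hK' : (0 : ℝ) < K := by exact_mod_cast hK
  have hsum : ∑ p ∈ P, 2 / (p : ℝ) ≤ 9 + 8 * Real.log K := by
    have h1 : ∑ p ∈ P, 1 / (p : ℝ) ≤ 1 / 2 + 4 * (1 + Real.log K) := by
      refine (sum_le_sum_of_subset_of_nonneg (fun p hp => mem_filter.2 ⟨mem_Icc.2
        ⟨(hP p hp).one_le, hPK p hp⟩, hP p hp⟩) fun _ _ _ => by positivity).trans
          ((sum_primes_inv_le K).trans ?_)
      gcongr
      exact sum_Icc_inv_le K
    calc _ = 2 * ∑ p ∈ P, 1 / (p : ℝ) := by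
          rw [mul_sum]
          exact sum_congr rfl fun p _ => by ring
      _ ≤ _ := by linarith
  calc _ ≤ ∏ p ∈ P, Real.exp (2 / (p : ℝ)) := by
        refine prod_le_prod (fun p _ => by positivity) fun p _ => ?_
        rw [add_comm]
        exact Real.add_one_le_exp _
    _ = Real.exp (∑ p ∈ P, 2 / (p : ℝ)) := (Real.exp_sum _ _).symm
    _ ≤ Real.exp (9 + 8 * Real.log K) := Real.exp_le_exp.2 hsum
    _ = _ := by
        rw [Real.exp_add, mul_comm (8 : ℝ), Real.exp_mul, Real.exp_log hK']
        norm_cast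

/-- The odd primes up to `z`. -/
def oddPrimes (z : ℕ) : Finset ℕ := {p ∈ (z + 1).primesBelow | p ≠ 2}

lemma prime_of_mem_oddPrimes {z p : ℕ} (hp : p ∈ oddPrimes z) : p.Prime :=
  Nat.prime_of_mem_primesBelow (mem_filter.1 hp).1

lemma le_of_mem_oddPrimes {z p : ℕ} (hp : p ∈ oddPrimes z) : p ≤ z :=
  Nat.lt_succ_iff.1 (Nat.lt_of_mem_primesBelow (mem_filter.1 hp).1)

lemma odd_and_le_of_mem_sieveSupport {z m r : ℕ} (hz : 0 < z)
    (hr : r ∈ sieveSupport (oddPrimes z) m) : Odd r ∧ r ≤ z ^ m := by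
  obtain ⟨s, hs, rfl⟩ := mem_image.1 hr
  obtain ⟨hs, hm⟩ := mem_filter.1 hs
  have hs := mem_powerset.1 hs
  refine ⟨prod_induction _ Odd (fun _ _ => Odd.mul) odd_one fun p hp => ?_, ?_⟩
  · exact (prime_of_mem_oddPrimes (hs hp)).odd_of_ne_two (mem_filter.1 (hs hp)).2
  · exact (prod_le_pow_card s _ z fun p hp => le_of_mem_oddPrimes (hs hp)).trans
      (Nat.pow_le_pow_right hz hm)

lemma isOddSieve_sieveSupport {N z k K : ℕ} {D : ℝ} (hz : 0 < z)
    (hD : (z : ℝ) ^ (2 * k) ≤ D) (hDN : D ≤ N) (hK : 0 < K) (hzK : z ≤ 2 ^ (K + 1)) :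
    IsOddSieve (sieveSupport (oddPrimes z) (2 * k)) sieveWeight N D
      (3 / Real.log (z + 1) + (1 / 4) ^ k * (Real.exp 9 * (K : ℝ) ^ 8)) where
  odd r hr := (odd_and_le_of_mem_sieveSupport hz hr).1
  le_length r hr := by
    have h : (r : ℝ) ≤ (z : ℝ) ^ (2 * k) := by
      exact_mod_cast (odd_and_le_of_mem_sieveSupport hz hr).2
    exact_mod_cast (h.trans hD).trans hDN
  le_level r hr := by
    refine le_trans ?_ hD
    exact_mod_cast (odd_and_le_of_mem_sieveSupport hz hr).2
  card_le := by
    refine le_trans ?_ hD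
    have h : sieveSupport (oddPrimes z) (2 * k) ⊆ Icc 1 (z ^ (2 * k)) := fun r hr =>
      mem_Icc.2 ⟨(odd_and_le_of_mem_sieveSupport hz hr).1.pos,
        (odd_and_le_of_mem_sieveSupport hz hr).2⟩
    have h' := card_le_card h
    rw [Nat.card_Icc, Nat.add_sub_cancel] at h'
    exact_mod_cast h'
  abs_le_one r _ := (abs_sieveWeight r).le
  abs_density_le q hq := by
    have hz' : (0 : ℝ) < z := by exact_mod_cast hz
    have hlog : 0 < Real.log (z + 1) := Real.log_pos (by linarith)
    refine (abs_sieveDensity_sieveWeight_le (fun p => prime_of_mem_oddPrimes) k q).trans ?_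
    rw [add_mul]
    refine add_le_add ?_ ?_
    · rw [div_mul_eq_mul_div, le_div_iff₀' hlog]
      exact log_mul_prod_coprime_le z hq
    · refine le_trans ?_ (le_mul_of_one_le_right (by positivity) (one_le_dedekindRatio q))
      gcongr
      exact prod_primes_one_add_two_div_le (fun p => prime_of_mem_oddPrimes) hK fun p hp =>
        (le_of_mem_oddPrimes hp).trans hzK

lemma four_inv_pow_ceil_le {L : ℝ} (hL : 0 < L) :
    (1 / 4 : ℝ) ^ ⌈9 * Real.log L⌉₊ ≤ (L ^ 9)⁻¹ := by
  have h1 : (1 / 4 : ℝ) ≤ Real.exp (-1) := by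
    rw [Real.exp_neg, one_div]
    exact inv_anti₀ (Real.exp_pos 1) (by linarith [Real.exp_one_lt_d9])
  calc _ ≤ Real.exp (-1) ^ ⌈9 * Real.log L⌉₊ := by gcongr
    _ = Real.exp (-(⌈9 * Real.log L⌉₊ : ℝ)) := by rw [← Real.exp_nat_mul, mul_neg_one]
    _ ≤ Real.exp (-(9 * Real.log L)) := Real.exp_le_exp.2 (neg_le_neg (Nat.le_ceil _))
    _ = (L ^ 9)⁻¹ := by
        rw [Real.exp_neg, mul_comm, Real.exp_mul, Real.exp_log hL]
        norm_cast

/-- An upper bound sieve of level `N ^ (1 / 100)` whose density is within a factor `log log N` of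
the density of the primes. -/
lemma exists_isOddSieve : ∃ C : ℝ, 0 < C ∧ ∀ N : ℕ, 1 ≤ Real.log (Real.log N) →
    ∃ (R : Finset ℕ) (c : ℕ → ℝ),
      IsOddSieve R c N ((N : ℝ) ^ (1 / 100 : ℝ)) (C * Real.log (Real.log N) / Real.log N) ∧
      (∀ n, 0 ≤ ∑ r ∈ R with r ∣ n, c r) ∧
      ∀ p : ℕ, p.Prime → (N : ℝ) ^ (1 / 100 : ℝ) < p → 1 ≤ ∑ r ∈ R with r ∣ p, c r := by
  refine ⟨6000 + 256 * Real.exp 9, by positivity, fun N hN => ?_⟩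
  have hL0 : 0 < Real.log N := by
    have h0 : 0 ≤ Real.log N := Real.log_natCast_nonneg N
    refine h0.lt_of_ne fun h => ?_
    rw [← h, Real.log_zero] at hN
    linarith
  have hN1 : (1 : ℝ) < N := by
    by_contra! h
    exact hL0.not_ge (Real.log_nonpos (Nat.cast_nonneg N) h)
  set L := Real.log N with hLdef
  have hL1 : 1 ≤ L := by linarith [Real.log_le_sub_one_of_pos hL0]
  set k := ⌈9 * Real.log L⌉₊
  have hk0 : 0 < k := Nat.ceil_pos.2 (by linarith)
  have hk0' : (0 : ℝ) < k := by exact_mod_cast hk0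
  have hk : (k : ℝ) ≤ 10 * Real.log L := by
    linarith [Nat.ceil_lt_add_one (show 0 ≤ 9 * Real.log L by linarith)]
  set x : ℝ := (N : ℝ) ^ (1 / (200 * k) : ℝ)
  have hx1 : 1 ≤ x := Real.one_le_rpow hN1.le (by positivity)
  set z := ⌊x⌋₊
  have hz0 : 0 < z := Nat.floor_pos.2 hx1
  have hzx : (z : ℝ) ≤ x := Nat.floor_le (by linarith)
  have hD : (z : ℝ) ^ (2 * k) ≤ (N : ℝ) ^ (1 / 100 : ℝ) := by
    calc _ ≤ x ^ (2 * k) := by gcongr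
      _ = _ := by
          rw [← Real.rpow_natCast x, ← Real.rpow_mul (by positivity)]
          congr 1
          push_cast
          field_simp
          norm_num
  have hDN : (N : ℝ) ^ (1 / 100 : ℝ) ≤ N := by
    conv_rhs => rw [← Real.rpow_one (N : ℝ)]
    exact Real.rpow_le_rpow_of_exponent_le hN1.le (by norm_num)
  set K := ⌊2 * L⌋₊
  have hK0 : 0 < K := Nat.floor_pos.2 (by linarith)
  have hK : (K : ℝ) ≤ 2 * L := Nat.floor_le (by linarith)
  have hzK : z ≤ 2 ^ (K + 1) := by
    have h1 : (N : ℝ) ≤ 2 ^ (K + 1) := by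
      rw [← Real.log_le_log_iff (by linarith) (by positivity), Real.log_pow, ← hLdef]
      push_cast
      nlinarith [Nat.lt_floor_add_one (2 * L), Real.log_two_gt_d9]
    have h2 : x ≤ N := by
      conv_rhs => rw [← Real.rpow_one (N : ℝ)]
      refine Real.rpow_le_rpow_of_exponent_le hN1.le ?_
      rw [div_le_one (by positivity)]
      have : (1 : ℝ) ≤ k := by exact_mod_cast hk0
      linarith
    exact_mod_cast (hzx.trans h2).trans h1
  have hsieve := isOddSieve_sieveSupport hz0 hD hDN hK0 hzK
  have hlogz : L / (200 * k) ≤ Real.log (z + 1) := by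
    calc L / (200 * k) = Real.log x := by
          rw [Real.log_rpow (by linarith)]
          ring
      _ ≤ _ := Real.log_le_log (by linarith) (Nat.lt_floor_add_one x).le
  have hv : 3 / Real.log (z + 1) + (1 / 4) ^ k * (Real.exp 9 * (K : ℝ) ^ 8) ≤
      (6000 + 256 * Real.exp 9) * Real.log L / L := by
    have h1 : 3 / Real.log (z + 1) ≤ 6000 * Real.log L / L := by
      calc _ ≤ 3 / (L / (200 * k)) := by gcongr
        _ = 600 * k / L := by
            field_simp
            norm_num
        _ ≤ 600 * (10 * Real.log L) / L := by gcongr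
        _ = _ := by ring
    have h2 : (1 / 4) ^ k * (Real.exp 9 * (K : ℝ) ^ 8) ≤ 256 * Real.exp 9 * Real.log L / L := by
      calc _ ≤ (L ^ 9)⁻¹ * (Real.exp 9 * (2 * L) ^ 8) := by
            gcongr
            exact four_inv_pow_ceil_le hL0
        _ = 256 * Real.exp 9 * 1 / L := by
            field_simp
            norm_num
        _ ≤ _ := by gcongr
    calc _ ≤ 6000 * Real.log L / L + 256 * Real.exp 9 * Real.log L / L := add_le_add h1 h2
      _ = _ := by ring
  refine ⟨_, _, { hsieve with
    abs_density_le := fun q hq => (hsieve.abs_density_le q hq).trans ?_ }, ?_, ?_⟩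
  · exact mul_le_mul_of_nonneg_right hv (zero_le_one.trans (one_le_dedekindRatio q))
  · exact sum_sieveWeight_dvd_nonneg (fun p => prime_of_mem_oddPrimes) k
  · intro p hp hDp
    refine (sum_sieveWeight_dvd_eq_one (fun p => prime_of_mem_oddPrimes) _ fun l hl hlp => ?_).ge
    have h1 : l = p := (Nat.prime_dvd_prime_iff_eq (prime_of_mem_oddPrimes hl) hp).1 hlp
    have h2 : p ≤ z ^ (2 * k) :=
      h1 ▸ (le_of_mem_oddPrimes hl).trans (Nat.le_self_pow (by omega) z)
    have h3 : (p : ℝ) ≤ (z : ℝ) ^ (2 * k) := by exact_mod_cast h2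
    linarith

lemma card_filter_Icc_le (N : ℕ) {G : ℝ} (hG : 0 ≤ G) :
    (#{g ∈ Icc 1 N | ((g : ℕ) : ℝ) ≤ G} : ℝ) ≤ G := by
  have h : {g ∈ Icc 1 N | ((g : ℕ) : ℝ) ≤ G} ⊆ Icc 1 ⌊G⌋₊ := fun g hg =>
    mem_Icc.2 ⟨(mem_Icc.1 (mem_filter.1 hg).1).1, Nat.le_floor (mem_filter.1 hg).2⟩
  have h' := card_le_card h
  rw [Nat.card_Icc, Nat.add_sub_cancel] at h'
  exact (Nat.cast_le.2 h').trans (Nat.floor_le hG)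

lemma sum_filter_lt_inv_sq_le (N : ℕ) {G : ℝ} (hG : 0 < G) :
    ∑ g ∈ Icc 1 N with G < ((g : ℕ) : ℝ), 1 / (g : ℝ) ^ 2 ≤ (1 + Real.log N) / G := by
  calc _ ≤ ∑ g ∈ Icc 1 N with G < ((g : ℕ) : ℝ), (1 / (g : ℝ)) / G := by
        refine sum_le_sum fun g hg => ?_
        have hGg := (mem_filter.1 hg).2
        have hg0 : (0 : ℝ) < g := hG.trans hGg
        rw [div_div]
        refine one_div_le_one_div_of_le (by positivity) ?_
        rw [sq]
        gcongr
    _ ≤ ∑ g ∈ Icc 1 N, (1 / (g : ℝ)) / G :=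
        sum_le_sum_of_subset_of_nonneg (filter_subset _ _) fun _ _ _ => by positivity
    _ = (∑ g ∈ Icc 1 N, 1 / (g : ℝ)) / G := (sum_div _ _ _).symm
    _ ≤ _ := by
        gcongr
        exact sum_Icc_inv_le N

/-- The sifted second moment, with the greatest common divisors cut at `G` and at `H`. -/
lemma sum_gcdPart_le {R : Finset ℕ} {c : ℕ → ℝ} {N : ℕ} {lo hi D v G H : ℝ}
    (hR : IsOddSieve R c N D v) (hlo : 0 < lo) (hlohi : lo ≤ hi) (hhi : hi ≤ N) (hv : 0 ≤ v)
    (hG : 0 < G) (hH : 0 < H) (hHhi : H ≤ hi) :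
    ∑ g ∈ Icc 1 N, gcdPart R c N lo hi g ≤
      G * (4 * D ^ 2 * (N / lo) * (1 + Real.log N) ^ 2) +
      D * hi ^ 2 * ((1 + Real.log N) / G) +
      H * (4 * (N / lo) * (1 + Real.log N) ^ 4) +
      N * v * (2 * (1 + Real.log (hi / lo))) ^ 2 * (2 * (1 + Real.log (hi / H))) := by
  have hD : 0 ≤ D := (Nat.cast_nonneg _).trans hR.card_le
  have hlog : 0 ≤ Real.log N := Real.log_natCast_nonneg N
  set A := 4 * D ^ 2 * (N / lo) * (1 + Real.log N) ^ 2 with hA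
  set B := 4 * (N / lo) * (1 + Real.log N) ^ 4 with hB
  set M := N * v * (2 * (1 + Real.log (hi / lo))) ^ 2 with hM
  have hA0 : 0 ≤ A := by positivity
  have hB0 : 0 ≤ B := by positivity
  have hM0 : 0 ≤ M := by positivity
  have hpt : ∀ g ∈ Icc 1 N, gcdPart R c N lo hi g ≤
      (if (g : ℝ) ≤ G then A else 0) + (if G < (g : ℝ) then D * hi ^ 2 * (1 / (g : ℝ) ^ 2) else 0) +
      (if (g : ℝ) ≤ H then B else 0) +
      (if H < (g : ℝ) ∧ (g : ℝ) < hi then M * (dedekindRatio g / g) else 0) := by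
    intro g hg
    have hg0 : 0 < g := (mem_Icc.1 hg).1
    have h1 : 0 ≤ (if (g : ℝ) ≤ G then A else 0) := by split_ifs <;> positivity
    have h2 : 0 ≤ (if G < (g : ℝ) then D * hi ^ 2 * (1 / (g : ℝ) ^ 2) else 0) := by
      split_ifs <;> positivity
    have h3 : 0 ≤ (if (g : ℝ) ≤ H then B else 0) := by split_ifs <;> positivity
    have h4 : 0 ≤ (if H < (g : ℝ) ∧ (g : ℝ) < hi then M * (dedekindRatio g / g) else 0) := by
      have := zero_le_one.trans (one_le_dedekindRatio g)
      split_ifs <;> positivity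
    rcases le_or_gt hi g with hhig | hghi
    · rw [gcdPart_eq_zero R c N lo hhig]
      positivity
    rcases le_or_gt (g : ℝ) G with hgG | hGg
    · have h := (le_abs_self _).trans (abs_gcdPart_le hR hlo hhi hg0)
      rw [if_pos hgG]
      rw [← hA] at h
      linarith
    have hsub := (le_abs_self _).trans (abs_gcdPart_sub_gcdMain_le (c := c) (lo := lo) hR
      (hlo.le.trans hlohi) hg0)
    have h2' : D * (hi / g) ^ 2 = D * hi ^ 2 * (1 / (g : ℝ) ^ 2) := by ring
    rw [h2'] at hsub
    rw [if_pos hGg]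
    rcases le_or_gt (g : ℝ) H with hgH | hHg
    · have h := (le_abs_self _).trans (abs_gcdMain_le hR hlo hhi hg0)
      rw [← hB] at h
      rw [if_pos hgH]
      linarith
    · have h := (le_abs_self _).trans (abs_gcdMain_le_of_density hR hlo hlohi hhi hv hg0)
      rw [← hM] at h
      rw [if_pos (show H < (g : ℝ) ∧ (g : ℝ) < hi from ⟨hHg, hghi⟩)]
      linarith
  refine (sum_le_sum hpt).trans ?_
  rw [sum_add_distrib, sum_add_distrib, sum_add_distrib]
  simp only [← sum_filter]
  rw [sum_const, sum_const, nsmul_eq_mul, nsmul_eq_mul, ← mul_sum, ← mul_sum]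
  have hwin := sum_window_dedekindRatio_div_le hH hHhi hhi
  have hcG := card_filter_Icc_le N hG.le
  have hcH := card_filter_Icc_le N hH.le
  have hsq := sum_filter_lt_inv_sq_le N hG
  gcongr

/-- Detecting the primes by sieve weights. -/
lemma sum_primes_sq_sum_divisors_le {w : ℕ → ℝ} {N : ℕ} {f : ℕ → ℝ} {U : ℝ}
    (hw : ∀ n, 0 ≤ w n) (hwp : ∀ p : ℕ, p.Prime → U < p → 1 ≤ w p)
    (hf : ∀ d : ℕ, (d : ℝ) ≤ U → f d = 0) :
    ∑ p ∈ range (N + 1), (if p.Prime then |∑ d ∈ (p - 1).divisors, f d| ^ 2 else 0) ≤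
      ∑ n ∈ Icc 1 N, w (n + 1) * (∑ d ∈ n.divisors, f d) ^ 2 := by
  have hterm : ∀ n ∈ range N,
      (if (n + 1).Prime then |∑ d ∈ (n + 1 - 1).divisors, f d| ^ 2 else 0) ≤
        w (n + 1) * (∑ d ∈ n.divisors, f d) ^ 2 := by
    intro n _
    rw [Nat.add_sub_cancel, sq_abs]
    split_ifs with hp
    · rcases le_or_gt (((n + 1 : ℕ) : ℕ) : ℝ) U with hU | hU
      · rw [sum_eq_zero fun d hd => hf d ?_]
        · simp
        · refine le_trans ?_ hU
          exact_mod_cast (Nat.divisor_le hd).trans (Nat.le_succ n)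
      · exact le_mul_of_one_le_left (sq_nonneg _) (hwp _ hp hU)
    · exact mul_nonneg (hw _) (sq_nonneg _)
  rw [sum_range_succ', if_neg Nat.not_prime_zero, add_zero]
  refine (sum_le_sum hterm).trans ?_
  rw [← sum_erase (range N) (a := 0) (by simp)]
  refine sum_le_sum_of_subset_of_nonneg (fun n hn => ?_) fun n _ _ =>
    mul_nonneg (hw _) (sq_nonneg _)
  have h1 := mem_range.1 (mem_erase.1 hn).2
  have h2 := (mem_erase.1 hn).1
  exact mem_Icc.2 ⟨by omega, by omega⟩

lemma eventually_log_rpow_le (ω : ℝ) : ∀ᶠ N : ℕ in Filter.atTop,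
    Real.log N ^ ω ≤ (N : ℝ) ^ (1 / 100 : ℝ) := by
  have h := (isLittleO_log_rpow_rpow_atTop ω (show (0 : ℝ) < 1 / 100 by norm_num)).bound one_pos
  filter_upwards [tendsto_natCast_atTop_atTop.eventually h] with N hN
  rw [one_mul] at hN
  refine (le_abs_self _).trans (hN.trans_eq ?_)
  rw [Real.norm_of_nonneg (by positivity)]

/-- The estimate for the sifted second moment at the chosen parameters, where `X = U ^ 100`. -/
lemma second_moment_numerics {X U W L l v ω C : ℝ} (hX : X = U ^ 100) (hU : 1 ≤ U) (hW : 1 ≤ W)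
    (hWU : W ≤ U) (hL : 1 ≤ L) (hLU : L ≤ U) (hl : 1 ≤ l) (hω : 0 < ω) (hC : 0 < C)
    (hv : v = C * l / L) :
    U ^ 40 * (4 * U ^ 2 * (X / (U ^ 50 * W⁻¹)) * (1 + L) ^ 2) +
      U * (U ^ 50 * W) ^ 2 * ((1 + L) / U ^ 40) +
      U ^ 50 / (W * L ^ 5) * (4 * (X / (U ^ 50 * W⁻¹)) * (1 + L) ^ 4) +
      X * v * (2 * (1 + 2 * ω * l)) ^ 2 * (2 * (1 + (2 * ω + 5) * l)) ≤
    (82 + 8 * C * (1 + 2 * ω) ^ 2 * (2 * ω + 6)) * X * L⁻¹ * l ^ 7 := by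
  have hU0 : 0 < U := by linarith
  have hW0 : 0 < W := by linarith
  have hL0 : 0 < L := by linarith
  have hX0 : 0 < X := hX ▸ pow_pos hU0 _
  have hl4 : l ^ 4 ≤ l ^ 7 := pow_le_pow_right₀ hl (by norm_num)
  have hl7 : 1 ≤ l ^ 7 := one_le_pow₀ hl
  have hbase : U ^ 99 ≤ X * L⁻¹ := by
    rw [← div_eq_mul_inv, le_div_iff₀ hL0, hX]
    calc U ^ 99 * L ≤ U ^ 99 * U := by gcongr
      _ = U ^ 100 := by ring
  have hquot : X / (U ^ 50 * W⁻¹) = U ^ 50 * W := by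
    rw [hX]
    field_simp
  have h1L : 1 + L ≤ 2 * L := by linarith
  have hT1 : U ^ 40 * (4 * U ^ 2 * (X / (U ^ 50 * W⁻¹)) * (1 + L) ^ 2) ≤ 16 * (X * L⁻¹) := by
    rw [hquot]
    calc _ ≤ U ^ 40 * (4 * U ^ 2 * (U ^ 50 * U) * (2 * U) ^ 2) := by
          gcongr
          linarith
      _ = 16 * U ^ 95 := by ring
      _ ≤ 16 * U ^ 99 := by
          gcongr
          norm_num
      _ ≤ _ := by gcongr
  have hT2 : U * (U ^ 50 * W) ^ 2 * ((1 + L) / U ^ 40) ≤ 2 * (X * L⁻¹) := by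
    calc _ ≤ U * (U ^ 50 * U) ^ 2 * ((2 * U) / U ^ 40) := by
          gcongr
          linarith
      _ = 2 * U ^ 64 := by
          field_simp
      _ ≤ 2 * U ^ 99 := by
          gcongr
          norm_num
      _ ≤ _ := by gcongr
  have hT3 : U ^ 50 / (W * L ^ 5) * (4 * (X / (U ^ 50 * W⁻¹)) * (1 + L) ^ 4) ≤
      64 * (X * L⁻¹) := by
    rw [hquot]
    calc _ ≤ U ^ 50 / (W * L ^ 5) * (4 * (U ^ 50 * W) * (2 * L) ^ 4) := by gcongr
      _ = 64 * (X * L⁻¹) := by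
          rw [hX]
          field_simp
          norm_num
  have hT4 : X * v * (2 * (1 + 2 * ω * l)) ^ 2 * (2 * (1 + (2 * ω + 5) * l)) ≤
      8 * C * (1 + 2 * ω) ^ 2 * (2 * ω + 6) * (X * L⁻¹) * l ^ 7 := by
    calc _ ≤ X * v * (2 * ((1 + 2 * ω) * l)) ^ 2 * (2 * ((2 * ω + 6) * l)) := by
          have : 0 ≤ v := by rw [hv]; positivity
          gcongr
          · linarith
          · linarith
      _ = 8 * C * (1 + 2 * ω) ^ 2 * (2 * ω + 6) * (X * L⁻¹) * l ^ 4 := by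
          rw [hv]
          ring
      _ ≤ _ := by gcongr
  have hXL : 0 ≤ X * L⁻¹ := by positivity
  have h82 : 82 * (X * L⁻¹) ≤ 82 * (X * L⁻¹) * l ^ 7 := le_mul_of_one_le_right (by positivity) hl7
  calc _ ≤ 82 * (X * L⁻¹) * l ^ 7 +
        8 * C * (1 + 2 * ω) ^ 2 * (2 * ω + 6) * (X * L⁻¹) * l ^ 7 := by linarith
    _ = _ := by ring

/-- Hooley:
∑_{p ≤ N} |∑_{d ∣ p-1, √N L^{-ω} < d < √N L^{ω}} χ(d)|² ≪ N L^{-1} (log L)⁷. -/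
theorem hooley_second_moment :
    ∀ ω : ℝ, 0 < ω → ∃ C : ℝ, 0 < C ∧ ∃ N0 : ℕ, ∀ N : ℕ, N0 ≤ N →
      (∑ p ∈ Finset.range (N + 1),
          if p.Prime then
            |∑ d ∈ (p - 1).divisors,
                if Real.sqrt N * Real.log N ^ (-ω) < (d : ℝ) ∧
                    (d : ℝ) < Real.sqrt N * Real.log N ^ ω then
                  chi4 d
                else 0| ^ 2
          else 0) ≤
        C * (N : ℝ) * (Real.log N)⁻¹ * Real.log (Real.log N) ^ 7 := by
  intro ω hω
  obtain ⟨C, hC, hsieve⟩ := exists_isOddSieve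
  refine ⟨82 + 8 * C * (1 + 2 * ω) ^ 2 * (2 * ω + 6), by positivity, ?_⟩
  have hloglog : ∀ᶠ N : ℕ in Filter.atTop, 1 ≤ Real.log (Real.log N) :=
    (Real.tendsto_log_atTop.comp (Real.tendsto_log_atTop.comp
      tendsto_natCast_atTop_atTop)).eventually_ge_atTop 1
  have hlogN : ∀ᶠ N : ℕ in Filter.atTop, 1 ≤ Real.log N :=
    (Real.tendsto_log_atTop.comp tendsto_natCast_atTop_atTop).eventually_ge_atTop 1
  obtain ⟨N0, hN0⟩ := Filter.eventually_atTop.1 (hloglog.and (hlogN.and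
    ((eventually_log_rpow_le 1).and (eventually_log_rpow_le ω))))
  refine ⟨N0, fun N hN => ?_⟩
  obtain ⟨hl, hL, hLU, hWU⟩ := hN0 N hN
  obtain ⟨R, c, hR, hnonneg, hprime⟩ := hsieve N hl
  rw [Real.rpow_one] at hLU
  have hN0 : (0 : ℝ) ≤ N := Nat.cast_nonneg N
  set U : ℝ := (N : ℝ) ^ (1 / 100 : ℝ)
  set L := Real.log N
  set W := L ^ ω
  set l := Real.log L with hldef
  have hL0 : 0 < L := by linarith
  have hW : 1 ≤ W := Real.one_le_rpow hL hω.le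
  have hW0 : 0 < W := by linarith
  have hU : 1 ≤ U := hL.trans hLU
  have hU0 : 0 < U := by linarith
  have hNU : (N : ℝ) = U ^ 100 := by
    rw [← Real.rpow_natCast U, ← Real.rpow_mul hN0]
    norm_num
  have hsqrt : Real.sqrt N = U ^ 50 := by
    rw [hNU, show U ^ 100 = (U ^ 50) ^ 2 by ring, Real.sqrt_sq (by positivity)]
  rw [hsqrt, Real.rpow_neg hL0.le]
  have hWinv : W⁻¹ ≤ 1 := inv_le_one_of_one_le₀ hW
  have hUlo : U ≤ U ^ 50 * W⁻¹ := by
    rw [← div_eq_mul_inv, le_div_iff₀ hW0]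
    calc U * W ≤ U * U := by gcongr
      _ = U ^ 2 := by ring
      _ ≤ U ^ 50 := pow_le_pow_right₀ hU (by norm_num)
  have hhiN : U ^ 50 * W ≤ N := by
    rw [hNU]
    calc U ^ 50 * W ≤ U ^ 50 * U := by gcongr
      _ = U ^ 51 := by ring
      _ ≤ U ^ 100 := pow_le_pow_right₀ hU (by norm_num)
  have hWL : 1 ≤ W * L ^ 5 := one_le_mul_of_one_le_of_one_le hW (one_le_pow₀ hL)
  have hlogW : Real.log W = ω * l := Real.log_rpow hL0 ω
  have hratio : Real.log (U ^ 50 * W / (U ^ 50 * W⁻¹)) = 2 * ω * l := by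
    rw [show U ^ 50 * W / (U ^ 50 * W⁻¹) = W ^ 2 by field_simp, Real.log_pow, hlogW]
    push_cast
    ring
  have hratio' : Real.log (U ^ 50 * W / (U ^ 50 / (W * L ^ 5))) = (2 * ω + 5) * l := by
    rw [show U ^ 50 * W / (U ^ 50 / (W * L ^ 5)) = W ^ 2 * L ^ 5 by field_simp,
      Real.log_mul (by positivity) (by positivity), Real.log_pow, Real.log_pow, hlogW]
    push_cast
    ring
  have hsum := sum_gcdPart_le hR (lo := U ^ 50 * W⁻¹) (hi := U ^ 50 * W) (by positivity)
    (by gcongr; exact hWinv.trans hW) hhiN (by positivity) (show 0 < U ^ 40 by positivity)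
    (show 0 < U ^ 50 / (W * L ^ 5) by positivity)
    ((div_le_self (by positivity) hWL).trans (le_mul_of_one_le_right (by positivity) hW))
  rw [hratio, hratio', ← sum_sieve_mul_sq_eq] at hsum
  refine (sum_primes_sq_sum_divisors_le (f := windowChi (U ^ 50 * W⁻¹) (U ^ 50 * W)) hnonneg
    hprime fun d hd => ?_).trans (hsum.trans
      (second_moment_numerics hNU hU hW hWU hL hLU hl hω hC rfl))
  exact if_neg fun h => (hd.trans hUlo).not_gt h.1
end
end

section
/- Let ω > 0 be a constant, N a sufficiently large integer, and n an integer with 1 ≤ n ≤ N. Let \mathcal{P} be the set of primes p ≤ N such that p - 1 has a divisor d with \sqrt{N} L^{-ω} < d < \sqrt{N} L^{ω}. Then the number of ordered pairs of primes (p_1, p_2) with p_1 + p_2 = n and p_1 ∈ \mathcal{P} is \ll N L^{-2-2\theta_0} (\log L)^6, where L = log N, θ_0 = 1/2 - (1/4) e log 2, and the implied constant depends only on ω. -/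
open Finset
open scoped Classical

noncomputable section

/-- θ₀ = 1/2 - (1/4) e log 2. -/
def theta0 : ℝ := 1 / 2 - (1 / 4) * Real.exp 1 * Real.log 2

/-- p belongs to the set 𝒫 = 𝒫_ω(N): p - 1 has a divisor d with
√N (log N)^{-ω} < d < √N (log N)^{ω}. -/
def inP (N : ℕ) (ω : ℝ) (p : ℕ) : Prop :=
  ∃ d : ℕ, d ∣ p - 1 ∧ Real.sqrt N * Real.log N ^ (-ω) < (d : ℝ) ∧
    (d : ℝ) < Real.sqrt N * Real.log N ^ ω

open ArithmeticFunction in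
lemma sum_vonMangoldt_mul_div (n : ℕ) :
    ∑ k ∈ Ioc 0 n, vonMangoldt k * ((n / k : ℕ) : ℝ) = Real.log n.factorial := by
  rw [← sum_Ioc_mul_zeta_eq_sum, vonMangoldt_mul_zeta]
  induction n with
  | zero => simp
  | succ n ih =>
    rw [Finset.sum_Ioc_succ_top (Nat.zero_le n), ih, Nat.factorial_succ, Nat.cast_mul,
      Real.log_mul (by positivity) (by positivity), log_apply]
    ring

lemma sum_vonMangoldt_div_le {n : ℕ} (hn : 1 ≤ n) :
    ∑ k ∈ Ioc 0 n, ArithmeticFunction.vonMangoldt k / k ≤ Real.log n + 6 := by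
  have hn0 : (0 : ℝ) < n := by exact_mod_cast hn
  have hpsi : ∑ k ∈ Ioc 0 n, ArithmeticFunction.vonMangoldt k ≤ 6 * n := by
    have h := Chebyshev.psi_le_const_mul_self hn0.le
    rw [Chebyshev.psi, Nat.floor_natCast] at h
    have h4 : Real.log 4 ≤ 2 := by
      rw [show (4 : ℝ) = 2 ^ 2 by norm_num, Real.log_pow]
      have := Real.log_two_lt_d9
      norm_num
      linarith
    nlinarith
  have hfac : Real.log n.factorial ≤ n * Real.log n := by
    rw [← Real.log_pow]
    exact Real.log_le_log (by positivity) (by exact_mod_cast Nat.factorial_le_pow n)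
  have hkey : n * ∑ k ∈ Ioc 0 n, ArithmeticFunction.vonMangoldt k / k ≤
      Real.log n.factorial + ∑ k ∈ Ioc 0 n, ArithmeticFunction.vonMangoldt k := by
    rw [← sum_vonMangoldt_mul_div, ← sum_add_distrib, mul_sum]
    refine sum_le_sum fun k hk => ?_
    have hk0 : 0 < k := (mem_Ioc.1 hk).1
    have h1 : (n : ℝ) / k ≤ ((n / k : ℕ) : ℝ) + 1 := by
      rw [div_le_iff₀ (by exact_mod_cast hk0)]
      have := Nat.lt_div_mul_add (a := n) hk0
      have h2 : n ≤ (n / k + 1) * k := by nlinarith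
      exact_mod_cast h2
    have h0 : (0 : ℝ) ≤ ArithmeticFunction.vonMangoldt k := ArithmeticFunction.vonMangoldt_nonneg
    calc n * (ArithmeticFunction.vonMangoldt k / k)
        = ArithmeticFunction.vonMangoldt k * ((n : ℝ) / k) := by ring
      _ ≤ ArithmeticFunction.vonMangoldt k * (((n / k : ℕ) : ℝ) + 1) := by gcongr
      _ = _ := by ring
  nlinarith

lemma le_sum_vonMangoldt_div {n : ℕ} (hn : 1 ≤ n) :
    Real.log n - 1 ≤ ∑ k ∈ Ioc 0 n, ArithmeticFunction.vonMangoldt k / k := by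
  have hn0 : (0 : ℝ) < n := by exact_mod_cast hn
  have hfac : n * Real.log n - n ≤ Real.log n.factorial := by
    have h := Real.pow_div_factorial_le_exp (n : ℝ) hn0.le n
    have h2 := Real.log_le_log (by positivity) h
    rw [Real.log_div (by positivity) (by positivity), Real.log_pow, Real.log_exp] at h2
    linarith
  have hkey : Real.log n.factorial ≤
      n * ∑ k ∈ Ioc 0 n, ArithmeticFunction.vonMangoldt k / k := by
    rw [← sum_vonMangoldt_mul_div, mul_sum]
    refine sum_le_sum fun k hk => ?_
    have h0 : (0 : ℝ) ≤ ArithmeticFunction.vonMangoldt k := ArithmeticFunction.vonMangoldt_nonneg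
    calc ArithmeticFunction.vonMangoldt k * ((n / k : ℕ) : ℝ)
        ≤ ArithmeticFunction.vonMangoldt k * ((n : ℝ) / k) := by gcongr; exact Nat.cast_div_le
      _ = _ := by ring
  nlinarith

lemma sum_vonMangoldt_div_Ioc_le {A B : ℝ} (hA : 0 < A) (hAB : A ≤ B) :
    ∑ k ∈ Ioc ⌊A⌋₊ ⌊B⌋₊, ArithmeticFunction.vonMangoldt k / k ≤ Real.log (B / A) + 8 := by
  have hB : 0 < B := hA.trans_le hAB
  have hlog : 0 ≤ Real.log (B / A) := Real.log_nonneg ((one_le_div hA).2 hAB)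
  rcases lt_or_ge B 1 with hB1 | hB1
  · rw [Nat.floor_eq_zero.2 hB1, Nat.floor_eq_zero.2 (hAB.trans_lt hB1)]
    simp only [Ioc_self, sum_empty]
    linarith
  have hfB : 1 ≤ ⌊B⌋₊ := Nat.one_le_floor_iff B |>.2 hB1
  have hup := sum_vonMangoldt_div_le hfB
  have hBl : Real.log ⌊B⌋₊ ≤ Real.log B :=
    Real.log_le_log (by exact_mod_cast hfB) (Nat.floor_le hB.le)
  rw [Real.log_div hB.ne' hA.ne'] at *
  rcases lt_or_ge A 1 with hA1 | hA1
  · rw [Nat.floor_eq_zero.2 hA1]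
    have := Real.log_nonpos hA.le hA1.le
    linarith
  have hfA : 1 ≤ ⌊A⌋₊ := Nat.one_le_floor_iff A |>.2 hA1
  have hlo := le_sum_vonMangoldt_div hfA
  have hAl : Real.log A - 1 ≤ Real.log ⌊A⌋₊ := by
    have h1 : A ≤ 2 * ⌊A⌋₊ := by
      have := Nat.lt_floor_add_one A
      have h2 : (1 : ℝ) ≤ ⌊A⌋₊ := by exact_mod_cast hfA
      linarith
    have h2 := Real.log_le_log hA h1
    rw [Real.log_mul (by norm_num) (by positivity)] at h2
    have := Real.log_two_lt_d9
    linarith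
  have hsplit := sum_Ioc_consecutive (fun k : ℕ => ArithmeticFunction.vonMangoldt k / (k : ℝ))
    (Nat.zero_le ⌊A⌋₊) (Nat.floor_le_floor hAB)
  linarith

lemma sum_inv_primesBelow_le {n : ℕ} (hn : 2 ≤ n) :
    ∑ p ∈ Nat.primesBelow (n + 1), (1 : ℝ) / p ≤ Real.log (Real.log n) + 11 := by
  set S : ℕ → ℝ := fun m => ∑ p ∈ Nat.primesBelow (m + 1), Real.log p / p with hS
  have hSle : ∀ m : ℕ, 1 ≤ m → S m ≤ Real.log m + 6 := by
    intro m hm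
    refine le_trans ?_ (sum_vonMangoldt_div_le hm)
    calc S m = ∑ p ∈ Nat.primesBelow (m + 1), ArithmeticFunction.vonMangoldt p / p := by
          refine sum_congr rfl fun p hp => ?_
          rw [ArithmeticFunction.vonMangoldt_apply_prime (Nat.prime_of_mem_primesBelow hp)]
      _ ≤ _ := by
          refine sum_le_sum_of_subset_of_nonneg (fun p hp => ?_) fun p _ _ => ?_
          · have := Nat.lt_of_mem_primesBelow hp
            have := (Nat.prime_of_mem_primesBelow hp).pos
            simp only [mem_Ioc]
            omega
          · exact div_nonneg ArithmeticFunction.vonMangoldt_nonneg (Nat.cast_nonneg _)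
  have hlog : ∀ m : ℕ, 2 ≤ m → 0 < Real.log m := fun m hm =>
    Real.log_pos (by exact_mod_cast hm)
  have hl2 := Real.log_two_gt_d9
  have hmain : ∀ m : ℕ, 2 ≤ m →
      ∑ p ∈ Nat.primesBelow (m + 1), (1 : ℝ) / p - S m / Real.log m ≤
        Real.log (Real.log m) - Real.log (Real.log 2) + 6 / Real.log 2 - 6 / Real.log m := by
    intro m hm
    induction m, hm using Nat.le_induction with
    | base =>
      have h3 : Nat.primesBelow (2 + 1) = {2} := by decide
      simp only [hS, h3, sum_singleton]
      push_cast
      have : Real.log 2 ≠ 0 := by positivity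
      field_simp
      simp
    | succ m hm ih =>
      have hm0 := hlog m hm
      have hm1 := hlog (m + 1) (by omega)
      have hstep : ∑ p ∈ Nat.primesBelow (m + 1 + 1), (1 : ℝ) / p
          - S (m + 1) / Real.log ((m + 1 : ℕ) : ℝ) =
          ∑ p ∈ Nat.primesBelow (m + 1), (1 : ℝ) / p - S m / Real.log ((m + 1 : ℕ) : ℝ) := by
        by_cases hp : (m + 1).Prime
        · simp only [hS]
          rw [Nat.primesBelow_succ (m + 1), if_pos hp, sum_insert (by simp [Nat.primesBelow]),
            sum_insert (by simp [Nat.primesBelow])]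
          field_simp
          ring
        · simp only [hS]
          rw [Nat.primesBelow_succ (m + 1), if_neg hp]
      rw [hstep]
      have hmono : Real.log m ≤ Real.log ((m + 1 : ℕ) : ℝ) :=
        Real.log_le_log (by positivity) (by push_cast; linarith)
      have hdiff : 0 ≤ 1 / Real.log m - 1 / Real.log ((m + 1 : ℕ) : ℝ) := by
        rw [sub_nonneg]
        exact one_div_le_one_div_of_le hm0 hmono
      have h1 : S m * (1 / Real.log m - 1 / Real.log ((m + 1 : ℕ) : ℝ)) ≤
          (Real.log m + 6) * (1 / Real.log m - 1 / Real.log ((m + 1 : ℕ) : ℝ)) :=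
        mul_le_mul_of_nonneg_right (hSle m (by omega)) hdiff
      have h2 : Real.log m * (1 / Real.log m - 1 / Real.log ((m + 1 : ℕ) : ℝ)) ≤
          Real.log (Real.log ((m + 1 : ℕ) : ℝ)) - Real.log (Real.log m) := by
        rw [← Real.log_div hm1.ne' hm0.ne']
        have := Real.one_sub_inv_le_log_of_pos (div_pos hm1 hm0)
        refine le_trans (le_of_eq ?_) this
        field_simp
      have e1 : S m * (1 / Real.log m - 1 / Real.log ((m + 1 : ℕ) : ℝ)) =
        S m / Real.log m - S m / Real.log ((m + 1 : ℕ) : ℝ) := by ring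
      have e2 : 6 * (1 / Real.log m - 1 / Real.log ((m + 1 : ℕ) : ℝ)) =
        6 / Real.log m - 6 / Real.log ((m + 1 : ℕ) : ℝ) := by ring
      linarith
  have h := hmain n hn
  have hn0 := hlog n hn
  have h3 : S n / Real.log n ≤ 1 + 6 / Real.log n := by
    rw [div_le_iff₀ hn0, add_mul, div_mul_cancel₀ _ hn0.ne']
    linarith [hSle n (by omega)]
  have h4 : 6 / Real.log 2 ≤ 9 := by
    rw [div_le_iff₀ (by positivity)]
    linarith
  have h5 : -1 ≤ Real.log (Real.log 2) := by
    have := Real.one_sub_inv_le_log_of_pos (show 0 < Real.log 2 by positivity)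
    have h6 : (Real.log 2)⁻¹ ≤ 2 := by
      rw [inv_le_comm₀ (by positivity) (by norm_num)]
      linarith
    linarith
  linarith

/-- The completely multiplicative function `m ↦ w ^ Ω(m) / m`. -/
def omegaWeight (w : ℝ) : ℕ →* ℝ where
  toFun m := if m = 0 then 0 else w ^ ArithmeticFunction.cardFactors m / m
  map_one' := by simp
  map_mul' m n := by
    by_cases hm : m = 0
    · simp [hm]
    by_cases hn : n = 0
    · simp [hn]
    simp only [mul_eq_zero, hm, hn, or_self, if_false, ArithmeticFunction.cardFactors_mul hm hn,
      pow_add, Nat.cast_mul]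
    rw [mul_div_mul_comm]

lemma omegaWeight_apply {w : ℝ} {m : ℕ} (hm : m ≠ 0) :
    omegaWeight w m = w ^ ArithmeticFunction.cardFactors m / m := by
  simp [omegaWeight, hm]

lemma omegaWeight_nonneg {w : ℝ} (hw : 0 ≤ w) (m : ℕ) : 0 ≤ omegaWeight w m := by
  by_cases hm : m = 0
  · simp [omegaWeight, hm]
  · rw [omegaWeight_apply hm]; positivity

lemma omegaWeight_prime {w : ℝ} {p : ℕ} (hp : p.Prime) : omegaWeight w p = w / p := by
  rw [omegaWeight_apply hp.ne_zero, ArithmeticFunction.cardFactors_apply_prime hp, pow_one]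

lemma omegaWeight_le_inv {w : ℝ} (hw : 0 ≤ w) (hw1 : w ≤ 1) (m : ℕ) :
    omegaWeight w m ≤ 1 / m := by
  by_cases hm : m = 0
  · simp [omegaWeight, hm]
  · rw [omegaWeight_apply hm]
    gcongr
    exact pow_le_one₀ hw hw1

lemma inv_one_sub_le_exp {t : ℝ} (ht : t ≤ 3 / 4) :
    (1 - t)⁻¹ ≤ Real.exp (t + 4 * t ^ 2) := by
  have h1 : 0 < 1 - t := by linarith
  rw [← Real.log_le_iff_le_exp (by positivity), Real.log_inv]
  have h2 := Real.one_sub_inv_le_log_of_pos h1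
  have h3 : (1 - t)⁻¹ ≤ 1 + t + 4 * t ^ 2 := by
    rw [inv_le_iff_one_le_mul₀ h1]
    nlinarith [mul_nonneg (sq_nonneg t) (show 0 ≤ 3 - 4 * t by linarith)]
  linarith

lemma sum_inv_sq_primesBelow_le (n : ℕ) :
    ∑ p ∈ Nat.primesBelow n, (1 : ℝ) / p ^ 2 ≤ 1 := by
  have h : ∀ n : ℕ, 1 ≤ n → ∑ p ∈ Nat.primesBelow (n + 1), (1 : ℝ) / p ^ 2 ≤ 1 - 1 / n := by
    intro n hn
    induction n, hn using Nat.le_induction with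
    | base => simp [Nat.primesBelow, Finset.sum_filter, Finset.sum_range_succ, Nat.not_prime_one]
    | succ m hm ih =>
      have hm0 : (0 : ℝ) < m := by exact_mod_cast hm
      have key : (1 : ℝ) / ((m + 1 : ℕ) : ℝ) ^ 2 ≤ 1 / m - 1 / ((m + 1 : ℕ) : ℝ) := by
        push_cast
        rw [div_sub_div _ _ (by positivity) (by positivity),
          div_le_div_iff₀ (by positivity) (by positivity)]
        nlinarith
      have : (0 : ℝ) ≤ 1 / ((m + 1 : ℕ) : ℝ) ^ 2 := by positivity
      rw [Nat.primesBelow_succ]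
      split_ifs with hp
      · rw [sum_insert (by simp [Nat.primesBelow])]
        linarith
      · linarith
  rcases Nat.lt_or_ge n 2 with hn | hn
  · have : Nat.primesBelow n = ∅ := by
      ext p
      simp only [Nat.mem_primesBelow, Finset.notMem_empty, iff_false, not_and]
      intro h hp
      have := hp.two_le
      omega
    simp [this]
  · obtain ⟨m, rfl⟩ : ∃ m, n = m + 1 := ⟨n - 1, by omega⟩
    have := h m (by omega)
    have h0 : (0 : ℝ) ≤ 1 / m := by positivity
    linarith

lemma sum_omegaWeight_le_exp {w : ℝ} (hw : 0 ≤ w) (hw1 : w ≤ 3 / 2) (n : ℕ) :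
    ∑ m ∈ Ioc 0 n, omegaWeight w m ≤
      Real.exp (w * ∑ p ∈ Nat.primesBelow (n + 1), (1 : ℝ) / p + 9) := by
  have hlt : ∀ {p : ℕ}, p.Prime → omegaWeight w p ≤ 3 / 4 := by
    intro p hp
    rw [omegaWeight_prime hp, div_le_iff₀ (by exact_mod_cast hp.pos)]
    have : (2 : ℝ) ≤ p := by exact_mod_cast hp.two_le
    linarith
  obtain ⟨hs, hsum⟩ := EulerProduct.summable_and_hasSum_smoothNumbers_prod_primesBelow_geometric
    (f := omegaWeight w) (fun {p} hp => by
      rw [Real.norm_of_nonneg (omegaWeight_nonneg hw p)]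
      linarith [hlt hp]) (n + 1)
  have h1 : ∑ m ∈ Ioc 0 n, omegaWeight w m ≤
      ∏ p ∈ Nat.primesBelow (n + 1), (1 - omegaWeight w p)⁻¹ := by
    have hmem : ∀ m ∈ Ioc 0 n, m ∈ Nat.smoothNumbers (n + 1) := fun m hm => by
      have := mem_Ioc.1 hm
      exact Nat.mem_smoothNumbers_of_lt this.1 (by omega)
    rw [← Finset.sum_attach]
    have := sum_le_hasSum (f := fun m : Nat.smoothNumbers (n + 1) => omegaWeight w m)
      ((Ioc 0 n).attach.map ⟨fun m => ⟨m.1, hmem m.1 m.2⟩, fun a b hab =>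
        Subtype.ext (congrArg (fun x => x.1) hab)⟩) (fun m _ => omegaWeight_nonneg hw _) hsum
    rw [Finset.sum_map] at this
    exact this
  refine h1.trans ?_
  calc ∏ p ∈ Nat.primesBelow (n + 1), (1 - omegaWeight w p)⁻¹
      ≤ ∏ p ∈ Nat.primesBelow (n + 1), Real.exp (w * (1 / p) + 9 * (1 / (p : ℝ) ^ 2)) := by
        refine prod_le_prod (fun p hp => ?_) fun p hp => ?_
        · have := hlt (Nat.prime_of_mem_primesBelow hp)
          exact inv_nonneg.2 (by linarith)
        · refine (inv_one_sub_le_exp (hlt (Nat.prime_of_mem_primesBelow hp))).trans ?_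
          rw [omegaWeight_prime (Nat.prime_of_mem_primesBelow hp)]
          refine Real.exp_le_exp.2 ?_
          have h2 : 4 * (w / p) ^ 2 ≤ 9 * (1 / (p : ℝ) ^ 2) := by
            have h4 : 4 * w ^ 2 ≤ 9 := by nlinarith
            calc 4 * (w / p) ^ 2 = 4 * w ^ 2 * (1 / (p : ℝ) ^ 2) := by ring
              _ ≤ _ := by gcongr
          have h3 : w * (1 / (p : ℝ)) = w / p := by ring
          linarith
    _ = Real.exp (w * ∑ p ∈ Nat.primesBelow (n + 1), (1 : ℝ) / p
          + 9 * ∑ p ∈ Nat.primesBelow (n + 1), (1 : ℝ) / p ^ 2) := by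
        rw [← Real.exp_sum, sum_add_distrib, mul_sum, mul_sum]
    _ ≤ _ := by
        refine Real.exp_le_exp.2 ?_
        have := sum_inv_sq_primesBelow_le (n + 1)
        linarith

lemma sum_omegaWeight_le {w : ℝ} (hw : 0 ≤ w) (hw1 : w ≤ 3 / 2) {n : ℕ} (hn : 2 ≤ n) :
    ∑ m ∈ Ioc 0 n, omegaWeight w m ≤ Real.exp 26 * Real.log n ^ w := by
  refine (sum_omegaWeight_le_exp hw hw1 n).trans ?_
  have hl : 0 < Real.log n := Real.log_pos (by exact_mod_cast hn)
  rw [Real.rpow_def_of_pos hl, ← Real.exp_add]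
  refine Real.exp_le_exp.2 ?_
  have h1 := mul_le_mul_of_nonneg_left (sum_inv_primesBelow_le hn) hw
  nlinarith

lemma le_sum_inv_primesBelow {n : ℕ} (hn : 2 ≤ n) :
    Real.log (Real.log n) - 9 ≤ ∑ p ∈ Nat.primesBelow (n + 1), (1 : ℝ) / p := by
  have hl : 0 < Real.log n := Real.log_pos (by exact_mod_cast hn)
  have h := sum_omegaWeight_le_exp zero_le_one (by norm_num : (1 : ℝ) ≤ 3 / 2) n
  have h1 : Real.log n ≤ ∑ m ∈ Ioc 0 n, omegaWeight 1 m := by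
    have h2 := log_add_one_le_harmonic n
    rw [harmonic_eq_sum_Icc] at h2
    push_cast at h2
    have h3 : Real.log n ≤ Real.log ((n : ℝ) + 1) :=
      Real.log_le_log (by positivity) (by linarith)
    refine h3.trans (h2.trans (le_of_eq ?_))
    refine sum_congr (by ext; simp; omega) fun m hm => ?_
    rw [omegaWeight_apply (by have := mem_Icc.1 hm; omega)]
    simp
  have h4 := Real.log_le_log hl (h1.trans h)
  rw [Real.log_exp] at h4
  linarith

lemma sum_omegaWeight_Ioc_mul_log_le {w : ℝ} (hw : 0 ≤ w) (hw1 : w ≤ 1) {A B : ℝ} (hA : 1 ≤ A)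
    (hAB : A ≤ B) :
    (∑ d ∈ Ioc ⌊A⌋₊ ⌊B⌋₊, omegaWeight w d) * Real.log A ≤
      (Real.log (B / A) + 8) * ∑ m ∈ Ioc 0 ⌊B⌋₊, omegaWeight w m := by
  have hA0 : 0 < A := by linarith
  have hB0 : 0 < B := by linarith
  calc (∑ d ∈ Ioc ⌊A⌋₊ ⌊B⌋₊, omegaWeight w d) * Real.log A
      ≤ ∑ d ∈ Ioc ⌊A⌋₊ ⌊B⌋₊, ∑ x ∈ d.divisorsAntidiagonal,
          ArithmeticFunction.vonMangoldt x.1 / x.1 * omegaWeight w x.2 := by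
        rw [sum_mul]
        refine sum_le_sum fun d hd => ?_
        have hAd : A < d := (Nat.floor_lt hA0.le).1 (mem_Ioc.1 hd).1
        calc omegaWeight w d * Real.log A ≤ omegaWeight w d * Real.log d := by
              gcongr
              exact omegaWeight_nonneg hw d
          _ = ∑ x ∈ d.divisorsAntidiagonal,
                omegaWeight w d * ArithmeticFunction.vonMangoldt x.1 := by
              rw [← ArithmeticFunction.vonMangoldt_sum, mul_sum,
                Nat.sum_divisorsAntidiagonal
                  (fun i _ => omegaWeight w d * ArithmeticFunction.vonMangoldt i)]
          _ ≤ _ := by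
              refine sum_le_sum fun x hx => ?_
              rw [← (Nat.mem_divisorsAntidiagonal.1 hx).1, map_mul]
              have h1 := omegaWeight_le_inv hw hw1 x.1
              have h2 := omegaWeight_nonneg hw x.2
              have h3 : 0 ≤ ArithmeticFunction.vonMangoldt x.1 :=
                ArithmeticFunction.vonMangoldt_nonneg
              calc _ = omegaWeight w x.1 *
                    (omegaWeight w x.2 * ArithmeticFunction.vonMangoldt x.1) := by ring
                _ ≤ 1 / x.1 * (omegaWeight w x.2 * ArithmeticFunction.vonMangoldt x.1) := by
                    gcongr
                _ = _ := by ring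
    _ = ∑ m ∈ Ioc 0 ⌊B⌋₊, ∑ k ∈ Ioc ⌊A / m⌋₊ ⌊B / m⌋₊,
          ArithmeticFunction.vonMangoldt k / k * omegaWeight w m := by
        rw [sum_sigma', sum_sigma']
        refine sum_nbij' (fun x => ⟨x.2.2, x.2.1⟩) (fun y => ⟨y.2 * y.1, (y.2, y.1)⟩) ?_ ?_ ?_ ?_ ?_
        · rintro ⟨d, k, m⟩ hx
          simp only [mem_sigma, mem_Ioc, Nat.mem_divisorsAntidiagonal] at hx ⊢
          obtain ⟨⟨h1, h2⟩, rfl, h3⟩ := hx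
          rw [Nat.floor_lt hA0.le] at h1
          rw [Nat.le_floor_iff hB0.le] at h2
          push_cast at h1 h2
          have hm : 0 < m := Nat.pos_of_ne_zero (right_ne_zero_of_mul h3)
          have hk : 0 < k := Nat.pos_of_ne_zero (left_ne_zero_of_mul h3)
          have hm' : (0 : ℝ) < m := by exact_mod_cast hm
          have hk' : (1 : ℝ) ≤ k := by exact_mod_cast hk
          refine ⟨⟨hm, Nat.le_floor ?_⟩, ?_, Nat.le_floor ?_⟩
          · nlinarith
          · rw [Nat.floor_lt (by positivity), div_lt_iff₀ hm']
            exact h1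
          · rw [le_div_iff₀ hm']
            exact h2
        · rintro ⟨m, k⟩ hx
          simp only [mem_sigma, mem_Ioc, Nat.mem_divisorsAntidiagonal] at hx ⊢
          obtain ⟨⟨hm, h1⟩, h2, h3⟩ := hx
          have hm' : (0 : ℝ) < m := by exact_mod_cast hm
          have hk : 0 < k := by omega
          rw [Nat.floor_lt (by positivity), div_lt_iff₀ hm'] at h2
          rw [Nat.le_floor_iff (by positivity), le_div_iff₀ hm'] at h3
          refine ⟨⟨?_, Nat.le_floor ?_⟩, trivial, (Nat.mul_pos hk hm).ne'⟩
          · rw [Nat.floor_lt hA0.le]; push_cast; exact h2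
          · push_cast; exact h3
        · rintro ⟨d, k, m⟩ hx
          simp only [mem_sigma, mem_Ioc, Nat.mem_divisorsAntidiagonal] at hx ⊢
          obtain ⟨-, rfl, -⟩ := hx
          rfl
        · rintro ⟨m, k⟩ -
          rfl
        · rintro ⟨d, k, m⟩ -
          rfl
    _ ≤ ∑ m ∈ Ioc 0 ⌊B⌋₊, (Real.log (B / A) + 8) * omegaWeight w m := by
        refine sum_le_sum fun m hm => ?_
        have hm' : (0 : ℝ) < m := by exact_mod_cast (mem_Ioc.1 hm).1
        rw [← sum_mul]
        refine mul_le_mul_of_nonneg_right ?_ (omegaWeight_nonneg hw m)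
        have := sum_vonMangoldt_div_Ioc_le (A := A / m) (B := B / m) (by positivity) (by gcongr)
        rwa [div_div_div_cancel_right₀ hm'.ne'] at this
    _ = _ := by rw [mul_sum]

lemma card_le_cardFactors_le {N : ℕ} (hN : 2 ≤ N) (K : ℕ) :
    (((Ioc 0 N).filter fun m => K ≤ ArithmeticFunction.cardFactors m).card : ℝ) ≤
      N * (Real.exp 26 * Real.log N ^ (3 / 2 : ℝ)) * (2 / 3) ^ K := by
  have h := sum_omegaWeight_le (w := 3 / 2) (by norm_num) le_rfl hN
  have hterm : ∀ m ∈ (Ioc 0 N).filter fun m => K ≤ ArithmeticFunction.cardFactors m,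
      (1 : ℝ) ≤ N * (2 / 3) ^ K * omegaWeight (3 / 2) m := by
    intro m hm
    simp only [mem_filter, mem_Ioc] at hm
    obtain ⟨⟨hm0, hmN⟩, hK⟩ := hm
    rw [omegaWeight_apply hm0.ne']
    have h1 : (1 : ℝ) ≤ N / m := by
      rw [le_div_iff₀ (by exact_mod_cast hm0)]
      simpa using (by exact_mod_cast hmN : (m : ℝ) ≤ N)
    have h2 : (3 / 2 : ℝ) ^ K ≤ (3 / 2) ^ ArithmeticFunction.cardFactors m :=
      pow_le_pow_right₀ (by norm_num) hK
    calc (1 : ℝ) = 1 * ((2 / 3) ^ K * (3 / 2) ^ K) := by rw [← mul_pow]; norm_num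
      _ ≤ N / m * ((2 / 3) ^ K * (3 / 2) ^ ArithmeticFunction.cardFactors m) := by gcongr
      _ = _ := by ring
  calc _ = ∑ m ∈ (Ioc 0 N).filter fun m => K ≤ ArithmeticFunction.cardFactors m, (1 : ℝ) := by simp
    _ ≤ ∑ m ∈ (Ioc 0 N).filter fun m => K ≤ ArithmeticFunction.cardFactors m,
          N * (2 / 3) ^ K * omegaWeight (3 / 2) m := sum_le_sum hterm
    _ ≤ ∑ m ∈ Ioc 0 N, N * (2 / 3) ^ K * omegaWeight (3 / 2) m :=
        sum_le_sum_of_subset_of_nonneg (filter_subset _ _) fun m _ _ =>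
          mul_nonneg (by positivity) (omegaWeight_nonneg (by norm_num) m)
    _ = N * (2 / 3) ^ K * ∑ m ∈ Ioc 0 N, omegaWeight (3 / 2) m := by rw [mul_sum]
    _ ≤ N * (2 / 3) ^ K * (Real.exp 26 * Real.log N ^ (3 / 2 : ℝ)) := by gcongr
    _ = _ := by ring

lemma sum_omegaWeight_dvd_le {w : ℝ} (hw : 0 ≤ w) (N : ℕ) (D : Finset ℕ) :
    ∑ a ∈ (Ioc 0 N).filter (fun a => ∃ d ∈ D, d ∣ a), omegaWeight w a ≤
      (∑ d ∈ D, omegaWeight w d) * ∑ m ∈ Ioc 0 N, omegaWeight w m := by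
  have hex : ∀ a : ℕ, ∃ d : ℕ, (a ∈ (Ioc 0 N).filter (fun a => ∃ d ∈ D, d ∣ a)) → d ∈ D ∧ d ∣ a := by
    intro a
    by_cases ha : a ∈ (Ioc 0 N).filter (fun a => ∃ d ∈ D, d ∣ a)
    · obtain ⟨d, hd, hda⟩ := (mem_filter.1 ha).2
      exact ⟨d, fun _ => ⟨hd, hda⟩⟩
    · exact ⟨0, fun h => absurd h ha⟩
  choose δ hδ using hex
  rw [sum_mul_sum, ← sum_product']
  calc _ = ∑ a ∈ (Ioc 0 N).filter (fun a => ∃ d ∈ D, d ∣ a),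
          omegaWeight w (δ a) * omegaWeight w (a / δ a) := by
        refine sum_congr rfl fun a ha => ?_
        rw [← map_mul, Nat.mul_div_cancel' (hδ a ha).2]
    _ = ∑ x ∈ ((Ioc 0 N).filter (fun a => ∃ d ∈ D, d ∣ a)).image (fun a => (δ a, a / δ a)),
          omegaWeight w x.1 * omegaWeight w x.2 := by
        rw [sum_image]
        intro a ha b hb hab
        simp only [Prod.mk.injEq] at hab
        rw [← Nat.mul_div_cancel' (hδ a ha).2, ← Nat.mul_div_cancel' (hδ b hb).2, hab.2, hab.1]
    _ ≤ _ := by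
        refine sum_le_sum_of_subset_of_nonneg ?_ fun x _ _ =>
          mul_nonneg (omegaWeight_nonneg hw _) (omegaWeight_nonneg hw _)
        intro x hx
        obtain ⟨a, ha, rfl⟩ := mem_image.1 hx
        have h1 := hδ a ha
        have h2 := mem_Ioc.1 (mem_filter.1 ha).1
        simp only [mem_product, mem_Ioc]
        refine ⟨h1.1, Nat.div_pos (Nat.le_of_dvd h2.1 h1.2) (Nat.pos_of_dvd_of_pos h1.2 h2.1),
          (Nat.div_le_self _ _).trans h2.2⟩

lemma sum_inv_of_dvd_Ioc_le {N : ℕ} (hN : 3 ≤ N) {A B : ℝ} (hA : 1 ≤ A)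
    (hNA : Real.log N ≤ 4 * Real.log A) (hAB : A ≤ B) (hBN : B ≤ N) :
    ∑ a ∈ (Ioc 0 N).filter (fun a => ∃ d ∈ Ioc ⌊A⌋₊ ⌊B⌋₊, d ∣ a), (1 : ℝ) / a ≤
      Real.exp 60 * Real.log N ^ (√2 - 1 / 2) * (Real.log (B / A) + 8) := by
  set F := (Ioc 0 N).filter (fun a => ∃ d ∈ Ioc ⌊A⌋₊ ⌊B⌋₊, d ∣ a) with hF
  set L := Real.log N with hL
  have hL1 : 1 ≤ L := by
    rw [hL, Real.le_log_iff_exp_le (by positivity)]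
    have := Real.exp_one_lt_d9
    have : (3 : ℝ) ≤ N := by exact_mod_cast hN
    linarith
  have hL0 : 0 < L := by linarith
  have hs2 : √2 * √2 = 2 := Real.mul_self_sqrt (by norm_num)
  have hs0 : 0 < √2 := by positivity
  have hs1 : √2 ≤ 3 / 2 := by nlinarith
  have hs1' : 1 ≤ √2 := by nlinarith
  have hlogBA : 0 ≤ Real.log (B / A) := Real.log_nonneg ((one_le_div (by linarith)).2 hAB)
  have hzs : √2 / 2 = (√2)⁻¹ := by field_simp; linarith
  have hpt : ∀ a ∈ F, (1 : ℝ) / a ≤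
      L ^ (-(1 / 2) : ℝ) * omegaWeight √2 a + L ^ (1 / 2 : ℝ) * omegaWeight (√2 / 2) a := by
    intro a ha
    have ha0 : 0 < a := (mem_Ioc.1 (mem_filter.1 ha).1).1
    have ha0' : (0 : ℝ) < a := by exact_mod_cast ha0
    rw [omegaWeight_apply ha0.ne', omegaWeight_apply ha0.ne', hzs, inv_pow, Real.rpow_neg hL0.le]
    set u := L ^ (1 / 2 : ℝ) with hu
    have hu0 : 0 < u := by positivity
    set x := √2 ^ ArithmeticFunction.cardFactors a
    have hx0 : 0 < x := by positivity
    have h1 : 1 ≤ u⁻¹ * x + u * x⁻¹ := by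
      have : u⁻¹ * x + u * x⁻¹ = (x ^ 2 + u ^ 2) / (u * x) := by field_simp
      rw [this, one_le_div (by positivity)]
      nlinarith [sq_nonneg (x - u)]
    calc (1 : ℝ) / a ≤ (u⁻¹ * x + u * x⁻¹) / a := by gcongr
      _ = _ := by ring
  have hZs := sum_omegaWeight_le hs0.le hs1 (n := N) (by omega)
  have hZz := sum_omegaWeight_le (w := √2 / 2) (by positivity) (by linarith) (n := N) (by omega)
  have hfl : ⌊B⌋₊ ≤ N := Nat.floor_le_of_le hBN
  have hD : (∑ d ∈ Ioc ⌊A⌋₊ ⌊B⌋₊, omegaWeight (√2 / 2) d) * L ≤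
      4 * ((Real.log (B / A) + 8) * (Real.exp 26 * L ^ (√2 / 2))) := by
    have h1 := sum_omegaWeight_Ioc_mul_log_le (w := √2 / 2) (by positivity) (by linarith) hA hAB
    have h2 : ∑ m ∈ Ioc 0 ⌊B⌋₊, omegaWeight (√2 / 2) m ≤ Real.exp 26 * L ^ (√2 / 2) := by
      refine le_trans (sum_le_sum_of_subset_of_nonneg (Ioc_subset_Ioc_right hfl)
        fun m _ _ => omegaWeight_nonneg (by positivity) m) hZz
    have h3 : 0 ≤ ∑ d ∈ Ioc ⌊A⌋₊ ⌊B⌋₊, omegaWeight (√2 / 2) d :=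
      sum_nonneg fun m _ => omegaWeight_nonneg (by positivity) m
    calc _ ≤ (∑ d ∈ Ioc ⌊A⌋₊ ⌊B⌋₊, omegaWeight (√2 / 2) d) * (4 * Real.log A) := by gcongr
      _ ≤ 4 * ((Real.log (B / A) + 8) * ∑ m ∈ Ioc 0 ⌊B⌋₊, omegaWeight (√2 / 2) m) := by linarith
      _ ≤ _ := by gcongr
  have hD' : ∑ d ∈ Ioc ⌊A⌋₊ ⌊B⌋₊, omegaWeight (√2 / 2) d ≤
      4 * ((Real.log (B / A) + 8) * (Real.exp 26 * L ^ (√2 / 2 - 1))) := by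
    rw [← le_div_iff₀ hL0] at hD
    refine hD.trans (le_of_eq ?_)
    rw [Real.rpow_sub_one hL0.ne']
    ring
  have hsum2 : ∑ a ∈ F, omegaWeight (√2 / 2) a ≤
      4 * ((Real.log (B / A) + 8) * (Real.exp 26 * L ^ (√2 / 2 - 1))) *
        (Real.exp 26 * L ^ (√2 / 2)) := by
    refine (sum_omegaWeight_dvd_le (by positivity) N _).trans ?_
    gcongr
    exact sum_nonneg fun m _ => omegaWeight_nonneg (by positivity) m
  have hsum1 : ∑ a ∈ F, omegaWeight √2 a ≤ Real.exp 26 * L ^ √2 :=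
    (sum_le_sum_of_subset_of_nonneg (filter_subset _ _)
        fun m _ _ => omegaWeight_nonneg hs0.le m).trans hZs
  calc _ ≤ ∑ a ∈ F, (L ^ (-(1 / 2) : ℝ) * omegaWeight √2 a
          + L ^ (1 / 2 : ℝ) * omegaWeight (√2 / 2) a) := sum_le_sum hpt
    _ = L ^ (-(1 / 2) : ℝ) * ∑ a ∈ F, omegaWeight √2 a
          + L ^ (1 / 2 : ℝ) * ∑ a ∈ F, omegaWeight (√2 / 2) a := by
        rw [sum_add_distrib, mul_sum, mul_sum]
    _ ≤ L ^ (-(1 / 2) : ℝ) * (Real.exp 26 * L ^ √2) + L ^ (1 / 2 : ℝ) *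
          (4 * ((Real.log (B / A) + 8) * (Real.exp 26 * L ^ (√2 / 2 - 1))) *
            (Real.exp 26 * L ^ (√2 / 2))) := by gcongr
    _ = Real.exp 26 * L ^ (√2 - 1 / 2) +
          4 * (Real.exp 26 * Real.exp 26) * L ^ (√2 - 1 / 2) * (Real.log (B / A) + 8) := by
        have e1 : L ^ (√2 - 1 / 2) = L ^ (-(1 / 2) : ℝ) * L ^ √2 := by
          rw [← Real.rpow_add hL0]; ring_nf
        have e2 : L ^ (√2 - 1 / 2) = L ^ (1 / 2 : ℝ) * L ^ (√2 / 2 - 1) * L ^ (√2 / 2) := by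
          rw [← Real.rpow_add hL0, ← Real.rpow_add hL0]; ring_nf
        nth_rewrite 2 [e2]
        rw [e1]
        ring
    _ ≤ Real.exp 26 * Real.exp 26 * L ^ (√2 - 1 / 2) * (Real.log (B / A) + 8) +
          4 * (Real.exp 26 * Real.exp 26) * L ^ (√2 - 1 / 2) * (Real.log (B / A) + 8) := by
        gcongr ?_ + _
        have h1 : (1 : ℝ) ≤ Real.exp 26 := Real.one_le_exp (by norm_num)
        have h2 : 0 ≤ L ^ (√2 - 1 / 2) := by positivity
        calc Real.exp 26 * L ^ (√2 - 1 / 2) = Real.exp 26 * 1 * L ^ (√2 - 1 / 2) * 1 := by ring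
          _ ≤ _ := by gcongr; linarith
    _ = 5 * Real.exp 52 * L ^ (√2 - 1 / 2) * (Real.log (B / A) + 8) := by
        rw [← Real.exp_add]; norm_num; ring
    _ ≤ _ := by
        gcongr
        have h8 : (5 : ℝ) ≤ Real.exp 8 := by
          have := Real.add_one_le_exp (8 : ℝ)
          linarith
        calc 5 * Real.exp 52 ≤ Real.exp 8 * Real.exp 52 := by gcongr
          _ = Real.exp 60 := by rw [← Real.exp_add]; norm_num

lemma one_le_sum_powerset_card_le (B : Finset ℕ) {R : ℕ} (hR : Even R) :
    (if B = ∅ then 1 else 0 : ℤ) ≤ ∑ D ∈ B.powerset with D.card ≤ R, (-1) ^ D.card := by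
  rw [sum_filter, sum_powerset_apply_card (fun m => if m ≤ R then (-1 : ℤ) ^ m else 0)]
  have h : ∑ m ∈ range (B.card + 1), B.card.choose m • (if m ≤ R then (-1 : ℤ) ^ m else 0) =
      ∑ k ∈ range (R + 1), (-1) ^ k * (B.card.choose k : ℤ) := by
    rw [← sum_subset (s₁ := range (min B.card R + 1)) (by gcongr; simp),
      ← sum_subset (s₁ := range (min B.card R + 1)) (s₂ := range (R + 1)) (by gcongr; simp)]
    · refine sum_congr rfl fun k hk => ?_
      have : k ≤ R := by have := mem_range.1 hk; omega
      simp [this, mul_comm]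
    · intro k hk hk'
      simp only [mem_range] at hk hk'
      rw [Nat.choose_eq_zero_of_lt (by omega)]
      simp
    · intro k hk hk'
      simp only [mem_range] at hk hk'
      rw [if_neg (by omega), smul_zero]
  rw [h]
  split_ifs with hB
  · subst hB
    rw [sum_range_succ']
    simp
  · obtain ⟨m, hm⟩ : ∃ m, B.card = m + 1 :=
      ⟨B.card - 1, by have := card_pos.2 (nonempty_iff_ne_empty.2 hB); omega⟩
    rw [hm, Int.alternating_sum_range_choose_eq_choose, hR.neg_one_pow]
    positivity

lemma card_sifted_le (Q P : Finset ℕ) (hit : ℕ → ℕ → Prop) {R : ℕ} (hR : Even R) :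
    ((Q.filter fun q => ∀ p ∈ P, ¬ hit q p).card : ℤ) ≤
      ∑ D ∈ P.powerset with D.card ≤ R,
        (-1) ^ D.card * ((Q.filter fun q => ∀ p ∈ D, hit q p).card : ℤ) := by
  calc ((Q.filter fun q => ∀ p ∈ P, ¬ hit q p).card : ℤ)
      = ∑ q ∈ Q, (if P.filter (hit q) = ∅ then 1 else 0 : ℤ) := by
        rw [card_filter]
        push_cast
        refine sum_congr rfl fun q _ => ?_
        simp only [filter_eq_empty_iff]
    _ ≤ ∑ q ∈ Q, ∑ D ∈ (P.filter (hit q)).powerset with D.card ≤ R, (-1) ^ D.card :=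
        sum_le_sum fun q _ => one_le_sum_powerset_card_le _ hR
    _ = ∑ q ∈ Q, ∑ D ∈ P.powerset with D.card ≤ R,
          if (∀ p ∈ D, hit q p) then (-1) ^ D.card else 0 := by
        refine sum_congr rfl fun q _ => ?_
        rw [← sum_filter]
        refine sum_congr ?_ fun _ _ => rfl
        ext D
        simp only [mem_filter, mem_powerset, subset_iff]
        constructor
        · rintro ⟨h1, h2⟩
          exact ⟨⟨fun p hp => (h1 hp).1, h2⟩, fun p hp => (h1 hp).2⟩
        · rintro ⟨⟨h1, h2⟩, h3⟩
          exact ⟨fun p hp => ⟨h1 hp, h3 p hp⟩, h2⟩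
    _ = _ := by
        rw [sum_comm]
        refine sum_congr rfl fun D _ => ?_
        rw [← sum_filter, sum_const, nsmul_eq_mul, mul_comm]

lemma abs_card_modEq_sub_le {m : ℕ} (hm : 0 < m) (c M : ℕ) :
    |(((Ioc 0 M).filter fun q => q ≡ c [MOD m]).card : ℝ) - M / m| ≤ 1 := by
  have h := Nat.Ioc_filter_modEq_card 0 M hm c
  have hm' : (0 : ℚ) < m := by exact_mod_cast hm
  rw [max_eq_left (sub_nonneg.2 (Int.floor_le_floor (by gcongr; simp)))] at h
  have h1 := Int.floor_le ((M - c : ℚ) / m)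
  have h2 := Int.lt_floor_add_one ((M - c : ℚ) / m)
  have h3 := Int.floor_le (((0 : ℕ) - c : ℚ) / m)
  have h4 := Int.lt_floor_add_one (((0 : ℕ) - c : ℚ) / m)
  have h5 : (((Ioc 0 M).filter fun q => q ≡ c [MOD m]).card : ℚ) =
      ⌊(M - c : ℚ) / m⌋ - ⌊((0 : ℕ) - c : ℚ) / m⌋ := by exact_mod_cast h
  have h6 : (M - c : ℚ) / m - ((0 : ℕ) - c : ℚ) / m = M / m := by
    push_cast; ring
  have h7 : |(((Ioc 0 M).filter fun q => q ≡ c [MOD m]).card : ℚ) - M / m| ≤ 1 := by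
    rw [h5, abs_le]
    constructor <;> linarith
  have h8 := (Rat.cast_le (K := ℝ)).2 h7
  push_cast at h8
  exact h8

lemma abs_card_residues_sub_le {κ : ℕ} (r : ℕ → Finset ℕ) (D : Finset ℕ)
    (hD : ∀ p ∈ D, p.Prime) (hr : ∀ p ∈ D, r p ⊆ range p) (hκ : ∀ p ∈ D, (r p).card = κ)
    {m : ℕ} (hm : 0 < m) (hmD : ∀ p ∈ D, m.Coprime p) (c M : ℕ) :
    |(((Ioc 0 M).filter fun q => q ≡ c [MOD m] ∧ ∀ p ∈ D, q % p ∈ r p).card : ℝ) -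
      M / m * ∏ p ∈ D, (κ : ℝ) / p| ≤ (κ : ℝ) ^ D.card := by
  induction D using Finset.induction_on generalizing m c with
  | empty => simpa using abs_card_modEq_sub_le hm c M
  | insert p D hpD ih =>
    have hp : p.Prime := hD p (mem_insert_self _ _)
    have hmp : m.Coprime p := hmD p (mem_insert_self _ _)
    have hsplit : (Ioc 0 M).filter
        (fun q => q ≡ c [MOD m] ∧ ∀ p' ∈ insert p D, q % p' ∈ r p') =
        (r p).biUnion fun s => (Ioc 0 M).filter fun q =>
          q ≡ Nat.chineseRemainder hmp c s [MOD m * p] ∧ ∀ p' ∈ D, q % p' ∈ r p' := by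
      ext q
      simp only [mem_filter, mem_biUnion, forall_mem_insert]
      constructor
      · rintro ⟨h1, h2, h3, h4⟩
        refine ⟨q % p, h3, h1, ?_, h4⟩
        exact Nat.chineseRemainder_modEq_unique hmp h2 (Nat.mod_modEq q p).symm
      · rintro ⟨s, hs, h1, h2, h3⟩
        have hc := (Nat.chineseRemainder hmp c s).2
        refine ⟨h1, (h2.of_mul_right p).trans hc.1, ?_, h3⟩
        have h4 : q ≡ s [MOD p] := (h2.of_mul_left m).trans hc.2
        have hsp : s < p := mem_range.1 (hr p (mem_insert_self _ _) hs)
        have h5 : q % p = s := Nat.mod_eq_of_modEq h4 hsp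
        rwa [h5]
    have hdisj : ∀ s ∈ r p, ∀ s' ∈ r p, s ≠ s' → Disjoint
        ((Ioc 0 M).filter fun q => q ≡ Nat.chineseRemainder hmp c s [MOD m * p] ∧
          ∀ p' ∈ D, q % p' ∈ r p')
        ((Ioc 0 M).filter fun q => q ≡ Nat.chineseRemainder hmp c s' [MOD m * p] ∧
          ∀ p' ∈ D, q % p' ∈ r p') := by
      intro s hs s' hs' hne
      rw [disjoint_filter]
      rintro q - ⟨h1, -⟩ ⟨h2, -⟩
      have e1 : q ≡ s [MOD p] := (h1.of_mul_left m).trans (Nat.chineseRemainder hmp c s).2.2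
      have e2 : q ≡ s' [MOD p] := (h2.of_mul_left m).trans (Nat.chineseRemainder hmp c s').2.2
      exact hne ((e1.symm.trans e2).eq_of_lt_of_lt
        (mem_range.1 (hr p (mem_insert_self _ _) hs))
        (mem_range.1 (hr p (mem_insert_self _ _) hs')))
    rw [hsplit, card_biUnion hdisj, prod_insert hpD, card_insert_of_notMem hpD]
    push_cast
    have hp0 : (p : ℝ) ≠ 0 := by exact_mod_cast hp.ne_zero
    have hm0 : (m : ℝ) ≠ 0 := by exact_mod_cast hm.ne'
    have hmain : (M : ℝ) / m * (κ / p * ∏ p ∈ D, (κ : ℝ) / p) =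
        ∑ s ∈ r p, (M : ℝ) / ((m * p : ℕ) : ℝ) * ∏ p ∈ D, (κ : ℝ) / p := by
      rw [sum_const, hκ p (mem_insert_self _ _), nsmul_eq_mul]
      push_cast
      field_simp
    rw [hmain, ← sum_sub_distrib]
    refine (abs_sum_le_sum_abs _ _).trans ?_
    calc _ ≤ ∑ s ∈ r p, (κ : ℝ) ^ D.card := by
          refine sum_le_sum fun s _ => ih (fun p' h => hD p' (mem_insert_of_mem h))
            (fun p' h => hr p' (mem_insert_of_mem h)) (fun p' h => hκ p' (mem_insert_of_mem h))
            (Nat.mul_pos hm hp.pos) (fun p' h => ?_) _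
          refine Nat.Coprime.mul_left (hmD p' (mem_insert_of_mem h)) ?_
          exact (Nat.coprime_primes hp (hD p' (mem_insert_of_mem h))).2
            fun e => hpD (e ▸ h)
      _ = _ := by
          rw [sum_const, hκ p (mem_insert_self _ _), nsmul_eq_mul, pow_succ, mul_comm]

lemma sum_powerset_card_gt_prod_le {P : Finset ℕ} {f : ℕ → ℝ} (hf : ∀ p ∈ P, 0 ≤ f p) (R : ℕ) :
    ∑ D ∈ P.powerset with ¬ D.card ≤ R, ∏ p ∈ D, f p ≤
      Real.exp (3 * ∑ p ∈ P, f p - R) := by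
  have h3 : Real.exp 1 ≤ 3 := by have := Real.exp_one_lt_d9; linarith
  have hnn : ∀ D ∈ P.powerset, 0 ≤ ∏ p ∈ D, f p := fun D hD =>
    prod_nonneg fun p hp => hf p (mem_powerset.1 hD hp)
  calc _ ≤ ∑ D ∈ P.powerset with ¬ D.card ≤ R, Real.exp (-R) * ∏ p ∈ D, (Real.exp 1 * f p) := by
        refine sum_le_sum fun D hD => ?_
        have h1 := hnn D (mem_filter.1 hD).1
        have h2 : (R : ℝ) ≤ D.card := by exact_mod_cast (not_le.1 (mem_filter.1 hD).2).le
        rw [prod_mul_distrib, prod_const, ← Real.exp_nat_mul, ← mul_assoc, ← Real.exp_add]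
        refine le_mul_of_one_le_left h1 (Real.one_le_exp ?_)
        linarith
    _ ≤ ∑ D ∈ P.powerset, Real.exp (-R) * ∏ p ∈ D, (Real.exp 1 * f p) := by
        refine sum_le_sum_of_subset_of_nonneg (filter_subset _ _) fun D hD _ => ?_
        rw [prod_mul_distrib, prod_const]
        have := hnn D hD
        positivity
    _ = Real.exp (-R) * ∏ p ∈ P, (1 + Real.exp 1 * f p) := by
        rw [← mul_sum, prod_one_add]
    _ ≤ Real.exp (-R) * ∏ p ∈ P, Real.exp (3 * f p) := by
        gcongr with p hp
        · exact fun p hp => by have := hf p hp; positivity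
        · have h4 := hf p hp
          have h5 := Real.add_one_le_exp (3 * f p)
          nlinarith
    _ = _ := by
        rw [← Real.exp_sum, ← Real.exp_add, ← mul_sum]
        ring_nf

lemma sum_powerset_card_le_pow_le {P : Finset ℕ} {W : ℝ} (hW : 1 ≤ W) (hP : P.card ≤ W) (κ R : ℕ) :
    ∑ D ∈ P.powerset with D.card ≤ R, (κ : ℝ) ^ D.card ≤ W ^ R * Real.exp κ := by
  have hW0 : 0 < W := by linarith
  calc _ ≤ ∑ D ∈ P.powerset with D.card ≤ R, W ^ R * ∏ _p ∈ D, (κ : ℝ) / W := by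
        refine sum_le_sum fun D hD => ?_
        rw [prod_const, div_pow, ← mul_div_assoc, le_div_iff₀ (by positivity), mul_comm (W ^ R)]
        gcongr
        exact (mem_filter.1 hD).2
    _ ≤ ∑ D ∈ P.powerset, W ^ R * ∏ _p ∈ D, (κ : ℝ) / W := by
        refine sum_le_sum_of_subset_of_nonneg (filter_subset _ _) fun D hD _ => ?_
        rw [prod_const]; positivity
    _ = W ^ R * (1 + κ / W) ^ P.card := by
        rw [← mul_sum, ← prod_one_add, prod_const]
    _ ≤ W ^ R * Real.exp (κ / W) ^ P.card := by
        gcongr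
        have := Real.add_one_le_exp (κ / W)
        linarith
    _ ≤ _ := by
        rw [← Real.exp_nat_mul]
        gcongr
        rw [← mul_div_assoc, div_le_iff₀ hW0, mul_comm]
        gcongr

lemma card_sifted_residues_le {κ : ℕ} (r : ℕ → Finset ℕ) (P : Finset ℕ)
    (hP : ∀ p ∈ P, p.Prime) (hr : ∀ p ∈ P, r p ⊆ range p) (hκ : ∀ p ∈ P, (r p).card = κ)
    {R : ℕ} (hR : Even R) {W : ℝ} (hW : 1 ≤ W) (hPW : P.card ≤ W) (M : ℕ) :
    (((Ioc 0 M).filter fun q => ∀ p ∈ P, q % p ∉ r p).card : ℝ) ≤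
      M * (Real.exp (-∑ p ∈ P, (κ : ℝ) / p) + Real.exp (3 * ∑ p ∈ P, (κ : ℝ) / p - R)) +
        W ^ R * Real.exp κ := by
  have h1 := card_sifted_le (Ioc 0 M) P (fun q p => q % p ∈ r p) hR
  have h2 : (((Ioc 0 M).filter fun q => ∀ p ∈ P, q % p ∉ r p).card : ℝ) ≤
      ∑ D ∈ P.powerset with D.card ≤ R, (-1 : ℝ) ^ D.card *
        (((Ioc 0 M).filter fun q => ∀ p ∈ D, q % p ∈ r p).card : ℝ) := by
    have h2 := (Int.cast_le (R := ℝ)).2 h1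
    push_cast at h2
    convert h2 <;> rfl
  have h3 : ∀ D ∈ P.powerset.filter (fun D => D.card ≤ R), (-1 : ℝ) ^ D.card *
        (((Ioc 0 M).filter fun q => ∀ p ∈ D, q % p ∈ r p).card : ℝ) ≤
        M * ∏ p ∈ D, -((κ : ℝ) / p) + (κ : ℝ) ^ D.card := by
    intro D hD
    have hDP := mem_powerset.1 (mem_filter.1 hD).1
    have h4 := abs_card_residues_sub_le r D (fun p h => hP p (hDP h)) (fun p h => hr p (hDP h))
      (fun p h => hκ p (hDP h)) one_pos (fun p _ => Nat.coprime_one_left p) 0 M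
    simp only [Nat.modEq_one, true_and, Nat.cast_one, div_one] at h4
    rw [prod_neg]
    rw [abs_le] at h4
    rcases neg_one_pow_eq_or ℝ D.card with h | h <;> rw [h] <;> linarith
  have h5 : ∑ D ∈ P.powerset with D.card ≤ R, ∏ p ∈ D, -((κ : ℝ) / p) ≤
      Real.exp (-∑ p ∈ P, (κ : ℝ) / p) + Real.exp (3 * ∑ p ∈ P, (κ : ℝ) / p - R) := by
    have h6 := sum_filter_add_sum_filter_not P.powerset (fun D => D.card ≤ R)
      (fun D => ∏ p ∈ D, -((κ : ℝ) / p))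
    rw [← prod_one_add] at h6
    have h7 : ∏ p ∈ P, (1 + -((κ : ℝ) / p)) ≤ Real.exp (-∑ p ∈ P, (κ : ℝ) / p) := by
      rw [← sum_neg_distrib, Real.exp_sum]
      refine prod_le_prod (fun p hp => ?_) fun p hp => ?_
      · have hle : κ ≤ p := by
          have := card_le_card (hr p hp)
          rwa [hκ p hp, card_range] at this
        have : (κ : ℝ) / p ≤ 1 := by
          rw [div_le_one (by exact_mod_cast (hP p hp).pos)]
          exact_mod_cast hle
        linarith
      · have := Real.add_one_le_exp (-((κ : ℝ) / p))
        linarith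
    have h8 : -∑ D ∈ P.powerset with ¬ D.card ≤ R, ∏ p ∈ D, -((κ : ℝ) / p) ≤
        Real.exp (3 * ∑ p ∈ P, (κ : ℝ) / p - R) := by
      refine le_trans ?_ (sum_powerset_card_gt_prod_le (fun p _ => by positivity) R)
      rw [← sum_neg_distrib]
      refine sum_le_sum fun D _ => ?_
      rw [prod_neg]
      have : 0 ≤ ∏ p ∈ D, (κ : ℝ) / p := prod_nonneg fun p _ => by positivity
      rcases neg_one_pow_eq_or ℝ D.card with h | h <;> rw [h] <;> linarith
    linarith
  calc _ ≤ _ := h2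
    _ ≤ ∑ D ∈ P.powerset with D.card ≤ R, (M * ∏ p ∈ D, -((κ : ℝ) / p) + (κ : ℝ) ^ D.card) :=
        sum_le_sum h3
    _ = M * ∑ D ∈ P.powerset with D.card ≤ R, ∏ p ∈ D, -((κ : ℝ) / p) +
          ∑ D ∈ P.powerset with D.card ≤ R, (κ : ℝ) ^ D.card := by
        rw [sum_add_distrib, mul_sum]
    _ ≤ _ := by
        gcongr
        exact sum_powerset_card_le_pow_le hW hPW κ R

/-- The residues of `q` modulo `p` for which `p` divides one of `q`, `a * q + 1`,
`n - (a * q + 1)`. -/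
def goldbachResidues (a n p : ℕ) : Finset ℕ :=
  {0, (-(a : ZMod p)⁻¹).val, (((n : ZMod p) - 1) * (a : ZMod p)⁻¹).val}

lemma goldbachResidues_subset_range (a n : ℕ) {p : ℕ} (hp : p.Prime) :
    goldbachResidues a n p ⊆ range p := by
  have : NeZero p := ⟨hp.ne_zero⟩
  intro s hs
  simp only [goldbachResidues, mem_insert, mem_singleton] at hs
  rw [mem_range]
  rcases hs with rfl | rfl | rfl
  · exact hp.pos
  · exact ZMod.val_lt _
  · exact ZMod.val_lt _

lemma card_goldbachResidues {a n p : ℕ} (hp : p.Prime) (hn : 1 ≤ n)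
    (h : ¬ p ∣ a * n * (n - 1)) : (goldbachResidues a n p).card = 3 := by
  have : Fact p.Prime := ⟨hp⟩
  simp only [hp.dvd_mul, not_or, ← ZMod.natCast_eq_zero_iff] at h
  obtain ⟨⟨ha, hn0⟩, hn1⟩ := h
  rw [Nat.cast_sub hn, Nat.cast_one] at hn1
  rw [goldbachResidues, card_insert_of_notMem, card_pair]
  · intro e
    have e1 := ZMod.val_injective p e
    have e2 : (n : ZMod p) * (a : ZMod p)⁻¹ = 0 := by linear_combination -e1
    simp_all
  · simp only [mem_insert, mem_singleton, not_or]
    refine ⟨fun e => ?_, fun e => ?_⟩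
    · rw [eq_comm, ZMod.val_eq_zero] at e
      simp_all
    · rw [eq_comm, ZMod.val_eq_zero] at e
      simp_all

lemma dvd_of_mod_mem_goldbachResidues {a n p q : ℕ} (hp : p.Prime) (hn : a * q + 1 ≤ n)
    (h : ¬ p ∣ a) (hq : q % p ∈ goldbachResidues a n p) :
    p ∣ q ∨ p ∣ a * q + 1 ∨ p ∣ n - (a * q + 1) := by
  have : Fact p.Prime := ⟨hp⟩
  rw [← ZMod.natCast_eq_zero_iff] at h
  simp only [← ZMod.natCast_eq_zero_iff, Nat.cast_sub hn]
  push_cast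
  rw [← ZMod.val_natCast] at hq
  simp only [goldbachResidues, mem_insert, mem_singleton] at hq
  rcases hq with e | e | e
  · left
    rwa [ZMod.val_eq_zero] at e
  · right; left
    rw [ZMod.val_injective p e]
    field_simp
    ring
  · right; right
    rw [ZMod.val_injective p e]
    field_simp
    ring

lemma sum_inv_primeFactors_le {m k : ℕ} (hm : m ≠ 0) (hk : 2 ≤ k) :
    ∑ p ∈ m.primeFactors, (1 : ℝ) / p ≤
      Real.log (Real.log k) + 11 + Real.log m / (Real.log 2 * k) := by
  have hk0 : (0 : ℝ) < k := by exact_mod_cast (by omega : 0 < k)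
  have hl2 := Real.log_pos (one_lt_two)
  rw [← sum_filter_add_sum_filter_not _ (fun p => p ≤ k)]
  refine add_le_add ((sum_le_sum_of_subset_of_nonneg (fun p hp => ?_)
    fun _ _ _ => by positivity).trans (sum_inv_primesBelow_le hk)) ?_
  · simp only [mem_filter, Nat.mem_primeFactors] at hp
    exact Nat.mem_primesBelow.2 ⟨by omega, hp.1.1⟩
  · have hcard : (m.primeFactors.card : ℝ) * Real.log 2 ≤ Real.log m := by
      rw [← Real.log_pow]
      refine Real.log_le_log (by positivity) ?_
      have h1 : 2 ^ m.primeFactors.card ≤ ∏ p ∈ m.primeFactors, p :=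
        pow_card_le_prod _ _ _ fun p hp => (Nat.prime_of_mem_primeFactors hp).two_le
      exact_mod_cast h1.trans (Nat.le_of_dvd (Nat.pos_of_ne_zero hm) (Nat.prod_primeFactors_dvd m))
    calc _ ≤ ∑ p ∈ m.primeFactors with ¬ p ≤ k, (1 : ℝ) / k := by
          refine sum_le_sum fun p hp => ?_
          have : k ≤ p := (not_le.1 (mem_filter.1 hp).2).le
          gcongr
      _ ≤ ∑ p ∈ m.primeFactors, (1 : ℝ) / k :=
          sum_le_sum_of_subset_of_nonneg (filter_subset _ _) fun _ _ _ => by positivity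
      _ = m.primeFactors.card / k := by rw [sum_const, nsmul_eq_mul, mul_one_div]
      _ ≤ _ := by
          rw [div_le_div_iff₀ hk0 (by positivity)]
          nlinarith

lemma sum_inv_primeFactors_le_of_le_pow {N m : ℕ} (hN : 3 ≤ Real.log N) (hm : m ≠ 0)
    (hmN : m ≤ N ^ 3) :
    ∑ p ∈ m.primeFactors, (1 : ℝ) / p ≤ Real.log (Real.log (Real.log N)) + 17 := by
  set L := Real.log N
  have hk : L ≤ ⌈L⌉₊ := Nat.le_ceil L
  have hk' : (⌈L⌉₊ : ℝ) < L + 1 := Nat.ceil_lt_add_one (by linarith)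
  have hk2 : 2 ≤ ⌈L⌉₊ := by
    have : (2 : ℝ) ≤ ⌈L⌉₊ := by linarith
    exact_mod_cast this
  have hL1 : 1 < Real.log L := by
    rw [Real.lt_log_iff_exp_lt (by linarith)]
    have := Real.exp_one_lt_d9
    linarith
  have hlog2 := Real.log_two_gt_d9
  have hlog2' := Real.log_two_lt_d9
  refine (sum_inv_primeFactors_le hm hk2).trans ?_
  have h1 : Real.log (Real.log ⌈L⌉₊) ≤ Real.log 2 + Real.log (Real.log L) := by
    rw [← Real.log_mul (by norm_num) (by linarith)]
    refine Real.log_le_log (Real.log_pos (by linarith)) ?_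
    have : 2 * Real.log L = Real.log (L ^ 2) := by rw [Real.log_pow]; norm_num
    rw [this]
    refine Real.log_le_log (by linarith) ?_
    nlinarith
  have h2 : Real.log m ≤ 3 * L := by
    have h3 : (3 : ℝ) * L = Real.log ((N : ℝ) ^ 3) := by rw [Real.log_pow]; norm_num [L]
    rw [h3]
    refine Real.log_le_log (by exact_mod_cast Nat.pos_of_ne_zero hm) (by exact_mod_cast hmN)
  have h3 : Real.log m / (Real.log 2 * ⌈L⌉₊) ≤ 5 := by
    rw [div_le_iff₀ (by positivity)]
    nlinarith
  linarith

/-- An upper bound for the number of `q ≤ M` such that none of `q`, `a * q + 1`,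
`n - (a * q + 1)` has a small prime factor. -/
lemma card_prime_triples_le {N a n z R : ℕ} (hN : 3 ≤ Real.log N) (ha : 1 ≤ a) (haN : a ≤ N)
    (hn : 2 ≤ n) (hnN : n ≤ N) (hz : 2 ≤ z) (hR : Even R) (M : ℕ) :
    (((Ioc 0 M).filter fun q => q.Prime ∧ (a * q + 1).Prime ∧ (n - (a * q + 1)).Prime ∧
        z < q ∧ z < a * q + 1 ∧ z < n - (a * q + 1)).card : ℝ) ≤
      M * (Real.exp 78 * (Real.log (Real.log N) / Real.log z) ^ 3 +
        Real.exp 99 * Real.log z ^ 9 * Real.exp (-R)) + (z : ℝ) ^ R * Real.exp 3 := by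
  have hz' : (2 : ℝ) ≤ z := by exact_mod_cast hz
  have hlz : 0 < Real.log z := Real.log_pos (by linarith)
  have hm : a * n * (n - 1) ≠ 0 := by
    have : 0 < n - 1 := by omega
    positivity
  have hmN : a * n * (n - 1) ≤ N ^ 3 := by
    calc a * n * (n - 1) ≤ N * N * N := by gcongr; omega
      _ = N ^ 3 := by ring
  have hL1 : 0 < Real.log (Real.log N) := Real.log_pos (by linarith)
  set P := (Nat.primesBelow (z + 1)).filter fun p => ¬ p ∣ a * n * (n - 1) with hPdef
  have hPm : ∀ p ∈ P, p ≤ z ∧ p.Prime ∧ ¬ p ∣ a * n * (n - 1) := fun p hp => by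
    rw [hPdef, mem_filter, Nat.mem_primesBelow] at hp
    exact ⟨by omega, hp.1.2, hp.2⟩
  have hPcard : (P.card : ℝ) ≤ z := by
    have h1 : P ⊆ Ioc 0 z := fun p hp =>
      mem_Ioc.2 ⟨(hPm p hp).2.1.pos, (hPm p hp).1⟩
    have := card_le_card h1
    rw [Nat.card_Ioc] at this
    exact_mod_cast this
  have hlow : Real.log (Real.log z) - Real.log (Real.log (Real.log N)) - 26 ≤
      ∑ p ∈ P, (1 : ℝ) / p := by
    have h1 := le_sum_inv_primesBelow hz
    rw [← sum_filter_add_sum_filter_not _ (fun p => p ∣ a * n * (n - 1))] at h1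
    have h2 : ∑ p ∈ Nat.primesBelow (z + 1) with p ∣ a * n * (n - 1), (1 : ℝ) / p ≤
        ∑ p ∈ (a * n * (n - 1)).primeFactors, (1 : ℝ) / p := by
      refine sum_le_sum_of_subset_of_nonneg (fun p hp => ?_) fun _ _ _ => by positivity
      rw [mem_filter, Nat.mem_primesBelow] at hp
      exact Nat.mem_primeFactors.2 ⟨hp.1.2, hp.2, hm⟩
    have h3 := sum_inv_primeFactors_le_of_le_pow hN hm hmN
    linarith
  have hup : ∑ p ∈ P, (1 : ℝ) / p ≤ Real.log (Real.log z) + 11 :=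
    (sum_le_sum_of_subset_of_nonneg (filter_subset _ _) fun _ _ _ => by positivity).trans
      (sum_inv_primesBelow_le hz)
  have hsum : ∑ p ∈ P, ((3 : ℕ) : ℝ) / p = 3 * ∑ p ∈ P, (1 : ℝ) / p := by
    rw [mul_sum]
    refine sum_congr rfl fun p _ => ?_
    push_cast
    ring
  have hsieve := card_sifted_residues_le (goldbachResidues a n) P (fun p hp => (hPm p hp).2.1)
    (fun p hp => goldbachResidues_subset_range a n (hPm p hp).2.1)
    (fun p hp => card_goldbachResidues (hPm p hp).2.1 (by omega) (hPm p hp).2.2) hR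
    (by linarith : (1 : ℝ) ≤ z) hPcard M
  rw [hsum] at hsieve
  have hsub : ((Ioc 0 M).filter fun q => q.Prime ∧ (a * q + 1).Prime ∧ (n - (a * q + 1)).Prime ∧
        z < q ∧ z < a * q + 1 ∧ z < n - (a * q + 1)) ⊆
      (Ioc 0 M).filter fun q => ∀ p ∈ P, q % p ∉ goldbachResidues a n p := by
    intro q hq
    rw [mem_filter] at hq ⊢
    obtain ⟨hqM, h1, h2, h3, h4, h5, h6⟩ := hq
    refine ⟨hqM, fun p hp hmem => ?_⟩
    obtain ⟨hpz, hpp, hpm⟩ := hPm p hp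
    have key : ∀ {x : ℕ}, x.Prime → z < x → ¬ p ∣ x := fun hx hzx hdvd => by
      have := (Nat.prime_dvd_prime_iff_eq hpp hx).1 hdvd
      omega
    rcases dvd_of_mod_mem_goldbachResidues hpp (by have := h3.pos; omega)
      (fun h => hpm (((h.mul_right n)).mul_right _)) hmem with h | h | h
    · exact key h1 h4 h
    · exact key h2 h5 h
    · exact key h3 h6 h
  calc _ ≤ _ := by exact_mod_cast card_le_card hsub
    _ ≤ _ := hsieve
    _ ≤ _ := by
      push_cast
      gcongr
      · calc _ ≤ Real.exp (78 + 3 * Real.log (Real.log (Real.log N) / Real.log z)) := by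
              gcongr
              rw [Real.log_div (by positivity) (by positivity)]
              linarith
          _ = _ := by
              rw [Real.exp_add, mul_comm (3 : ℝ), Real.exp_mul, Real.exp_log (by positivity)]
              norm_cast
      · calc _ ≤ Real.exp (99 + 9 * Real.log (Real.log z) + -R) := by
              gcongr
              linarith
          _ = _ := by
              rw [Real.exp_add, Real.exp_add, mul_comm (9 : ℝ), Real.exp_mul, Real.exp_log hlz]
              norm_cast

lemma exists_prime_dvd_gt_of_pow_lt {m K : ℕ} {y : ℝ} (hy : 1 ≤ y)
    (hK : ArithmeticFunction.cardFactors m ≤ K) (h : y ^ K < m) :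
    ∃ q : ℕ, q.Prime ∧ q ∣ m ∧ y < q := by
  by_contra! hcon
  have hm : m ≠ 0 := by
    rintro rfl
    have : (0 : ℝ) < y ^ K := by positivity
    simp only [Nat.cast_zero] at h
    linarith
  have h1 : m ≤ ⌊y⌋₊ ^ ArithmeticFunction.cardFactors m := by
    rw [ArithmeticFunction.cardFactors_apply]
    conv_lhs => rw [← Nat.prod_primeFactorsList hm]
    refine List.prod_le_pow_card _ _ fun q hq => ?_
    exact Nat.le_floor (hcon q (Nat.prime_of_mem_primeFactorsList hq)
      (Nat.dvd_of_mem_primeFactorsList hq))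
  have h2 : (m : ℝ) ≤ y ^ K := by
    calc (m : ℝ) ≤ (⌊y⌋₊ : ℝ) ^ ArithmeticFunction.cardFactors m := by exact_mod_cast h1
      _ ≤ y ^ ArithmeticFunction.cardFactors m := by
          gcongr
          exact Nat.floor_le (by linarith)
      _ ≤ y ^ K := by gcongr
  linarith

/-- Removing a prime factor `q` from `m` leaves a divisor in a slightly longer range. -/
lemma exists_dvd_of_prime_mul {N q a d : ℕ} {X u v A B : ℝ} (hq : q.Prime) (ha : 0 < a)
    (hX : X < (a * q : ℕ)) (hN : a * q ≤ N) (hu : 0 < u) (hAu : A ≤ u) (hvB : v ≤ B)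
    (hA0 : 0 ≤ A) (hA : A * v ≤ X) (hB : N ≤ B * u) (hd : d ∣ a * q) (hud : u < d) (hdv : d < v) :
    ∃ e ∈ Ioc ⌊A⌋₊ ⌊B⌋₊, e ∣ a := by
  obtain ⟨m, hm⟩ := hd
  have hmem : ∀ e : ℕ, A < e → (e : ℝ) ≤ B → e ∈ Ioc ⌊A⌋₊ ⌊B⌋₊ := fun e h1 h2 =>
    mem_Ioc.2 ⟨(Nat.floor_lt hA0).2 h1, Nat.le_floor h2⟩
  rcases (hq.dvd_mul).1 (hm ▸ Dvd.intro_left a rfl : q ∣ d * m) with ⟨d', rfl⟩ | ⟨m', rfl⟩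
  · have hda : a = d' * m := Nat.eq_of_mul_eq_mul_right hq.pos (by rw [hm]; ring)
    refine ⟨m, ?_, hda ▸ Dvd.intro_left d' rfl⟩
    have e1 : ((a * q : ℕ) : ℝ) = ((q * d' : ℕ) : ℝ) * m := by rw [hm]; push_cast; ring
    have e2 : ((a * q : ℕ) : ℝ) ≤ N := by exact_mod_cast hN
    have hm0 : (0 : ℝ) < m := by
      rcases Nat.eq_zero_or_pos m with h | h
      · subst h; omega
      · exact_mod_cast h
    set D : ℝ := ((q * d' : ℕ) : ℝ)
    refine hmem m ?_ ?_
    · have h1 : A * v < v * m := by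
        calc A * v ≤ X := hA
          _ < D * m := by rw [← e1]; exact hX
          _ ≤ v * m := by gcongr
      have hv : 0 < v := by linarith
      nlinarith
    · have h1 : u * m ≤ B * u := by
        calc u * m ≤ D * m := by gcongr
          _ ≤ N := by rw [← e1]; exact e2
          _ ≤ B * u := hB
      nlinarith
  · have hda : a = d * m' := Nat.eq_of_mul_eq_mul_right hq.pos (by rw [hm]; ring)
    exact ⟨d, hmem d (by linarith) (by linarith), hda ▸ Dvd.intro _ rfl⟩

/-- Goldbach pairs `(p₁, p₂)` with a divisor of `p₁ - 1` in `(u, v)` are either degenerate or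
come from a triple of primes `q`, `a * q + 1`, `n - (a * q + 1)`. -/
lemma card_goldbach_le {N n K z : ℕ} {X y u v A B : ℝ} (hnN : n ≤ N) (hX : 0 ≤ X) (hy : 1 ≤ y)
    (hyX : y ≤ X) (hyK : y ^ K ≤ X) (hz : z ≤ y) (hu : 0 < u) (hAu : A ≤ u) (hvB : v ≤ B)
    (hA0 : 0 ≤ A) (hA : A * v ≤ X) (hB : N ≤ B * u) :
    (((range (N + 1) ×ˢ range (N + 1)).filter fun q => q.1.Prime ∧ q.2.Prime ∧ q.1 + q.2 = n ∧
        ∃ d : ℕ, d ∣ q.1 - 1 ∧ u < d ∧ d < v).card : ℝ) ≤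
      2 * X + 3 +
      (((Ioc 0 N).filter fun m => K ≤ ArithmeticFunction.cardFactors m).card : ℝ) +
      ∑ a ∈ ((Ioc 0 N).filter fun a => ∃ d ∈ Ioc ⌊A⌋₊ ⌊B⌋₊, d ∣ a).filter
          (fun a : ℕ => (a : ℝ) * y ≤ N),
        (((Ioc 0 (N / a)).filter fun q => q.Prime ∧ (a * q + 1).Prime ∧
          (n - (a * q + 1)).Prime ∧ z < q ∧ z < a * q + 1 ∧ z < n - (a * q + 1)).card : ℝ) := by
  set S := (range (N + 1) ×ˢ range (N + 1)).filter fun q => q.1.Prime ∧ q.2.Prime ∧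
    q.1 + q.2 = n ∧ ∃ d : ℕ, d ∣ q.1 - 1 ∧ u < d ∧ d < v
  set T := (Ioc 0 N).filter fun m => K ≤ ArithmeticFunction.cardFactors m
  set I := ((Ioc 0 N).filter fun a => ∃ d ∈ Ioc ⌊A⌋₊ ⌊B⌋₊, d ∣ a).filter fun a : ℕ => (a : ℝ) * y ≤ N
  set Q : ℕ → Finset ℕ := fun a => (Ioc 0 (N / a)).filter fun q => q.Prime ∧ (a * q + 1).Prime ∧
          (n - (a * q + 1)).Prime ∧ z < q ∧ z < a * q + 1 ∧ z < n - (a * q + 1)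
  have hsub : S.image Prod.fst ⊆ range (⌊X⌋₊ + 2) ∪ (range (⌊X⌋₊ + 1)).image (n - ·) ∪
      T.image (· + 1) ∪ I.biUnion fun a => (Q a).image fun q => a * q + 1 := by
    intro p hp
    obtain ⟨⟨p₁, p₂⟩, hpS, rfl⟩ := mem_image.1 hp
    simp only [S, mem_filter, mem_product, mem_range] at hpS
    obtain ⟨-, hp1, hp2, hpn, d, hd, hud, hdv⟩ := hpS
    simp only [mem_union]
    have h1 := hp1.two_le
    by_cases c1 : ((p₁ - 1 : ℕ) : ℝ) ≤ X
    · left; left; left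
      have := Nat.le_floor c1
      exact mem_range.2 (by omega)
    by_cases c2 : (p₂ : ℝ) ≤ X
    · left; left; right
      have := Nat.le_floor c2
      exact mem_image.2 ⟨p₂, mem_range.2 (by omega), by omega⟩
    by_cases c3 : K ≤ ArithmeticFunction.cardFactors (p₁ - 1)
    · left; right
      exact mem_image.2 ⟨p₁ - 1, mem_filter.2 ⟨mem_Ioc.2 ⟨by omega, by omega⟩, c3⟩,
        by omega⟩
    right
    push Not at c1 c2 c3
    obtain ⟨q, hq, ⟨a, hqa⟩, hyq⟩ := exists_prime_dvd_gt_of_pow_lt hy c3.le (hyK.trans_lt c1)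
    rw [mul_comm] at hqa
    have ha : 0 < a := by
      rcases Nat.eq_zero_or_pos a with h | h
      · subst h; omega
      · exact h
    have hp₁ : p₁ = a * q + 1 := by omega
    have hp₂ : p₂ = n - (a * q + 1) := by omega
    have haqN : a * q ≤ N := by omega
    have haN : a ≤ N := (Nat.le_mul_of_pos_right a hq.pos).trans haqN
    have hzq : z < q := by
      have : (z : ℝ) < q := by linarith
      exact_mod_cast this
    have hzp : z < p₂ := by
      have : (z : ℝ) < p₂ := by linarith
      exact_mod_cast this
    refine mem_biUnion.2 ⟨a, mem_filter.2 ⟨mem_filter.2 ⟨mem_Ioc.2 ⟨ha, haN⟩, ?_⟩, ?_⟩,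
      mem_image.2 ⟨q, mem_filter.2 ⟨mem_Ioc.2 ⟨hq.pos, ?_⟩, hq, hp₁ ▸ hp1, hp₂ ▸ hp2, hzq, ?_,
        hp₂ ▸ hzp⟩, hp₁.symm⟩⟩
    · rw [hqa] at hd c1
      exact exists_dvd_of_prime_mul hq ha c1 haqN hu hAu hvB hA0 hA hB hd hud hdv
    · calc a * y ≤ a * q := by gcongr
        _ ≤ N := by exact_mod_cast haqN
    · rw [Nat.le_div_iff_mul_le ha, mul_comm]
      exact haqN
    · have := Nat.le_mul_of_pos_left q ha
      omega
  have hinj : (S.image Prod.fst).card = S.card := by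
    refine card_image_of_injOn fun x hx x' hx' e => ?_
    simp only [S, coe_filter, Set.mem_ofPred_eq] at hx hx'
    have h1 := hx.2.2.2.1
    have h2 := hx'.2.2.2.1
    exact Prod.ext e (by omega)
  have hcard : S.card ≤ (⌊X⌋₊ + 2) + (⌊X⌋₊ + 1) + T.card + ∑ a ∈ I, (Q a).card := by
    rw [← hinj]
    refine (card_le_card hsub).trans ?_
    refine (card_union_le _ _).trans (add_le_add ((card_union_le _ _).trans (add_le_add
      ((card_union_le _ _).trans (add_le_add (card_range _).le ?_)) card_image_le)) ?_)
    · exact card_image_le.trans (card_range _).le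
    · exact card_biUnion_le.trans (sum_le_sum fun a _ => card_image_le)
  have hcard' : (S.card : ℝ) ≤ (⌊X⌋₊ + 2) + (⌊X⌋₊ + 1) + T.card + ∑ a ∈ I, ((Q a).card : ℝ) := by
    exact_mod_cast hcard
  have hfl := Nat.floor_le hX
  linarith

/-- The contribution of the cofactors `a` with a divisor in `(A, B]`. -/
lemma sum_card_prime_triples_le {N n z R : ℕ} {A B y E : ℝ} (hN : 3 ≤ Real.log N) (hn : 2 ≤ n)
    (hnN : n ≤ N) (hz : 2 ≤ z) (hR : Even R) (hy : 0 < y) (hzy : (z : ℝ) ^ R ≤ E * y)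
    (hA : 1 ≤ A) (hNA : Real.log N ≤ 4 * Real.log A) (hAB : A ≤ B) (hBN : B ≤ N) :
    ∑ a ∈ ((Ioc 0 N).filter fun a => ∃ d ∈ Ioc ⌊A⌋₊ ⌊B⌋₊, d ∣ a).filter
          (fun a : ℕ => (a : ℝ) * y ≤ N),
        (((Ioc 0 (N / a)).filter fun q => q.Prime ∧ (a * q + 1).Prime ∧
          (n - (a * q + 1)).Prime ∧ z < q ∧ z < a * q + 1 ∧ z < n - (a * q + 1)).card : ℝ) ≤
      N * (Real.exp 78 * (Real.log (Real.log N) / Real.log z) ^ 3 +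
        Real.exp 99 * Real.log z ^ 9 * Real.exp (-R) + E * Real.exp 3) *
        (Real.exp 60 * Real.log N ^ (√2 - 1 / 2) * (Real.log (B / A) + 8)) := by
  have hN3 : 3 ≤ N := by
    by_contra! h
    have h0 : (N : ℝ) ≤ 2 := by exact_mod_cast Nat.le_of_lt_succ h
    rcases Nat.eq_zero_or_pos N with h1 | h1
    · subst h1; norm_num at hN
    · have := Real.log_le_sub_one_of_pos (by exact_mod_cast h1 : (0 : ℝ) < N)
      linarith
  set F := Real.exp 78 * (Real.log (Real.log N) / Real.log z) ^ 3 +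
        Real.exp 99 * Real.log z ^ 9 * Real.exp (-R) with hF
  have hz' : (2 : ℝ) ≤ z := by exact_mod_cast hz
  have hlz : 0 < Real.log z := Real.log_pos (by linarith)
  have hL1 : 0 < Real.log (Real.log N) := Real.log_pos (by linarith)
  have hF0 : 0 ≤ F := by positivity
  have hE : 0 ≤ E := by
    by_contra! h
    have : 0 ≤ (z : ℝ) ^ R := by positivity
    nlinarith
  calc _ ≤ ∑ a ∈ ((Ioc 0 N).filter fun a => ∃ d ∈ Ioc ⌊A⌋₊ ⌊B⌋₊, d ∣ a).filter
          (fun a : ℕ => (a : ℝ) * y ≤ N),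
        N * (F + E * Real.exp 3) * (1 / (a : ℝ)) := by
        refine sum_le_sum fun a ha => ?_
        simp only [mem_filter, mem_Ioc] at ha
        obtain ⟨⟨⟨ha0, haN⟩, -⟩, hay⟩ := ha
        have ha0' : (0 : ℝ) < a := by exact_mod_cast ha0
        refine (card_prime_triples_le hN ha0 haN hn hnN hz hR (N / a)).trans ?_
        rw [← hF]
        have h1 : ((N / a : ℕ) : ℝ) ≤ N / a := Nat.cast_div_le
        have h2 : y ≤ N / a := by rwa [le_div_iff₀ ha0', mul_comm]
        calc _ ≤ (N : ℝ) / a * F + E * (N / a) * Real.exp 3 := by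
              gcongr
              exact hzy.trans (by gcongr)
          _ = _ := by ring
    _ ≤ ∑ a ∈ (Ioc 0 N).filter fun a => ∃ d ∈ Ioc ⌊A⌋₊ ⌊B⌋₊, d ∣ a,
        N * (F + E * Real.exp 3) * (1 / (a : ℝ)) :=
        sum_le_sum_of_subset_of_nonneg (filter_subset _ _) fun _ _ _ => by positivity
    _ ≤ _ := by
        rw [← mul_sum]
        gcongr
        exact sum_inv_of_dvd_Ioc_le hN3 hA hNA hAB hBN

lemma exists_mul_log_add_le_rpow (c δ : ℝ) (hδ : 0 < δ) :
    ∃ x₀ : ℝ, ∀ x ≥ x₀, c * Real.log x + 8 ≤ x ^ δ := by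
  have h1 : (fun x => c * Real.log x + 8) =o[Filter.atTop] fun x : ℝ => x ^ δ :=
    ((isLittleO_log_rpow_atTop hδ).const_mul_left c).add
      (Asymptotics.isLittleO_const_left.2
        (Or.inr (tendsto_norm_atTop_atTop.comp (tendsto_rpow_atTop hδ))))
  have h2 := h1.bound one_pos
  obtain ⟨x₀, hx₀⟩ := Filter.eventually_atTop.1 (h2.and (Filter.eventually_ge_atTop 0))
  refine ⟨x₀, fun x hx => ?_⟩
  obtain ⟨h3, h4⟩ := hx₀ x hx
  rw [one_mul, Real.norm_eq_abs, Real.norm_eq_abs, abs_of_nonneg (Real.rpow_nonneg h4 δ)] at h3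
  exact (le_abs_self _).trans h3

lemma sqrt_two_lt_neg_two_sub_two_mul_theta0 :
    10 / 1000 - 3 + (√2 - 1 / 2) ≤ -2 - 2 * theta0 := by
  have h1 := Real.exp_one_gt_d9
  have h2 := Real.log_two_gt_d9
  have h3 : √2 ≤ 1.415 := Real.sqrt_le_iff.2 ⟨by norm_num, by norm_num⟩
  rw [theta0]
  nlinarith

lemma half_le_log_floor_exp {w : ℝ} (hw : 2 ≤ w) : w / 2 ≤ Real.log ⌊Real.exp w⌋₊ := by
  have h1 := Nat.lt_floor_add_one (Real.exp w)
  have h2 : Real.exp w = Real.exp (w / 2) * Real.exp (w / 2) := by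
    rw [← Real.exp_add]; ring_nf
  have h3 := Real.add_one_le_exp (w / 2)
  have h4 : Real.exp (w / 2) ≤ ⌊Real.exp w⌋₊ := by nlinarith
  rw [Real.le_log_iff_exp_le (by linarith)]
  exact h4

set_option maxHeartbeats 600000 in
lemma card_goldbach_inP_le {N n : ℕ} {ω : ℝ} (hω : 0 < ω) (hN : 3 ≤ Real.log N) (hn : 2 ≤ n)
    (hnN : n ≤ N)
    (ht : (76 + 4 * ω) * Real.log (Real.log N) + 8 ≤ Real.log N ^ (1 / 1000 : ℝ)) :
    (((range (N + 1) ×ˢ range (N + 1)).filter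
      (fun q => q.1.Prime ∧ q.2.Prime ∧ q.1 + q.2 = n ∧ inP N ω q.1)).card : ℝ) ≤
      (5 + Real.exp 26 + (8 * Real.exp 78 + Real.exp 99 + Real.exp 3) * Real.exp 60 *
        (2 * ω + 12)) * N * Real.log N ^ (-2 - 2 * theta0) := by
  have hN0 : (0 : ℝ) < N := by exact_mod_cast (by omega : 0 < N)
  set L := Real.log N with hL
  have hL0 : 0 < L := by linarith
  set l := Real.log L with hl
  set t := L ^ (1 / 1000 : ℝ) with htdef
  have hl1 : 1 ≤ l := by
    rw [hl, Real.le_log_iff_exp_le hL0]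
    have := Real.exp_one_lt_d9
    linarith
  have hNe : (N : ℝ) = Real.exp L := (Real.exp_log hN0).symm
  have hLe : L = Real.exp l := (Real.exp_log hL0).symm
  have hrpow : ∀ s : ℝ, L ^ s = Real.exp (l * s) := fun s => Real.rpow_def_of_pos hL0 s
  have hte : t = Real.exp (l * (1 / 1000)) := hrpow _
  have hωl : 0 ≤ ω * l := by positivity
  have ht8 : 84 ≤ t := by linarith
  have ht0 : 0 < t := by linarith
  have hlt : l ≤ t := by linarith
  have ht3L : t ^ 3 ≤ L := by
    rw [hte, ← Real.exp_nat_mul, hLe]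
    gcongr
    push_cast
    linarith
  have htL : t ≤ L := (le_self_pow₀ (by linarith) (by norm_num)).trans ht3L
  have ht2L : t ^ 2 ≤ L := (pow_le_pow_right₀ (by linarith) (by norm_num)).trans ht3L
  have hlL : (76 + 4 * ω) * l ≤ L := by linarith
  set R := 2 * ⌊t / 4⌋₊ with hRdef
  have hR : Even R := even_two_mul _
  have hRt : (R : ℝ) ≤ t / 2 := by
    have := Nat.floor_le (by positivity : 0 ≤ t / 4)
    rw [hRdef]; push_cast; linarith
  have hRl : 30 * l ≤ R := by
    have := Nat.lt_floor_add_one (t / 4)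
    rw [hRdef]; push_cast; linarith
  set w := L / t ^ 2 with hw
  have hwt : w = L / t / t := by rw [hw]; field_simp
  have hw2 : 2 ≤ w := by
    rw [hw, le_div_iff₀ (by positivity)]
    refine le_trans ?_ ht3L
    rw [pow_succ' t 2]
    gcongr
    linarith
  have hwL : w ≤ L / t := by
    rw [hwt]
    exact div_le_self (by positivity) (by linarith)
  have hLt : L / t ≤ L / 2 := by gcongr; linarith
  have hRLt : R * (L / t) ≤ L / 2 := by
    calc R * (L / t) ≤ t / 2 * (L / t) := by gcongr
      _ = L / 2 := by field_simp
  have hRw : R * w ≤ L / t / 2 := by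
    calc R * w ≤ t / 2 * w := by gcongr
      _ = L / t / 2 := by rw [hwt]; field_simp
  have hRLt' : (R : ℝ) ≤ L / t / 2 := by
    refine hRt.trans ?_
    gcongr
    rwa [le_div_iff₀ ht0, ← sq]
  set z := ⌊Real.exp w⌋₊ with hz
  have hzle : (z : ℝ) ≤ Real.exp w := Nat.floor_le (by positivity)
  have hz2 : 2 ≤ z := Nat.le_floor (by have := Real.add_one_le_exp w; push_cast; linarith)
  have hlz : w / 2 ≤ Real.log z := half_le_log_floor_exp hw2
  have hlz0 : 0 < Real.log z := by linarith
  have hlzL : Real.log z ≤ L := by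
    rw [Real.log_le_iff_le_exp (by positivity)]
    refine hzle.trans (Real.exp_le_exp.2 ?_)
    linarith
  have hsqrt : √(N : ℝ) = Real.exp (L / 2) := by rw [hNe, Real.exp_half]
  have hu : √(N : ℝ) * L ^ (-ω) = Real.exp (L / 2 - ω * l) := by
    rw [hsqrt, hrpow, ← Real.exp_add]; ring_nf
  have hv : √(N : ℝ) * L ^ ω = Real.exp (L / 2 + ω * l) := by
    rw [hsqrt, hrpow, ← Real.exp_add]; ring_nf
  have hmain := card_goldbach_le (N := N) (n := n) (K := R) (z := z) (X := Real.exp (L - 4 * l))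
    (y := Real.exp (L / t)) (u := Real.exp (L / 2 - ω * l)) (v := Real.exp (L / 2 + ω * l))
    (A := Real.exp (L / 2 - (ω + 4) * l)) (B := Real.exp (L / 2 + ω * l)) hnN (by positivity)
    (Real.one_le_exp (by positivity)) (Real.exp_le_exp.2 (by linarith))
    (by rw [← Real.exp_nat_mul]; exact Real.exp_le_exp.2 (by linarith))
    (hzle.trans (Real.exp_le_exp.2 hwL)) (by positivity) (Real.exp_le_exp.2 (by linarith)) le_rfl
    (by positivity) (by rw [← Real.exp_add]; exact Real.exp_le_exp.2 (by linarith))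
    (by rw [← Real.exp_add, hNe]; exact Real.exp_le_exp.2 (by linarith))
  have hsum := sum_card_prime_triples_le (N := N) (n := n) (z := z) (R := R)
    (A := Real.exp (L / 2 - (ω + 4) * l)) (B := Real.exp (L / 2 + ω * l))
    (y := Real.exp (L / t)) (E := Real.exp (-R)) hN hn hnN hz2 hR (by positivity)
    (by
      calc (z : ℝ) ^ R ≤ Real.exp w ^ R := by gcongr
        _ = Real.exp (R * w) := (Real.exp_nat_mul _ _).symm
        _ ≤ Real.exp (-R + L / t) := Real.exp_le_exp.2 (by linarith)
        _ = _ := Real.exp_add _ _)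
    (Real.one_le_exp (by linarith)) (by rw [Real.log_exp]; linarith)
    (Real.exp_le_exp.2 (by linarith)) (by rw [hNe]; exact Real.exp_le_exp.2 (by linarith))
  rw [← Real.exp_sub, Real.log_exp] at hsum
  have hΩ := card_le_cardFactors_le (by omega : 2 ≤ N) R
  have hER : Real.exp (-R) ≤ Real.exp (l * (-30)) := Real.exp_le_exp.2 (by linarith)
  set θ := -2 - 2 * theta0 with hθ
  have hθ' := sqrt_two_lt_neg_two_sub_two_mul_theta0
  rw [← hθ] at hθ'
  have hsqrt2 : 1 ≤ √(2 : ℝ) := Real.one_le_sqrt.2 (by norm_num)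
  have hlθ : l * (10 / 1000 - 3 + (√2 - 1 / 2)) ≤ l * θ := by gcongr
  have hlθ3 : l * (-3) ≤ l * θ := by gcongr; linarith
  have b1 : 2 * Real.exp (L - 4 * l) + 3 ≤ 5 * N * L ^ θ := by
    have h1 : 1 ≤ Real.exp (L - 4 * l) := Real.one_le_exp (by linarith)
    have h2 : Real.exp (L - 4 * l) ≤ N * L ^ θ := by
      rw [hrpow, hNe, ← Real.exp_add]
      exact Real.exp_le_exp.2 (by linarith)
    linarith
  have b2 : N * (Real.exp 26 * L ^ (3 / 2 : ℝ)) * (2 / 3) ^ R ≤ Real.exp 26 * N * L ^ θ := by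
    have h1 : (2 / 3 : ℝ) ^ R ≤ Real.exp (l * (-10)) := by
      calc (2 / 3 : ℝ) ^ R ≤ Real.exp (-1 / 3) ^ R := by
            gcongr
            have := Real.add_one_le_exp (-1 / 3 : ℝ)
            linarith
        _ = Real.exp (R * (-1 / 3)) := (Real.exp_nat_mul _ _).symm
        _ ≤ _ := Real.exp_le_exp.2 (by linarith)
    calc _ ≤ N * (Real.exp 26 * L ^ (3 / 2 : ℝ)) * Real.exp (l * (-10)) := by gcongr
      _ = Real.exp 26 * N * Real.exp (l * (3 / 2) + l * (-10)) := by
          rw [hrpow, Real.exp_add]; ring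
      _ ≤ _ := by
          rw [hrpow]
          gcongr
          linarith
  have b3 : Real.exp 78 * (l / Real.log z) ^ 3 + Real.exp 99 * Real.log z ^ 9 * Real.exp (-R) +
      Real.exp (-R) * Real.exp 3 ≤
      (8 * Real.exp 78 + Real.exp 99 + Real.exp 3) * Real.exp (l * (9 / 1000 - 3)) := by
    have h1 : (l / Real.log z) ^ 3 ≤ 8 * Real.exp (l * (9 / 1000 - 3)) := by
      calc (l / Real.log z) ^ 3 ≤ (t / (w / 2)) ^ 3 := by gcongr
        _ = 8 * (t ^ 9 / L ^ 3) := by rw [hw]; field_simp; ring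
        _ = _ := by
            rw [hte, hLe, ← Real.exp_nat_mul, ← Real.exp_nat_mul, ← Real.exp_sub]
            push_cast
            ring_nf
    have h2 : Real.log z ^ 9 * Real.exp (-R) ≤ Real.exp (l * (9 / 1000 - 3)) := by
      calc _ ≤ L ^ 9 * Real.exp (l * (-30)) := by gcongr
        _ = Real.exp (l * (-21)) := by
            rw [hLe, ← Real.exp_nat_mul, ← Real.exp_add]
            push_cast
            ring_nf
        _ ≤ _ := Real.exp_le_exp.2 (by linarith)
    have h3 : Real.exp (-R) ≤ Real.exp (l * (9 / 1000 - 3)) :=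
      hER.trans (Real.exp_le_exp.2 (by linarith))
    calc _ = Real.exp 78 * (l / Real.log z) ^ 3 + Real.exp 99 * (Real.log z ^ 9 * Real.exp (-R)) +
          Real.exp 3 * Real.exp (-R) := by ring
      _ ≤ Real.exp 78 * (8 * Real.exp (l * (9 / 1000 - 3))) +
          Real.exp 99 * Real.exp (l * (9 / 1000 - 3)) +
          Real.exp 3 * Real.exp (l * (9 / 1000 - 3)) := by gcongr
      _ = _ := by ring
  have b4 : L / 2 + ω * l - (L / 2 - (ω + 4) * l) + 8 ≤
      (2 * ω + 12) * Real.exp (l * (1 / 1000)) := by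
    rw [← hte]
    have : (2 * ω + 4) * l ≤ (2 * ω + 4) * t := by gcongr
    linarith
  have b4' : 0 ≤ L / 2 + ω * l - (L / 2 - (ω + 4) * l) + 8 := by linarith
  have b5 := calc
    N * (Real.exp 78 * (l / Real.log z) ^ 3 + Real.exp 99 * Real.log z ^ 9 * Real.exp (-R) +
      Real.exp (-R) * Real.exp 3) * (Real.exp 60 * L ^ (√2 - 1 / 2) *
        (L / 2 + ω * l - (L / 2 - (ω + 4) * l) + 8))
      ≤ N * ((8 * Real.exp 78 + Real.exp 99 + Real.exp 3) * Real.exp (l * (9 / 1000 - 3))) *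
        (Real.exp 60 * L ^ (√2 - 1 / 2) * ((2 * ω + 12) * Real.exp (l * (1 / 1000)))) := by
        gcongr
    _ = (8 * Real.exp 78 + Real.exp 99 + Real.exp 3) * Real.exp 60 * (2 * ω + 12) * N *
        Real.exp (l * (9 / 1000 - 3) + l * (√2 - 1 / 2) + l * (1 / 1000)) := by
        rw [hrpow, Real.exp_add, Real.exp_add]
        ring
    _ ≤ (8 * Real.exp 78 + Real.exp 99 + Real.exp 3) * Real.exp 60 * (2 * ω + 12) * N *
        L ^ θ := by
        rw [hrpow]
        gcongr
        linarith
  simp only [inP, ← hL, hu, hv]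
  calc _ ≤ _ := hmain
    _ ≤ 5 * N * L ^ θ + Real.exp 26 * N * L ^ θ +
        (8 * Real.exp 78 + Real.exp 99 + Real.exp 3) * Real.exp 60 * (2 * ω + 12) * N * L ^ θ :=
        add_le_add (add_le_add b1 (hΩ.trans b2)) (hsum.trans b5)
    _ = _ := by ring

/-- the number of ordered pairs of primes (p₁, p₂) with
p₁ + p₂ = n and p₁ ∈ 𝒫 is ≪ N L^{-2-2θ₀} (log L)⁶, uniformly in 1 ≤ n ≤ N. -/
theorem goldbach_pairs_with_restricted_divisor :
    ∀ ω : ℝ, 0 < ω → ∃ C : ℝ, 0 < C ∧ ∃ N0 : ℕ, ∀ N : ℕ, N0 ≤ N → ∀ n : ℕ, 1 ≤ n → n ≤ N →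
      (((Finset.range (N + 1) ×ˢ Finset.range (N + 1)).filter
          (fun q => q.1.Prime ∧ q.2.Prime ∧ q.1 + q.2 = n ∧ inP N ω q.1)).card : ℝ) ≤
        C * (N : ℝ) * Real.log N ^ (-2 - 2 * theta0) * Real.log (Real.log N) ^ 6 := by
  intro ω hω
  obtain ⟨x₀, hx₀⟩ := exists_mul_log_add_le_rpow (76 + 4 * ω) (1 / 1000) (by norm_num)
  refine ⟨5 + Real.exp 26 + (8 * Real.exp 78 + Real.exp 99 + Real.exp 3) * Real.exp 60 *
    (2 * ω + 12), by positivity, ⌈Real.exp (max x₀ 3)⌉₊, fun N hN n _ hnN => ?_⟩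
  have hNexp : Real.exp (max x₀ 3) ≤ N := Nat.ceil_le.1 hN
  have hN0 : (0 : ℝ) < N := (Real.exp_pos _).trans_le hNexp
  have hlog : max x₀ 3 ≤ Real.log N := (Real.le_log_iff_exp_le hN0).2 hNexp
  have hlog3 : 3 ≤ Real.log N := (le_max_right _ _).trans hlog
  have hloglog : 1 ≤ Real.log (Real.log N) := by
    rw [Real.le_log_iff_exp_le (by linarith)]
    have := Real.exp_one_lt_d9
    linarith
  rcases Nat.lt_or_ge n 2 with hn | hn
  · rw [filter_false_of_mem, card_empty, Nat.cast_zero]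
    · positivity
    · rintro q - ⟨h1, h2, h3, -⟩
      have := h1.two_le
      omega
  · refine (card_goldbach_inP_le hω hlog3 hn hnN
      (hx₀ _ ((le_max_left _ _).trans hlog))).trans ?_
    exact le_mul_of_one_le_right (by positivity) (one_le_pow₀ hloglog)
end
end
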